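/- arXiv:1706.06269 — 5 statements merged into one kernel-verified Lean document; each statement's English description precedes it below -/
import Mathlib

section
/- Let α₀ and β be units of R, let λ = α₀^{p^s} + γβ, and suppose x^n − α₀ is basic irreducible over R. Let C = ⟨(x^n − α₀)^ν⟩ be an ideal of R[x]/⟨x^{np^s} − λ⟩, where 0 ≤ ν ≤ 2p^s. Then the Hamming distance of C is: 1 if 0 ≤ ν ≤ p^s; ℓ + 2 if p^s + ℓp^{s−1} + 1 ≤ ν ≤ p^s + (ℓ+1)p^{s−1} for some 0 ≤ ℓ ≤ p − 2; (i+1)p^k if 2p^s − p^{s−k} + (i−1)p^{s−k−1} + 1 ≤ ν ≤ 2p^s − p^{s−k} + i·p^{s−k−1} for some 1 ≤ i ≤ p − 1 and 1 ≤ k ≤ s − 1; and 0 if ν = 2p^s. -/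
open Polynomial

/-- The unique representative of degree `< deg q` of an element of `A[x]/⟨q⟩`
(for `q` monic). -/
noncomputable def polyRep {A : Type} [CommRing A] (q : A[X]) (c : A[X] ⧸ Ideal.span {q}) :
    A[X] :=
  Function.surjInv Ideal.Quotient.mk_surjective c %ₘ q

/-- Hamming weight of a codeword. -/
noncomputable def wH {A : Type} [CommRing A] (q : A[X]) (c : A[X] ⧸ Ideal.span {q}) : ℕ :=
  (polyRep q c).support.card

/-- Hamming distance of a code (an ideal of `A[x]/⟨q⟩`); `0` for the zero code. -/
noncomputable def dH {A : Type} [CommRing A] (q : A[X])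
    (I : Ideal (A[X] ⧸ Ideal.span {q})) : ℕ :=
  sInf {w : ℕ | ∃ c ∈ I, c ≠ 0 ∧ w = wH q c}


/-- digit product -/
def digitProd (p : ℕ) (hp : 2 ≤ p) (v : ℕ) : ℕ :=
  if h : v = 0 then 1 else (v % p + 1) * digitProd p hp (v / p)
termination_by v
decreasing_by exact Nat.div_lt_self (Nat.pos_of_ne_zero h) (by omega)

lemma digitProd_zero (p : ℕ) (hp : 2 ≤ p) : digitProd p hp 0 = 1 := by
  rw [digitProd]; simp

lemma digitProd_rec (p : ℕ) (hp : 2 ≤ p) (v : ℕ) :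
    digitProd p hp v = (v % p + 1) * digitProd p hp (v / p) := by
  by_cases h : v = 0
  · subst h; simp [digitProd_zero]
  · conv_lhs => rw [digitProd]
    simp [h]

lemma digitProd_pos (p : ℕ) (hp : 2 ≤ p) (v : ℕ) : 1 ≤ digitProd p hp v := by
  induction v using Nat.strong_induction_on with
  | _ v ih =>
    by_cases h : v = 0
    · subst h; simp [digitProd_zero]
    · rw [digitProd_rec]
      have := ih (v / p) (Nat.div_lt_self (by omega) (by omega))
      nlinarith [Nat.zero_le (v % p)]

lemma digitProd_div_le (p : ℕ) (hp : 2 ≤ p) (v : ℕ) :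
    digitProd p hp (v / p) ≤ digitProd p hp v := by
  rw [digitProd_rec p hp v]; exact Nat.le_mul_of_pos_left _ (by omega)

lemma digitProd_full (p : ℕ) (hp : 2 ≤ p) (k v : ℕ) (h : v + 1 = p ^ k) :
    digitProd p hp v = p ^ k := by
  induction k generalizing v with
  | zero => have : v = 0 := by simpa using h
            subst this; simp [digitProd_zero]
  | succ k ih =>
    obtain ⟨w, hw⟩ : ∃ w, w + 1 = p ^ k := ⟨p ^ k - 1, Nat.sub_add_cancel (Nat.pos_of_ne_zero (by positivity))⟩
    have hv : v = p * w + (p - 1) := by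
      have : p ^ (k+1) = p * (w + 1) := by rw [hw]; ring
      rw [this, mul_add] at h; omega
    have h1 : v / p = w := by
      rw [hv, Nat.mul_add_div (by omega), Nat.div_eq_of_lt (by omega)]; simp
    have h2 : v % p = p - 1 := by
      rw [hv, Nat.mul_add_mod, Nat.mod_eq_of_lt (by omega)]
    rw [digitProd_rec, h1, h2, ih w hw, pow_succ, Nat.sub_add_cancel (by omega), mul_comm]

lemma digitProd_ge (p : ℕ) (hp : 2 ≤ p) (k j t v : ℕ)     (hv : v < p ^ (k + 1 + t)) (h : p ^ (k + 1 + t) + j * p ^ t ≤ v + p ^ (t + 1)) :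
    (j + 1) * p ^ k ≤ digitProd p hp v := by
  induction t generalizing v with
  | zero =>
    simp only [add_zero, pow_zero, mul_one, zero_add, pow_one] at hv h
    have hd := Nat.div_add_mod v p
    have hr := Nat.mod_lt v (show 0 < p by omega)
    rw [pow_succ] at hv h
    have h1 : v / p < p ^ k := Nat.div_lt_of_lt_mul (by rw [mul_comm]; exact hv)
    have h2 : p ^ k ≤ v / p + 1 := by
      by_contra hc
      have : p * (v / p + 2) ≤ p * p ^ k := Nat.mul_le_mul_left _ (by omega)
      nlinarith
    have h3 : v / p + 1 = p ^ k := by omega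
    have h4 : j ≤ v % p := by
      have : p * (v / p + 1) = p * p ^ k := by rw [h3]
      nlinarith
    rw [digitProd_rec, digitProd_full p hp k _ h3]
    exact Nat.mul_le_mul_right _ (by omega)
  | succ t ih =>
    refine le_trans (ih (v / p) ?_ ?_) (digitProd_div_le p hp v)
    · exact Nat.div_lt_of_lt_mul (by rw [← pow_succ']; exact hv)
    · have hd := Nat.div_add_mod v p
      have hr := Nat.mod_lt v (show 0 < p by omega)
      have e1 : p ^ (k + 1 + (t + 1)) = p * p ^ (k + 1 + t) := by ring
      have e2 : p ^ (t + 1 + 1) = p * p ^ (t + 1) := by ring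
      have e3 : j * p ^ (t + 1) = p * (j * p ^ t) := by ring
      rw [e1, e2, e3] at h
      by_contra hc
      have : p * (v / p + p ^ (t + 1) + 1) ≤ p * (p ^ (k + 1 + t) + j * p ^ t) :=
        Nat.mul_le_mul_left _ (by omega)
      nlinarith

lemma digitProd_gt (p : ℕ) (hp : 2 ≤ p) (k j t v : ℕ) (hj : j + 1 < p)
    (hv : v < p ^ (k + 1 + t)) (h : p ^ (k + 1 + t) + j * p ^ t < v + p ^ (t + 1)) :
    (j + 2) * p ^ k ≤ digitProd p hp v := by
  induction t generalizing v with
  | zero =>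
    apply digitProd_ge p hp k (j + 1) 0 v hv
    simp only [pow_zero, mul_one] at h ⊢; omega
  | succ t ih =>
    have hd := Nat.div_add_mod v p
    have hr := Nat.mod_lt v (show 0 < p by omega)
    have e1 : p ^ (k + 1 + (t + 1)) = p * p ^ (k + 1 + t) := by ring
    have e2 : p ^ (t + 1 + 1) = p * p ^ (t + 1) := by ring
    have e3 : j * p ^ (t + 1) = p * (j * p ^ t) := by ring
    have hv' : v / p < p ^ (k + 1 + t) := Nat.div_lt_of_lt_mul (by rw [← pow_succ']; exact hv)
    rw [e1, e2, e3] at h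
    by_cases hc : p ^ (k + 1 + t) + j * p ^ t < v / p + p ^ (t + 1)
    · exact le_trans (ih (v / p) hv' hc) (digitProd_div_le p hp v)
    · have h1 : p ^ (k + 1 + t) + j * p ^ t ≤ v / p + p ^ (t + 1) := by
        by_contra hc
        have : p * (v / p + p ^ (t + 1) + 1) ≤ p * (p ^ (k + 1 + t) + j * p ^ t) :=
          Nat.mul_le_mul_left _ (by omega)
        nlinarith
      have h2 : 1 ≤ v % p := by
        have : p * (v / p + p ^ (t + 1)) ≤ p * (p ^ (k + 1 + t) + j * p ^ t) :=
          Nat.mul_le_mul_left _ (by omega)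
        nlinarith
      have h3 := digitProd_ge p hp k j t (v / p) hv' h1
      rw [digitProd_rec]
      calc (j + 2) * p ^ k ≤ 2 * ((j + 1) * p ^ k) := by nlinarith [Nat.zero_le (p ^ k), Nat.zero_le (j * p^k)]
        _ ≤ _ := Nat.mul_le_mul (by omega) h3

/-- polyphase component -/
noncomputable def comp' {F : Type} [Field F] (n j : ℕ) (f : F[X]) : F[X] :=
  ∑ k ∈ Finset.range (f.natDegree + 1), monomial k (f.coeff (k * n + j))

lemma comp'_coeff {F : Type} [Field F] (n j : ℕ) (hn : 0 < n) (f : F[X]) (k : ℕ) :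
    (comp' n j f).coeff k = f.coeff (k * n + j) := by
  unfold comp'
  simp only [finsetSum_coeff, coeff_monomial, Finset.sum_ite_eq', Finset.mem_range]
  split_ifs with h
  · rfl
  · rw [coeff_eq_zero_of_natDegree_lt]
    nlinarith

lemma comp'_expand_mul {F : Type} [Field F] (n j : ℕ) (hn : 0 < n) (hj : j < n) (g h : F[X]) :
    comp' n j (expand F n g * h) = g * comp' n j h := by
  induction g using Polynomial.induction_on' with
  | add a b ha hb =>
    ext k
    rw [map_add, add_mul, add_mul, comp'_coeff _ _ hn, coeff_add, coeff_add, ← ha, ← hb,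
      comp'_coeff _ _ hn, comp'_coeff _ _ hn]
  | monomial e c =>
    ext k
    rw [comp'_coeff _ _ hn, expand_monomial, ← C_mul_X_pow_eq_monomial, ← C_mul_X_pow_eq_monomial,
      mul_assoc, mul_assoc, coeff_C_mul, coeff_C_mul, coeff_X_pow_mul', coeff_X_pow_mul',
      comp'_coeff _ _ hn]
    have : e * n ≤ k * n + j ↔ e ≤ k := by
      constructor
      · intro h
        by_contra hc
        have : (k + 1) * n ≤ e * n := Nat.mul_le_mul_right _ (by omega)
        nlinarith
      · intro h
        have : e * n ≤ k * n := Nat.mul_le_mul_right _ h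
        omega
    simp only [this]
    split_ifs with h
    · congr 2
      obtain ⟨d, rfl⟩ := Nat.exists_eq_add_of_le h
      rw [add_mul]; simp; omega
    · rfl

lemma comp'_decomp {F : Type} [Field F] (n : ℕ) (hn : 0 < n) (f : F[X]) :
    f = ∑ j ∈ Finset.range n, X ^ j * expand F n (comp' n j f) := by
  ext k
  rw [finsetSum_coeff, Finset.sum_eq_single (k % n)]
  · rw [coeff_X_pow_mul', if_pos (Nat.mod_le _ _), coeff_expand hn, if_pos (Nat.dvd_sub_mod k),
      comp'_coeff _ _ hn, Nat.div_mul_cancel (Nat.dvd_sub_mod k),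
      Nat.sub_add_cancel (Nat.mod_le _ _)]
  · intro j hj hne
    rw [coeff_X_pow_mul']
    split_ifs with h
    · rw [coeff_expand hn, if_neg]
      intro hd
      apply hne
      obtain ⟨c, hc⟩ := hd
      have : k = n * c + j := by omega
      rw [this, Nat.mul_add_mod, Nat.mod_eq_of_lt (Finset.mem_range.1 hj)]
    · rfl
  · intro h
    exact absurd (Finset.mem_range.2 (Nat.mod_lt _ hn)) h

lemma comp'_card {F : Type} [Field F] (n : ℕ) (hn : 0 < n) (f : F[X]) (J : Finset ℕ)
    (hJ : ∀ j ∈ J, j < n) :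
    ∑ j ∈ J, (comp' n j f).support.card ≤ f.support.card := by
  rw [← Finset.card_sigma]
  apply Finset.card_le_card_of_injOn (fun x => x.2 * n + x.1)
  · rintro ⟨j, k⟩ h
    simp only [Finset.mem_coe, Finset.mem_sigma, mem_support_iff, comp'_coeff _ _ hn] at h
    simpa using h.2
  · rintro ⟨j, k⟩ h ⟨j', k'⟩ h' e
    simp only [Finset.mem_coe, Finset.mem_sigma] at h h'
    have a := hJ _ h.1
    have b := hJ _ h'.1
    simp only at e
    have e1 : j = j' := by
      have := congrArg (· % n) e
      simpa [Nat.mod_eq_of_lt a, Nat.mod_eq_of_lt b] using this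
    subst e1
    have e2 : k = k' := Nat.eq_of_mul_eq_mul_right hn (by omega)
    subst e2; rfl

lemma comp'_congr {F : Type} [Field F] (n : ℕ) (hn : 0 < n) (h : F[X]) (b : F) :
    expand F n (X - C b) ∣ h - ∑ j ∈ Finset.range n, X ^ j * C ((comp' n j h).eval b) := by
  have key : h - ∑ j ∈ Finset.range n, X ^ j * C ((comp' n j h).eval b) =
      ∑ j ∈ Finset.range n, X ^ j * expand F n (comp' n j h - C ((comp' n j h).eval b)) := by
    simp only [map_sub, mul_sub, expand_C, Finset.sum_sub_distrib]
    rw [← comp'_decomp n hn h]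
  rw [key]
  apply Finset.dvd_sum
  intro j _
  apply Dvd.dvd.mul_left
  obtain ⟨g, hg⟩ := X_sub_C_dvd_sub_C_eval (a := b) (p := comp' n j h)
  rw [hg, map_mul]
  exact dvd_mul_right _ _

lemma sparse_low {F : Type} [Field F] (p : ℕ) [CharP F p] (a : F) (ha : a ≠ 0) (r : ℕ)
    (u : F[X]) (hu : u ≠ 0) (hdeg : ∀ k ∈ u.support, k < p) (hd : (X - C a) ^ r ∣ u) :
    r + 1 ≤ u.support.card := by
  induction r generalizing u with
  | zero => 
    have : u.support.Nonempty := by simpa using hu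
    have := this.card_pos
    omega
  | succ r ih =>
    obtain ⟨m, hm⟩ : u.support.Nonempty := by simpa using hu
    set w : F[X] := X * derivative u - C (m : F) * u with hw
    have hco : ∀ k, w.coeff k = ((k : F) - m) * u.coeff k := by
      intro k
      rw [hw, coeff_sub, coeff_C_mul]
      cases k with
      | zero => simp
      | succ k => rw [coeff_X_mul, coeff_derivative]; push_cast; ring
    have hsub : w.support ⊆ u.support.erase m := by
      intro k hk
      rw [mem_support_iff, hco] at hk
      rw [Finset.mem_erase, mem_support_iff]
      refine ⟨?_, right_ne_zero_of_mul hk⟩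
      rintro rfl
      simp at hk
    have hcard : w.support.card + 1 ≤ u.support.card := by
      rw [← Finset.card_erase_add_one hm]
      exact Nat.succ_le_succ (Finset.card_le_card hsub)
    have hdw : (X - C a) ^ r ∣ w := by
      obtain ⟨g, hg⟩ := hd
      apply dvd_sub
      · apply Dvd.dvd.mul_left
        rw [hg, derivative_mul]
        apply dvd_add
        · apply Dvd.dvd.mul_right
          rw [derivative_X_sub_C_pow]
          exact Dvd.intro_left _ rfl
        · exact Dvd.dvd.mul_right (pow_dvd_pow _ (by omega)) _
      · exact Dvd.dvd.mul_left ((pow_dvd_pow _ (by omega)).trans ⟨g, hg⟩) _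
    have hw0 : w ≠ 0 := by
      intro h0
      have huk : ∀ k, k ≠ m → u.coeff k = 0 := by
        intro k hk
        by_contra hne
        have h1 := hco k
        rw [h0, coeff_zero, eq_comm, mul_eq_zero] at h1
        rcases h1 with h1 | h1
        · rw [sub_eq_zero, CharP.cast_eq_iff_mod_eq F p,
            Nat.mod_eq_of_lt (hdeg k (mem_support_iff.2 hne)), Nat.mod_eq_of_lt (hdeg m hm)] at h1
          exact hk h1
        · exact hne h1
      have hum : u = C (u.coeff m) * X ^ m := by
        ext k
        rw [coeff_C_mul, coeff_X_pow]
        split_ifs with h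
        · simp [h]
        · rw [huk k h]; simp
      have : u.eval a = 0 := by
        have : X - C a ∣ u := (dvd_pow_self _ (by omega)).trans hd
        exact dvd_iff_isRoot.1 this
      rw [hum] at this
      simp [ha] at this
      rw [mem_support_iff] at hm
      exact hm this
    have := ih w hw0 (fun k hk => hdeg k (Finset.mem_of_mem_erase (hsub hk))) hdw
    omega

lemma massey {F : Type} [Field F] (p : ℕ) (hp : p.Prime) [CharP F p] (v : ℕ) (a : F) (ha : a ≠ 0)
    (g : F[X]) (hg : g.eval a ≠ 0) :
    digitProd p hp.two_le v ≤ ((X - C a) ^ v * g).support.card := by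
  have := Fact.mk hp
  induction v using Nat.strong_induction_on generalizing a g with
  | _ v ih =>
  by_cases hv : v = 0
  · subst hv
    rw [digitProd_zero, pow_zero, one_mul]
    have : g ≠ 0 := by rintro rfl; simp at hg
    have : g.support.Nonempty := by simpa using this
    exact this.card_pos
  set q := v / p
  set r := v % p
  have hr : r < p := Nat.mod_lt v hp.pos
  have hvq : v = p * q + r := (Nat.div_add_mod v p).symm
  have hXp : (X - C a : F[X]) ^ p = expand F p (X - C (a ^ p)) := by
    rw [sub_pow_char]; simp
  set h : F[X] := (X - C a) ^ r * g with hh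
  have hf : (X - C a) ^ v * g = expand F p ((X - C (a ^ p)) ^ q) * h := by
    rw [map_pow, ← hXp, ← pow_mul, hvq, pow_add, mul_assoc]
  have hh0 : ¬ (X - C a) ^ p ∣ h := by
    intro hd
    have : (X - C a) ^ (r + 1) ∣ (X - C a) ^ r * g := (pow_dvd_pow _ (by omega)).trans hd
    rw [pow_succ] at this
    have := (mul_dvd_mul_iff_left (pow_ne_zero r (X_sub_C_ne_zero a))).1 this
    exact hg (dvd_iff_isRoot.1 this)
  set u : F[X] := ∑ j ∈ Finset.range p, X ^ j * C ((comp' p j h).eval (a ^ p)) with hu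
  have hcong : (X - C a) ^ p ∣ h - u := by
    rw [hXp]
    exact comp'_congr p hp.pos h (a ^ p)
  have hu0 : u ≠ 0 := by
    intro h0
    rw [h0, sub_zero] at hcong
    exact hh0 hcong
  have hucoeff : ∀ k, u.coeff k = if k < p then (comp' p k h).eval (a ^ p) else 0 := by
    intro k
    rw [hu, finsetSum_coeff]
    simp only [coeff_mul_C, coeff_X_pow, ite_mul, one_mul, zero_mul, Finset.sum_ite_eq,
      Finset.mem_range]
  have hlow := sparse_low p a ha r u hu0 (by
    intro k hk
    rw [mem_support_iff, hucoeff] at hk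
    by_contra hc
    simp [hc] at hk) (by
    have h1 : (X - C a) ^ r ∣ h - u := (pow_dvd_pow _ hr.le).trans hcong
    have h2 : (X - C a) ^ r ∣ h := Dvd.intro _ rfl
    exact (dvd_sub_right h2).1 h1)
  rw [digitProd_rec]
  refine le_trans ?_ (comp'_card p hp.pos _ u.support ?_)
  · calc (r + 1) * digitProd p hp.two_le q ≤ u.support.card * digitProd p hp.two_le q :=
          Nat.mul_le_mul_right _ hlow
      _ = ∑ j ∈ u.support, digitProd p hp.two_le q := by simp
      _ ≤ _ := by
        apply Finset.sum_le_sum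
        intro j hj
        rw [mem_support_iff, hucoeff] at hj
        have hjp : j < p := by
          by_contra hc
          simp [hc] at hj
        rw [if_pos hjp] at hj
        rw [hf, comp'_expand_mul p j hp.pos hjp]
        exact ih q (Nat.div_lt_self (by omega) hp.one_lt) (a ^ p) (pow_ne_zero _ ha) _ hj
  · intro k hk
    rw [mem_support_iff, hucoeff] at hk
    by_contra hc
    simp [hc] at hk

/-- lower bound over the field -/
lemma field_lower {F : Type} [Field F] (p : ℕ) (hp : p.Prime) [CharP F p] (n : ℕ) (hn : 0 < n)
    (k j t μ : ℕ) (hj : j + 1 < p) (hμ : p ^ (k + 1 + t) + j * p ^ t < μ + p ^ (t + 1))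
    (a : F) (ha : a ≠ 0) (f : F[X]) (hf : f ≠ 0) (hdeg : f.natDegree < n * p ^ (k + 1 + t))
    (hd : (X ^ n - C a) ^ μ ∣ f) : (j + 2) * p ^ k ≤ f.support.card := by
  obtain ⟨i, hi, hi0⟩ : ∃ i < n, comp' n i f ≠ 0 := by
    by_contra hc
    push Not at hc
    apply hf
    rw [comp'_decomp n hn f]
    apply Finset.sum_eq_zero
    intro i hi
    rw [hc i (Finset.mem_range.1 hi)]; simp
  have hd' : (X - C a) ^ μ ∣ comp' n i f := by
    obtain ⟨g, rfl⟩ := hd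
    have : (X ^ n - C a : F[X]) ^ μ = expand F n ((X - C a) ^ μ) := by simp
    rw [this, comp'_expand_mul n i hn hi]
    exact Dvd.intro _ rfl
  have hcard : (comp' n i f).support.card ≤ f.support.card := by
    simpa using comp'_card n hn f {i} (by simpa using hi)
  refine le_trans ?_ hcard
  have hdeg' : (comp' n i f).natDegree < p ^ (k + 1 + t) := by
    by_contra hc
    have h1 : (comp' n i f).coeff (comp' n i f).natDegree ≠ 0 := by simpa using hi0
    rw [comp'_coeff _ _ hn] at h1
    have h2 := le_natDegree_of_ne_zero h1
    have : p ^ (k + 1 + t) * n ≤ (comp' n i f).natDegree * n := Nat.mul_le_mul_right _ (by omega)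
    nlinarith
  obtain ⟨g, hg, hg0⟩ := exists_eq_pow_rootMultiplicity_mul_and_not_dvd (comp' n i f) hi0 a
  set v := rootMultiplicity a (comp' n i f)
  have hμv : μ ≤ v := (le_rootMultiplicity_iff hi0).2 hd'
  have hvlt : v < p ^ (k + 1 + t) := by
    refine lt_of_le_of_lt ?_ hdeg'
    rw [hg, natDegree_mul (pow_ne_zero _ (X_sub_C_ne_zero a)) (by rintro rfl; simp at hg0)]
    simp
  rw [hg]
  refine le_trans (digitProd_gt p hp.two_le k j t v hj hvlt (by omega)) (massey p hp v a ha g ?_)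
  intro h
  exact hg0 (dvd_iff_isRoot.2 h)

lemma card_pow_le {F : Type} [Field F] (m : ℕ) (hm : 0 < m) (b : F) (e : ℕ) :
    ((X ^ m - C b : F[X]) ^ e).support.card ≤ e + 1 := by
  have : (X ^ m - C b : F[X]) ^ e = expand F m ((X - C b) ^ e) := by simp
  rw [this]
  have hsub : (expand F m ((X - C b) ^ e)).support ⊆
      (Finset.range (e + 1)).image (fun i => i * m) := by
    intro k hk
    rw [mem_support_iff, coeff_expand hm] at hk
    split_ifs at hk with hd
    · rw [Finset.mem_image]
      refine ⟨k / m, ?_, Nat.div_mul_cancel hd⟩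
      have := le_natDegree_of_ne_zero hk
      rw [natDegree_pow, natDegree_X_sub_C] at this
      rw [Finset.mem_range]; omega
    · exact absurd rfl hk
  refine le_trans (Finset.card_le_card hsub) (le_trans Finset.card_image_le ?_)
  simp

lemma field_upper {F : Type} [Field F] (p : ℕ) (hp : p.Prime) [CharP F p] (n : ℕ) (hn : 0 < n)
    (k j t M : ℕ) (hM : M + p ^ (t + 1) = p ^ (k + 1 + t) + j * p ^ t)
    (a : F) : ((X ^ n - C a : F[X]) ^ M).support.card ≤ (j + 1) * p ^ k := by
  have := Fact.mk hp
  obtain ⟨w, hw⟩ : ∃ w, w + 1 = p ^ k :=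
    ⟨p ^ k - 1, Nat.sub_add_cancel (Nat.pow_pos hp.pos)⟩
  have hM' : M = p ^ (t + 1) * w + p ^ t * j := by
    have : p ^ (k + 1 + t) = p ^ (t + 1) * (w + 1) := by rw [hw]; ring
    rw [this] at hM
    nlinarith
  rw [hM', pow_add, pow_mul, pow_mul, sub_pow_char_pow, sub_pow_char_pow, ← pow_mul, ← pow_mul,
    ← C_pow, ← C_pow, ← hw, mul_comm (j + 1)]
  exact le_trans (card_support_mul_le) (Nat.mul_le_mul
    (card_pow_le _ (Nat.mul_pos hn (Nat.pow_pos hp.pos)) _ _)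
    (card_pow_le _ (Nat.mul_pos hn (Nat.pow_pos hp.pos)) _ _))

lemma wH_mk {A : Type} [CommRing A] (q : A[X]) (hq : q.Monic) (f : A[X]) :
    wH q (Ideal.Quotient.mk (Ideal.span {q}) f) = (f %ₘ q).support.card := by
  unfold wH polyRep
  congr 2
  apply modByMonic_eq_of_dvd_sub hq
  rw [← Ideal.mem_span_singleton, ← Ideal.Quotient.eq]
  exact Function.surjInv_eq _ _

lemma dH_eq {A : Type} [CommRing A] (q : A[X]) (I : Ideal (A[X] ⧸ Ideal.span {q})) (d : ℕ)
    (h1 : ∃ c ∈ I, c ≠ 0 ∧ wH q c ≤ d) (h2 : ∀ c ∈ I, c ≠ 0 → d ≤ wH q c) : dH q I = d := by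
  unfold dH
  obtain ⟨c, hc, hc0, hcd⟩ := h1
  apply le_antisymm
  · exact le_trans (Nat.sInf_le ⟨c, hc, hc0, rfl⟩) hcd
  · refine le_csInf ⟨wH q c, c, hc, hc0, rfl⟩ ?_
    rintro w ⟨c, hc, hc0, rfl⟩
    exact h2 c hc hc0

lemma mk_eq_zero_iff' {A : Type} [CommRing A] (q : A[X]) (hq : q.Monic) (f : A[X]) :
    Ideal.Quotient.mk (Ideal.span {q}) f = 0 ↔ f %ₘ q = 0 := by
  rw [Ideal.Quotient.eq_zero_iff_mem, Ideal.mem_span_singleton, modByMonic_eq_zero_iff_dvd hq]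

lemma wH_pos {A : Type} [CommRing A] (q : A[X]) (hq : q.Monic) (c : A[X] ⧸ Ideal.span {q})
    (hc : c ≠ 0) : 1 ≤ wH q c := by
  obtain ⟨f, rfl⟩ := Ideal.Quotient.mk_surjective c
  rw [wH_mk q hq]
  have h : f %ₘ q ≠ 0 := fun h => hc ((mk_eq_zero_iff' q hq f).2 h)
  have : (f %ₘ q).support.Nonempty := by simpa using h
  exact this.card_pos

lemma key_unit {R : Type} [CommRing R] (p s n : ℕ) (hp : p.Prime)
    (γ : R) (hγ2 : γ ^ 2 = 0) (hpγ : (p : R) ∈ Ideal.span {γ})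
    (α₀ β : R) (hβ : IsUnit β) (q : R[X])
    (hq : q = X ^ (n * p ^ s) - C (α₀ ^ p ^ s + γ * β)) :
    ∃ u : R[X] ⧸ Ideal.span {q}, IsUnit u ∧
      (Ideal.Quotient.mk (Ideal.span {q}) (X ^ n - C α₀)) ^ p ^ s =
        Ideal.Quotient.mk (Ideal.span {q}) (C γ) * u := by
  obtain ⟨c, hc⟩ := Ideal.mem_span_singleton.1 hpγ
  obtain ⟨r, hr⟩ := exists_add_pow_prime_pow_eq hp (X ^ n - C α₀) (C α₀ : R[X]) s
  have hpC : (p : R[X]) = C γ * C c := by rw [← C_mul, ← hc]; simp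
  have hpoly : (X ^ n - C α₀ : R[X]) ^ p ^ s =
      C γ * (C β - (X ^ n - C α₀) * (C c * C α₀ * r)) + q := by
    rw [sub_add_cancel, ← pow_mul] at hr
    rw [hq, hr, hpC]
    simp only [C_add, C_mul, C_pow]
    ring
  have hmk : (Ideal.Quotient.mk (Ideal.span {q}) (X ^ n - C α₀)) ^ p ^ s =
      Ideal.Quotient.mk (Ideal.span {q}) (C γ) *
      (Ideal.Quotient.mk (Ideal.span {q}) (C β) - Ideal.Quotient.mk (Ideal.span {q}) (X ^ n - C α₀)
        * Ideal.Quotient.mk (Ideal.span {q}) (C c * C α₀ * r)) := by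
    have hq0 : Ideal.Quotient.mk (Ideal.span {q}) q = 0 := by
      rw [Ideal.Quotient.eq_zero_iff_mem]; exact Ideal.mem_span_singleton_self q
    rw [← map_pow, hpoly, map_add, hq0, add_zero, map_mul, map_sub, map_mul]
  refine ⟨_, ?_, hmk⟩
  have hg2 : Ideal.Quotient.mk (Ideal.span {q}) (C γ) ^ 2 = 0 := by
    rw [← map_pow, ← C_pow, hγ2]; simp
  have hnil : IsNilpotent (Ideal.Quotient.mk (Ideal.span {q}) (X ^ n - C α₀)) :=
    ⟨p ^ s * 2, by rw [pow_mul, hmk, mul_pow, hg2, zero_mul]⟩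
  have hu : IsUnit (Ideal.Quotient.mk (Ideal.span {q}) (C β)) :=
    (hβ.map C).map (Ideal.Quotient.mk (Ideal.span {q}))
  rw [sub_eq_add_neg]
  refine IsNilpotent.isUnit_add_left_of_commute ?_ hu (Commute.all _ _)
  exact ((Commute.all _ _).isNilpotent_mul_right hnil).neg

lemma support_gamma {R : Type} [CommRing R] (γ : R) (hγ : γ ≠ 0) (hγ2 : γ ^ 2 = 0)
    (hmax : ∀ a : R, a ∈ Ideal.span {γ} ↔ ¬ IsUnit a) (f : R[X]) :
    (C γ * f).support = (f.map (Ideal.Quotient.mk (Ideal.span {γ}))).support := by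
  ext k
  rw [mem_support_iff, mem_support_iff, coeff_C_mul, coeff_map, not_iff_not,
    Ideal.Quotient.eq_zero_iff_mem]
  constructor
  · intro h
    rw [hmax]
    intro hu
    exact hγ ((hu.mul_left_eq_zero).1 h)
  · intro h
    obtain ⟨c, hc⟩ := Ideal.mem_span_singleton.1 h
    rw [hc, ← mul_assoc, ← pow_two, hγ2, zero_mul]

lemma dH_mid {R : Type} [CommRing R] [Nontrivial R]
    (p k j t n : ℕ) (hp : p.Prime) (hn : 0 < n)
    (γ : R) (hγ : γ ≠ 0) (hγ2 : γ ^ 2 = 0)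
    (hmax : ∀ a : R, a ∈ Ideal.span {γ} ↔ ¬ IsUnit a)
    (hM : (Ideal.span {γ}).IsMaximal) (hchar : CharP (R ⧸ Ideal.span {γ}) p)
    (α₀ β : R) (hα₀ : IsUnit α₀) (hβ : IsUnit β) (q : R[X])
    (hq : q = X ^ (n * p ^ (k + 1 + t)) - C (α₀ ^ p ^ (k + 1 + t) + γ * β))
    (μ : ℕ) (hj : j + 1 < p)
    (h1 : p ^ (k + 1 + t) + j * p ^ t < μ + p ^ (t + 1))
    (h2 : μ + p ^ (t + 1) ≤ p ^ (k + 1 + t) + (j + 1) * p ^ t) :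
    dH q (Ideal.span {Ideal.Quotient.mk (Ideal.span {q})
      ((X ^ n - C α₀) ^ (p ^ (k + 1 + t) + μ))}) = (j + 2) * p ^ k := by
  letI : Field (R ⧸ Ideal.span {γ}) := Ideal.Quotient.field _
  have := Fact.mk hp
  have hpγ : (p : R) ∈ Ideal.span {γ} := by
    rw [← Ideal.Quotient.eq_zero_iff_mem, map_natCast]
    exact CharP.cast_eq_zero _ _
  obtain ⟨u, hu, hkey⟩ := key_unit p (k + 1 + t) n hp γ hγ2 hpγ α₀ β hβ q hq
  set s := k + 1 + t with hs
  have hps : 0 < p ^ s := Nat.pow_pos hp.pos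
  have hN : n * p ^ s ≠ 0 := (Nat.mul_pos hn hps).ne'
  have hqm : q.Monic := by rw [hq]; exact monic_X_pow_sub_C _ hN
  have hqd : q.natDegree = n * p ^ s := by rw [hq]; exact natDegree_X_pow_sub_C
  set φ := Ideal.Quotient.mk (Ideal.span {γ}) with hφ
  set π := Ideal.Quotient.mk (Ideal.span {q}) with hπ
  have ha : φ α₀ ≠ 0 := (hα₀.map φ).ne_zero
  have hφγ : φ γ = 0 := by
    rw [hφ, Ideal.Quotient.eq_zero_iff_mem]; exact Ideal.mem_span_singleton_self γ
  have hqmap : q.map φ = (X ^ n - C (φ α₀)) ^ p ^ s := by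
    rw [hq, sub_pow_char_pow]
    simp [hφγ, pow_mul]
  have hYmap : ∀ e, ((X ^ n - C α₀ : R[X]) ^ e).map φ = (X ^ n - C (φ α₀)) ^ e := by
    intro e; simp
  have hgen : π ((X ^ n - C α₀) ^ (p ^ s + μ)) = π (C γ * (X ^ n - C α₀) ^ μ) * u := by
    rw [map_pow, pow_add, hkey, map_mul, map_pow]; ring
  have hpt : 0 < p ^ t := Nat.pow_pos hp.pos
  have hpt1 : (j + 1) * p ^ t < p ^ (t + 1) := by
    rw [pow_succ']; exact Nat.mul_lt_mul_of_pos_right hj hpt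
  have hts : p ^ (t + 1) ≤ p ^ s := Nat.pow_le_pow_right hp.pos (by omega)
  apply dH_eq
  · obtain ⟨M, hMM⟩ : ∃ M, M + p ^ (t + 1) = p ^ s + (j + 1) * p ^ t :=
      ⟨p ^ s + (j + 1) * p ^ t - p ^ (t + 1), by omega⟩
    have hMlt : M < p ^ s := by omega
    have hrep : (C γ * (X ^ n - C α₀) ^ M) %ₘ q = C γ * (X ^ n - C α₀) ^ M := by
      rw [modByMonic_eq_self_iff hqm]
      apply degree_lt_degree
      rw [hqd]
      refine lt_of_le_of_lt (natDegree_C_mul_le _ _) ?_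
      refine lt_of_le_of_lt natDegree_pow_le ?_
      rw [natDegree_X_pow_sub_C, mul_comm]
      exact Nat.mul_lt_mul_of_pos_left hMlt hn
    have hcard : (C γ * (X ^ n - C α₀) ^ M).support.card =
        ((X ^ n - C (φ α₀)) ^ M).support.card := by
      rw [support_gamma γ hγ hγ2 hmax, hYmap]
    refine ⟨π (C γ * (X ^ n - C α₀) ^ M), ?_, ?_, ?_⟩
    · rw [Ideal.mem_span_singleton, hgen, hu.mul_right_dvd]
      apply _root_.map_dvd
      exact mul_dvd_mul_left _ (pow_dvd_pow _ (by omega))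
    · rw [hπ, Ne, mk_eq_zero_iff' q hqm, hrep]
      intro h0
      rw [h0] at hcard
      rw [support_zero, Finset.card_empty, eq_comm, Finset.card_eq_zero,
        Polynomial.support_eq_empty] at hcard
      exact pow_ne_zero _ (monic_X_pow_sub_C (φ α₀) hn.ne').ne_zero hcard
    · rw [hπ, wH_mk q hqm, hrep, hcard]
      exact field_upper p hp n hn k (j + 1) t M hMM (φ α₀)
  · intro c hc hc0
    rw [Ideal.mem_span_singleton, hgen, hu.mul_right_dvd] at hc
    obtain ⟨d, rfl⟩ := hc
    obtain ⟨g, rfl⟩ := Ideal.Quotient.mk_surjective d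
    rw [← hπ, ← map_mul, mul_assoc] at hc0 ⊢
    have hrep : (C γ * ((X ^ n - C α₀) ^ μ * g)) %ₘ q = C γ * (((X ^ n - C α₀) ^ μ * g) %ₘ q) := by
      rw [← smul_eq_C_mul, smul_modByMonic, smul_eq_C_mul]
    rw [hπ, Ne, mk_eq_zero_iff' q hqm, hrep] at hc0
    rw [hπ, wH_mk q hqm, hrep]
    rw [← Polynomial.support_eq_empty] at hc0
    rw [support_gamma γ hγ hγ2 hmax] at hc0 ⊢
    rw [Polynomial.support_eq_empty] at hc0
    have hmap : (((X ^ n - C α₀) ^ μ * g) %ₘ q).map φ =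
        ((X ^ n - C (φ α₀)) ^ μ * g.map φ) %ₘ (q.map φ) := by
      rw [map_modByMonic φ hqm, Polynomial.map_mul, hYmap]
    refine field_lower p hp n hn k j t μ hj h1 (φ α₀) ha _ hc0 ?_ ?_
    · have h3 : (q.map φ).natDegree = n * p ^ s := by rw [hqm.natDegree_map, hqd]
      rw [hmap, ← hs, ← h3]
      apply natDegree_modByMonic_lt _ (hqm.map φ)
      intro h4
      rw [h4, natDegree_one] at h3
      exact hN h3.symm
    · rw [hmap, modByMonic_eq_sub_mul_div]
      apply dvd_sub (dvd_mul_right _ _)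
      rw [hqmap]
      exact (pow_dvd_pow _ (by omega)).mul_right _

/-- Hamming distances of the `(α₀^{p^s} + γβ)`-constacyclic codes
`⟨(x^n − α₀)^ν⟩` of length `np^s` over a finite chain ring with nilpotency index 2. -/
theorem stmt5 {R : Type} [CommRing R] [Finite R]
    (p m s n : ℕ) (hp : p.Prime) (hm : 0 < m) (hs : 0 < s) (hn : 0 < n)
    (hnp : Nat.gcd n p = 1)
    (γ : R) (hγ : γ ≠ 0) (hγ2 : γ ^ 2 = 0)
    (hmax : ∀ a : R, a ∈ Ideal.span {γ} ↔ ¬ IsUnit a)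
    (hres : Nat.card (R ⧸ Ideal.span {γ}) = p ^ m)
    (α₀ β : R) (hα₀ : IsUnit α₀) (hβ : IsUnit β)
    (hirr : Irreducible ((X ^ n - C α₀ : R[X]).map (Ideal.Quotient.mk (Ideal.span {γ}))))
    (ν : ℕ) (hν : ν ≤ 2 * p ^ s) :
    (ν ≤ p ^ s →
      dH (X ^ (n * p ^ s) - C (α₀ ^ p ^ s + γ * β))
        (Ideal.span {Ideal.Quotient.mk
          (Ideal.span {(X ^ (n * p ^ s) - C (α₀ ^ p ^ s + γ * β) : R[X])})
          ((X ^ n - C α₀) ^ ν)}) = 1) ∧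
    (∀ ℓ, ℓ ≤ p - 2 → p ^ s + ℓ * p ^ (s - 1) + 1 ≤ ν → ν ≤ p ^ s + (ℓ + 1) * p ^ (s - 1) →
      dH (X ^ (n * p ^ s) - C (α₀ ^ p ^ s + γ * β))
        (Ideal.span {Ideal.Quotient.mk
          (Ideal.span {(X ^ (n * p ^ s) - C (α₀ ^ p ^ s + γ * β) : R[X])})
          ((X ^ n - C α₀) ^ ν)}) = ℓ + 2) ∧
    (∀ i k, 1 ≤ i → i ≤ p - 1 → 1 ≤ k → k ≤ s - 1 →
      2 * p ^ s - p ^ (s - k) + (i - 1) * p ^ (s - k - 1) + 1 ≤ ν →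
      ν ≤ 2 * p ^ s - p ^ (s - k) + i * p ^ (s - k - 1) →
      dH (X ^ (n * p ^ s) - C (α₀ ^ p ^ s + γ * β))
        (Ideal.span {Ideal.Quotient.mk
          (Ideal.span {(X ^ (n * p ^ s) - C (α₀ ^ p ^ s + γ * β) : R[X])})
          ((X ^ n - C α₀) ^ ν)}) = (i + 1) * p ^ k) ∧
    (ν = 2 * p ^ s →
      dH (X ^ (n * p ^ s) - C (α₀ ^ p ^ s + γ * β))
        (Ideal.span {Ideal.Quotient.mk
          (Ideal.span {(X ^ (n * p ^ s) - C (α₀ ^ p ^ s + γ * β) : R[X])})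
          ((X ^ n - C α₀) ^ ν)}) = 0) := by
  have hmaxl : (Ideal.span {γ}).IsMaximal := by
    rw [Ideal.isMaximal_iff]
    refine ⟨fun h => (hmax 1).1 h isUnit_one, ?_⟩
    intro J x hJ hx hxJ
    have hu : IsUnit x := by
      by_contra hc
      exact hx ((hmax x).2 hc)
    rw [J.eq_top_of_isUnit_mem hxJ hu]
    trivial
  have hnt : Nontrivial R := ⟨γ, 0, hγ⟩
  have hchar : CharP (R ⧸ Ideal.span {γ}) p := by
    have := Fact.mk hp
    have : IsDomain (R ⧸ Ideal.span {γ}) := by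
      have := hmaxl.isPrime
      exact Ideal.Quotient.isDomain _
    have : Finite (R ⧸ Ideal.span {γ}) :=
      Finite.of_surjective _ (Ideal.Quotient.mk_surjective (I := Ideal.span {γ}))
    have := Fintype.ofFinite (R ⧸ Ideal.span {γ})
    rw [Nat.card_eq_fintype_card] at hres
    exact charP_of_card_eq_prime_pow hres
  have hpγ : (p : R) ∈ Ideal.span {γ} := by
    rw [← Ideal.Quotient.eq_zero_iff_mem, map_natCast]
    exact CharP.cast_eq_zero _ _
  have hps : 0 < p ^ s := Nat.pow_pos hp.pos
  have hN : n * p ^ s ≠ 0 := (Nat.mul_pos hn hps).ne'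
  have h2p := hp.two_le
  obtain ⟨u, hu, hkey⟩ := key_unit p s n hp γ hγ2 hpγ α₀ β hβ _ rfl
  refine ⟨?_, ?_, ?_, ?_⟩
  · intro hνs
    have hqm := monic_X_pow_sub_C (α₀ ^ p ^ s + γ * β) hN
    have hrep : (C γ : R[X]) %ₘ (X ^ (n * p ^ s) - C (α₀ ^ p ^ s + γ * β)) = C γ := by
      rw [modByMonic_eq_self_iff hqm]
      apply degree_lt_degree
      rw [natDegree_X_pow_sub_C, natDegree_C]
      exact Nat.pos_of_ne_zero hN
    apply dH_eq
    · refine ⟨Ideal.Quotient.mk _ (C γ), ?_, ?_, ?_⟩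
      · rw [Ideal.mem_span_singleton, ← hu.dvd_mul_right, ← hkey, map_pow]
        exact pow_dvd_pow _ hνs
      · rw [Ne, mk_eq_zero_iff' _ hqm, hrep, C_eq_zero]
        exact hγ
      · rw [wH_mk _ hqm, hrep, support_C hγ]
        simp
    · intro c _ hc
      exact wH_pos _ hqm c hc
  · intro ℓ hℓ h1 h2
    obtain ⟨t, rfl⟩ : ∃ t, s = 0 + 1 + t := ⟨s - 1, by omega⟩
    have e : 0 + 1 + t - 1 = t := by omega
    rw [e] at h1 h2
    obtain ⟨μ, rfl⟩ : ∃ μ, ν = p ^ (0 + 1 + t) + μ := ⟨ν - p ^ (0 + 1 + t), by omega⟩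
    have e2 : p ^ (t + 1) = p ^ (0 + 1 + t) := by congr 1; omega
    have := dH_mid p 0 ℓ t n hp hn γ hγ hγ2 hmax hmaxl hchar α₀ β hα₀ hβ _ rfl μ
      (by omega) (by omega) (by omega)
    rw [this]; simp
  · intro i k hi hi' hk hk' h1 h2
    obtain ⟨j, rfl⟩ : ∃ j, i = j + 1 := ⟨i - 1, by omega⟩
    obtain ⟨t, rfl⟩ : ∃ t, s = k + 1 + t := ⟨s - k - 1, by omega⟩
    have e : k + 1 + t - k - 1 = t := by omega
    have e' : k + 1 + t - k = t + 1 := by omega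
    rw [e, e'] at h1 h2
    have e2 : p ^ (t + 1) ≤ p ^ (k + 1 + t) := Nat.pow_le_pow_right hp.pos (by omega)
    rw [Nat.add_sub_cancel] at h1
    obtain ⟨μ, rfl⟩ : ∃ μ, ν = p ^ (k + 1 + t) + μ := ⟨ν - p ^ (k + 1 + t), by omega⟩
    exact dH_mid p k j t n hp hn γ hγ hγ2 hmax hmaxl hchar α₀ β hα₀ hβ _ rfl μ
      (by omega) (by omega) (by omega)
  · intro hν2
    have h0 : Ideal.Quotient.mk
        (Ideal.span {(X ^ (n * p ^ s) - C (α₀ ^ p ^ s + γ * β) : R[X])})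
          ((X ^ n - C α₀) ^ ν) = 0 := by
      rw [hν2, map_pow, mul_comm 2 (p ^ s), pow_mul _ (p ^ s) 2, hkey, mul_pow, ← map_pow, ← C_pow, hγ2]
      simp
    rw [h0]
    unfold dH
    have : {w : ℕ | ∃ c ∈ Ideal.span {(0 : R[X] ⧸ Ideal.span
        {(X ^ (n * p ^ s) - C (α₀ ^ p ^ s + γ * β) : R[X])})}, c ≠ 0 ∧
        w = wH (X ^ (n * p ^ s) - C (α₀ ^ p ^ s + γ * β)) c} = ∅ := by
      ext w
      simp only [Set.mem_ofPred_eq, Set.mem_empty_iff_false, iff_false]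
      rintro ⟨c, hc, hc0, _⟩
      rw [Ideal.mem_span_singleton, zero_dvd_iff] at hc
      exact hc0 hc
    rw [this]
    exact Nat.sInf_empty
end

section
/- Let α₀ and β be units of R, let λ = α₀^{p^s} + γβ, and suppose x^n − α₀ is basic irreducible over R. Let C = ⟨(x^n − α₀)^ν⟩ be an ideal of R[x]/⟨x^{np^s} − λ⟩, where 0 ≤ ν ≤ 2p^s, and for 0 ≤ ρ ≤ np^s let A_ρ denote the number of codewords of C with RT weight equal to ρ. Then A_0 = 1 in all cases, and for 1 ≤ ρ ≤ np^s: (a) if ν = 2p^s, then A_ρ = 0; (b) if p^s + 1 ≤ ν ≤ 2p^s − 1, then A_ρ = 0 for 1 ≤ ρ ≤ nν − np^s and A_ρ = (p^m − 1)p^{m(ρ − nν + np^s − 1)} for nν − np^s + 1 ≤ ρ ≤ np^s; (c) if ν = y·p^s with y ∈ {0, 1}, then A_ρ = (p^{m(2−y)} − 1)p^{m(2−y)(ρ−1)}; (d) if 1 ≤ ν ≤ p^s − 1, then A_ρ = (p^m − 1)p^{m(ρ−1)} for 1 ≤ ρ ≤ nν and A_ρ = (p^{2m} − 1)p^{m(2ρ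 − nν − 2)} for nν + 1 ≤ ρ ≤ np^s. -/
open Polynomial

open Classical in
/-- RT (Rosenbloom–Tsfasman) weight of a codeword: `1 + deg` of its representative,
and `0` for the zero codeword. -/
noncomputable def wRT {A : Type} [CommRing A] (q : A[X]) (c : A[X] ⧸ Ideal.span {q}) : ℕ :=
  if c = 0 then 0 else (polyRep q c).natDegree + 1

/-- The number of codewords of the code `I ⊆ A[x]/⟨q⟩` with RT weight `ρ`. -/
noncomputable def rtCount {A : Type} [CommRing A] (q : A[X])
    (I : Ideal (A[X] ⧸ Ideal.span {q})) (ρ : ℕ) : ℕ :=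
  Set.ncard {c : A[X] ⧸ Ideal.span {q} | c ∈ I ∧ wRT q c = ρ}

namespace RTaux

lemma card_map_mul {G H : Type*} [AddCommGroup G] [AddCommGroup H] (P : AddSubgroup G)
    (φ : G →+ H) : Nat.card P = Nat.card (P.map φ) * Nat.card (P ⊓ φ.ker : AddSubgroup G) := by
  let ψ := φ.comp P.subtype
  have h1 : Nat.card P = Nat.card (P ⧸ ψ.ker) * Nat.card ψ.ker :=
    AddSubgroup.card_eq_card_quotient_mul_card_addSubgroup _
  have h2 : Nat.card (P ⧸ ψ.ker) = Nat.card (P.map φ) := by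
    rw [Nat.card_congr (QuotientAddGroup.quotientKerEquivRange ψ).toEquiv]
    have : ψ.range = P.map φ := by
      ext x; simp [ψ, AddMonoidHom.mem_range, AddSubgroup.mem_map]
    rw [this]
  have h3 : Nat.card ψ.ker = Nat.card (P ⊓ φ.ker : AddSubgroup G) := by
    refine Nat.card_congr ⟨fun x => ⟨x.1.1, x.1.2, x.2⟩, fun x => ⟨⟨x.1, x.2.1⟩, x.2.2⟩, ?_, ?_⟩
    · intro x; rfl
    · intro x; rfl
  rw [h1, h2, h3]

/-- polynomials of degree `< ρ` whose image under `φ` is divisible by `F` -/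
def P {R S : Type*} [CommRing R] [CommRing S] (φ : R →+* S) (F : S[X]) (ρ : ℕ) :
    AddSubgroup R[X] where
  carrier := {g | g.degree < ρ ∧ F ∣ g.map φ}
  zero_mem' := by simp
  add_mem' := by
    rintro a b ⟨h1, h2⟩ ⟨h3, h4⟩
    exact ⟨(degree_add_le _ _).trans_lt (max_lt h1 h3), by
      rw [Polynomial.map_add]; exact dvd_add h2 h4⟩
  neg_mem' := by
    rintro a ⟨h1, h2⟩
    exact ⟨by rwa [degree_neg], by rw [Polynomial.map_neg]; exact (dvd_neg).2 h2⟩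

lemma mem_P {R S : Type*} [CommRing R] [CommRing S] (φ : R →+* S) (F : S[X]) (ρ : ℕ) (g : R[X]) :
    g ∈ P φ F ρ ↔ g.degree < ρ ∧ F ∣ g.map φ := Iff.rfl

lemma card_deg {S : Type*} [CommRing S] (ρ : ℕ) :
    Nat.card {g : S[X] // g.degree < ρ} = Nat.card S ^ ρ := by
  have e : {g : S[X] // g.degree < ρ} ≃ degreeLT S ρ :=
    Equiv.subtypeEquivRight (fun g => by rw [mem_degreeLT])
  rw [Nat.card_congr (e.trans (degreeLTEquiv S ρ).toEquiv), Nat.card_fun, Nat.card_fin]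

lemma card_T {S : Type*} [CommRing S] [Nontrivial S] (F : S[X]) (hF : F.Monic) (ρ : ℕ) :
    Nat.card (P (RingHom.id S) F ρ) = Nat.card S ^ (ρ - F.natDegree) := by
  rw [← card_deg]
  symm
  refine Nat.card_congr (Equiv.ofBijective (fun h => ⟨h.1 * F, ?_, by simp⟩) ⟨?_, ?_⟩)
  · by_cases h0 : h.1 = 0
    · simp [h0]
    have h2 := h.2
    rw [degree_eq_natDegree h0] at h2
    rw [hF.degree_mul, degree_eq_natDegree h0, degree_eq_natDegree hF.ne_zero]
    norm_cast at h2 ⊢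
    omega
  · intro a b hab
    have : a.1 * F = b.1 * F := congrArg Subtype.val hab
    exact Subtype.ext (hF.isRegular.right this)
  · rintro ⟨g, hg, hd⟩
    rw [Polynomial.map_id] at hd
    obtain ⟨h, rfl⟩ := hd
    refine ⟨⟨h, ?_⟩, Subtype.ext (mul_comm _ _)⟩
    by_cases h0 : h = 0
    · simp [h0]
    rw [mul_comm, hF.degree_mul, degree_eq_natDegree h0, degree_eq_natDegree hF.ne_zero] at hg
    rw [degree_eq_natDegree h0]
    norm_cast at hg ⊢
    omega

lemma map_P {R S : Type*} [CommRing R] [CommRing S] (φ : R →+* S)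
    (hφ : Function.Surjective φ) (F : S[X]) (ρ : ℕ) :
    (P φ F ρ).map (mapRingHom φ).toAddMonoidHom = P (RingHom.id S) F ρ := by
  ext h
  simp only [AddSubgroup.mem_map, mem_P, Polynomial.map_id]
  constructor
  · rintro ⟨g, ⟨h1, h2⟩, rfl⟩
    exact ⟨(degree_map_le).trans_lt h1, h2⟩
  · rintro ⟨h1, h2⟩
    obtain ⟨g, hg, hd⟩ := exists_degree_eq_of_mem_lifts (mem_lifts_of_surjective hφ h)
    exact ⟨g, ⟨by rwa [hd], by rwa [hg]⟩, hg⟩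

lemma P_inf_ker {R S : Type*} [CommRing R] [CommRing S] (φ : R →+* S) (F : S[X]) (ρ : ℕ) :
    P φ F ρ ⊓ (mapRingHom φ).toAddMonoidHom.ker = P φ 0 ρ := by
  ext g
  simp only [AddSubgroup.mem_inf, mem_P, AddMonoidHom.mem_ker, zero_dvd_iff]
  constructor
  · rintro ⟨⟨h1, h2⟩, h3⟩; exact ⟨h1, h3⟩
  · rintro ⟨h1, h2⟩; exact ⟨⟨h1, by simp [h2]⟩, h2⟩

lemma card_P {R S : Type*} [CommRing R] [CommRing S] [Nontrivial S] [Finite R] (φ : R →+* S)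
    (hφ : Function.Surjective φ) (hc : Nat.card R = Nat.card S * Nat.card S)
    (F : S[X]) (hF : F.Monic) (ρ : ℕ) :
    Nat.card (P φ F ρ) = Nat.card S ^ (ρ - F.natDegree) * Nat.card (P φ 0 ρ) ∧
    Nat.card (P φ 0 ρ) = Nat.card S ^ ρ := by
  have key : ∀ F : S[X], F.Monic →
      Nat.card (P φ F ρ) = Nat.card S ^ (ρ - F.natDegree) * Nat.card (P φ 0 ρ) := by
    intro F hF
    rw [card_map_mul (P φ F ρ) (mapRingHom φ).toAddMonoidHom, map_P φ hφ, P_inf_ker, card_T F hF]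
  refine ⟨key F hF, ?_⟩
  have h1 := key 1 monic_one
  have : Finite S := Finite.of_surjective φ hφ
  have h2 : Nat.card (P φ 1 ρ) = Nat.card R ^ ρ := by
    rw [← card_deg]
    exact Nat.card_congr (Equiv.subtypeEquivRight (fun g => by simp [mem_P]))
  rw [h2, hc, mul_pow] at h1
  simp only [natDegree_one, Nat.sub_zero] at h1
  exact (Nat.eq_of_mul_eq_mul_left (pow_pos Nat.card_pos _) h1).symm

section
variable {A : Type} [CommRing A]

lemma mk_polyRep (q : A[X]) (c : A[X] ⧸ Ideal.span {q}) :
    Ideal.Quotient.mk (Ideal.span {q}) (polyRep q c) = c := by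
  conv_rhs => rw [← Function.surjInv_eq Ideal.Quotient.mk_surjective c]
  rw [Ideal.Quotient.eq, Ideal.mem_span_singleton]
  exact dvd_modByMonic_sub _ _

lemma polyRep_mk [Nontrivial A] (q : A[X]) (hq : q.Monic) (g : A[X]) (hg : g.degree < q.degree) :
    polyRep q (Ideal.Quotient.mk (Ideal.span {q}) g) = g := by
  have h := mk_polyRep q (Ideal.Quotient.mk (Ideal.span {q}) g)
  rw [Ideal.Quotient.eq, Ideal.mem_span_singleton] at h
  have hd : (polyRep q (Ideal.Quotient.mk (Ideal.span {q}) g)).degree < q.degree := by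
    exact degree_modByMonic_lt _ hq
  exact sub_eq_zero.1 (by
    by_contra h0
    exact hq.not_dvd_of_degree_lt h0 ((degree_sub_le _ _).trans_lt (max_lt hd hg)) h)

lemma rtCount_zero (q : A[X]) (I : Ideal (A[X] ⧸ Ideal.span {q})) : rtCount q I 0 = 1 := by
  unfold rtCount
  have : {c : A[X] ⧸ Ideal.span {q} | c ∈ I ∧ wRT q c = 0} = {0} := by
    ext c
    simp only [Set.mem_ofPred_eq, Set.mem_singleton_iff, wRT]
    constructor
    · rintro ⟨_, h⟩
      by_contra h0
      simp [h0] at h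
    · rintro rfl; simp
  rw [this, Set.ncard_singleton]

/-- representatives of degree `< ρ` -/
def Sset (q : A[X]) (I : Ideal (A[X] ⧸ Ideal.span {q})) (ρ : ℕ) : Set A[X] :=
  {g | g.degree < ρ ∧ Ideal.Quotient.mk (Ideal.span {q}) g ∈ I}

lemma finite_deg [Finite A] (ρ : ℕ) : {g : A[X] | g.degree < ρ}.Finite := by
  have e : {g : A[X] // g.degree < ρ} ≃ degreeLT A ρ :=
    Equiv.subtypeEquivRight (fun g => by rw [mem_degreeLT])
  have : Finite (degreeLT A ρ) := Finite.of_equiv _ (degreeLTEquiv A ρ).symm.toEquiv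
  exact Finite.of_equiv _ e.symm

lemma rtCount_succ [Finite A] [Nontrivial A] (q : A[X]) (hq : q.Monic)
    (I : Ideal (A[X] ⧸ Ideal.span {q})) (ρ : ℕ) (hρ : ρ + 1 ≤ q.natDegree) :
    rtCount q I (ρ + 1) = (Sset q I (ρ + 1)).ncard - (Sset q I ρ).ncard := by
  have hsub : Sset q I ρ ⊆ Sset q I (ρ + 1) := by
    rintro g ⟨h1, h2⟩
    exact ⟨h1.trans (by exact_mod_cast Nat.lt_succ_self ρ), h2⟩
  have hfin : (Sset q I ρ).Finite := (finite_deg ρ).subset (fun g hg => hg.1)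
  rw [← Set.ncard_sdiff hsub hfin]
  unfold rtCount
  have hinj : Function.Injective (polyRep q) := Function.LeftInverse.injective (mk_polyRep q)
  rw [← Set.ncard_image_of_injective _ hinj]
  congr 1
  have hlt : ∀ g : A[X], g ≠ 0 → g.natDegree + 1 = ρ + 1 → g.degree < q.degree := by
    intro g h0 hg
    rw [degree_eq_natDegree h0, degree_eq_natDegree hq.ne_zero]
    norm_cast
    omega
  ext g
  constructor
  · rintro ⟨c, ⟨hc, hw⟩, rfl⟩
    unfold wRT at hw
    split_ifs at hw with h0
    have hne : polyRep q c ≠ 0 := fun h => h0 (by rw [← mk_polyRep q c, h, map_zero])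
    refine ⟨⟨?_, by rwa [mk_polyRep]⟩, fun h => ?_⟩
    · rw [degree_eq_natDegree hne]; norm_cast; omega
    · have := h.1
      rw [degree_eq_natDegree hne] at this; norm_cast at this; omega
  · rintro ⟨⟨h1, h2⟩, h3⟩
    have hne : g ≠ 0 := by
      rintro rfl
      exact h3 ⟨by simp, h2⟩
    have h4 : ¬ g.degree < ρ := fun h => h3 ⟨h, h2⟩
    rw [degree_eq_natDegree hne] at h1 h4
    norm_cast at h1 h4
    have hd : g.natDegree + 1 = ρ + 1 := by omega
    have hr := polyRep_mk q hq g (hlt g hne hd)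
    refine ⟨Ideal.Quotient.mk _ g, ⟨h2, ?_⟩, hr⟩
    unfold wRT
    rw [if_neg, hr, hd]
    intro h
    rw [h] at hr
    have h00 := polyRep_mk q hq 0 (by
      rw [degree_zero]; exact bot_lt_iff_ne_bot.2 (by simpa using hq.ne_zero))
    rw [map_zero] at h00
    exact hne (hr.symm.trans h00)
end

section
variable {R : Type} [CommRing R] [Finite R] {γ : R}

lemma gamma_mul (hγ : γ ≠ 0) (hγ2 : γ ^ 2 = 0)
    (hmax : ∀ a : R, a ∈ Ideal.span {γ} ↔ ¬ IsUnit a) (a : R) :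
    γ * a = 0 ↔ a ∈ Ideal.span {γ} := by
  constructor
  · intro h
    rw [hmax]
    intro hu
    exact hγ ((hu.mul_left_eq_zero).1 h)
  · intro h
    obtain ⟨b, rfl⟩ := Ideal.mem_span_singleton.1 h
    rw [← mul_assoc, ← sq, hγ2, zero_mul]

lemma card_R (hγ : γ ≠ 0) (hγ2 : γ ^ 2 = 0)
    (hmax : ∀ a : R, a ∈ Ideal.span {γ} ↔ ¬ IsUnit a) :
    Nat.card R = Nat.card (R ⧸ Ideal.span {γ}) * Nat.card (R ⧸ Ideal.span {γ}) := by
  have h1 := card_map_mul (⊤ : AddSubgroup R) (AddMonoidHom.mulLeft γ)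
  have h2 : (⊤ : AddSubgroup R).map (AddMonoidHom.mulLeft γ)
      = (Ideal.span {γ}).toAddSubgroup := by
    ext x
    simp [AddSubgroup.mem_map, Ideal.mem_span_singleton, Dvd.dvd, eq_comm]
  have h3 : (⊤ : AddSubgroup R) ⊓ (AddMonoidHom.mulLeft γ).ker
      = (Ideal.span {γ}).toAddSubgroup := by
    ext x
    simpa [AddMonoidHom.mem_ker] using gamma_mul hγ hγ2 hmax x
  have h4 : Nat.card R = Nat.card (R ⧸ Ideal.span {γ}) * Nat.card (Ideal.span {γ}).toAddSubgroup :=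
    AddSubgroup.card_eq_card_quotient_mul_card_addSubgroup (Ideal.span {γ}).toAddSubgroup
  rw [h2, h3, AddSubgroup.card_top] at h1
  have h5 : Nat.card (R ⧸ Ideal.span {γ}) = Nat.card (Ideal.span {γ}).toAddSubgroup :=
    Nat.eq_of_mul_eq_mul_right Nat.card_pos (h4.symm.trans h1)
  rw [← h5] at h4
  exact h4

lemma map_eq_zero_iff (g : R[X]) :
    g.map (Ideal.Quotient.mk (Ideal.span {γ})) = 0 ↔ C γ ∣ g := by
  rw [C_dvd_iff_dvd_coeff, Polynomial.ext_iff]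
  simp [coeff_map, Ideal.Quotient.eq_zero_iff_mem, Ideal.mem_span_singleton]

lemma C_mul_eq_zero_iff (hγ : γ ≠ 0) (hγ2 : γ ^ 2 = 0)
    (hmax : ∀ a : R, a ∈ Ideal.span {γ} ↔ ¬ IsUnit a) (g : R[X]) :
    C γ * g = 0 ↔ g.map (Ideal.Quotient.mk (Ideal.span {γ})) = 0 := by
  rw [Polynomial.ext_iff, Polynomial.ext_iff]
  simp [coeff_map, Ideal.Quotient.eq_zero_iff_mem, gamma_mul hγ hγ2 hmax]

lemma card_map_gamma (hγ : γ ≠ 0) (hγ2 : γ ^ 2 = 0)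
    (hmax : ∀ a : R, a ∈ Ideal.span {γ} ↔ ¬ IsUnit a) [Nontrivial (R ⧸ Ideal.span {γ})]
    (F : (R ⧸ Ideal.span {γ})[X]) (hF : F.Monic) (ρ : ℕ) :
    Nat.card ((P (Ideal.Quotient.mk (Ideal.span {γ})) F ρ).map (AddMonoidHom.mulLeft (C γ)))
      = Nat.card (R ⧸ Ideal.span {γ}) ^ (ρ - F.natDegree) := by
  have h1 := card_map_mul (P (Ideal.Quotient.mk (Ideal.span {γ})) F ρ)
    (AddMonoidHom.mulLeft (C γ))
  have hk : (AddMonoidHom.mulLeft (C γ)).ker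
      = (mapRingHom (Ideal.Quotient.mk (Ideal.span {γ}))).toAddMonoidHom.ker := by
    ext g
    exact C_mul_eq_zero_iff hγ hγ2 hmax g
  obtain ⟨h2, h3⟩ := card_P (Ideal.Quotient.mk (Ideal.span {γ})) Ideal.Quotient.mk_surjective
    (card_R hγ hγ2 hmax) F hF ρ
  rw [hk, P_inf_ker, h2] at h1
  refine (Nat.eq_of_mul_eq_mul_right ?_ h1).symm
  have := Finite.of_surjective _ (Ideal.Quotient.mk_surjective (I := Ideal.span {γ}))
  rw [h3]
  exact pow_pos Nat.card_pos _

lemma p_mem (hmax : ∀ a : R, a ∈ Ideal.span {γ} ↔ ¬ IsUnit a)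
    [Nontrivial (R ⧸ Ideal.span {γ})] {p m : ℕ}
    (hres : Nat.card (R ⧸ Ideal.span {γ}) = p ^ m) : γ ∣ (p : R) := by
  rw [← Ideal.mem_span_singleton, hmax]
  intro hu
  have h0 : ((Nat.card (R ⧸ Ideal.span {γ}) : ℕ) : R ⧸ Ideal.span {γ}) = 0 := by
    have := Finite.of_surjective _ (Ideal.Quotient.mk_surjective (I := Ideal.span {γ}))
    have := Fintype.ofFinite (R ⧸ Ideal.span {γ})
    rw [Nat.card_eq_fintype_card]
    exact Nat.cast_card_eq_zero _
  have h1 := (hu.pow m).map (Ideal.Quotient.mk (Ideal.span {γ}))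
  rw [hres] at h0
  push_cast at h0
  rw [map_pow, map_natCast, h0] at h1
  exact not_isUnit_zero h1

/-- `f ^ (p ^ s)` equals `q + γ * (β + f * w)` -/
lemma f_pow (hmax : ∀ a : R, a ∈ Ideal.span {γ} ↔ ¬ IsUnit a)
    [Nontrivial (R ⧸ Ideal.span {γ})] {p m : ℕ} (hp : p.Prime)
    (hres : Nat.card (R ⧸ Ideal.span {γ}) = p ^ m) (n s : ℕ) (α₀ β : R) :
    ∃ w : R[X], (X ^ n - C α₀) ^ p ^ s =
      (X ^ (n * p ^ s) - C (α₀ ^ p ^ s + γ * β)) + C γ * (C β + (X ^ n - C α₀) * w) := by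
  obtain ⟨c, hc⟩ := p_mem hmax hres
  obtain ⟨r, hr⟩ := (Commute.all (X ^ n - C α₀ : R[X]) (C α₀)).exists_add_pow_prime_pow_eq hp s
  rw [sub_add_cancel, ← pow_mul] at hr
  have hpc : (p : R[X]) = C γ * C c := by rw [← C_mul, ← hc]; simp
  refine ⟨- (C c * C α₀ * r), ?_⟩
  rw [hr, hpc]
  simp only [C_add, C_mul, C_pow]
  ring

lemma exists_unit (hγ2 : γ ^ 2 = 0) {q f b w : R[X]} (hb : IsUnit b) (N : ℕ)
    (h : f ^ N = q + C γ * (b + f * w)) :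
    ∃ u, IsUnit u ∧ Ideal.Quotient.mk (Ideal.span {q}) f ^ N =
      Ideal.Quotient.mk (Ideal.span {q}) (C γ) * u := by
  set π := Ideal.Quotient.mk (Ideal.span {q})
  have hq : π q = 0 := Ideal.Quotient.eq_zero_iff_mem.2 (Ideal.mem_span_singleton_self q)
  have h1 : π f ^ N = π (C γ) * π (b + f * w) := by
    rw [← map_pow, h, map_add, hq, zero_add, map_mul]
  refine ⟨_, ?_, h1⟩
  have hn : IsNilpotent (π f) := by
    refine ⟨N * 2, ?_⟩
    rw [pow_mul, h1, mul_pow, ← map_pow, ← C_pow, hγ2]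
    simp
  have hn' : IsNilpotent (π (f * w)) := by
    rw [map_mul]; exact (Commute.all _ _).isNilpotent_mul_right hn
  rw [map_add, add_comm]
  exact hn'.isUnit_add_right_of_commute (hb.map π) (Commute.all _ _)

/-- Case `ν ≤ p ^ s` -/
lemma Sset_low {q f : R[X]} {N ν : ℕ} (hν : ν ≤ N)
    (hqm : q.map (Ideal.Quotient.mk (Ideal.span {γ}))
      = (f.map (Ideal.Quotient.mk (Ideal.span {γ}))) ^ N)
    (hu : ∃ u, IsUnit u ∧ Ideal.Quotient.mk (Ideal.span {q}) f ^ N =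
      Ideal.Quotient.mk (Ideal.span {q}) (C γ) * u) (ρ : ℕ) :
    Sset q (Ideal.span {Ideal.Quotient.mk (Ideal.span {q}) (f ^ ν)}) ρ
      = P (Ideal.Quotient.mk (Ideal.span {γ}))
          ((f.map (Ideal.Quotient.mk (Ideal.span {γ}))) ^ ν) ρ := by
  obtain ⟨u, hu, hfu⟩ := hu
  ext g
  refine and_congr_right fun _ => ?_
  rw [Ideal.mem_span_singleton]
  constructor
  · rintro ⟨h, hh⟩
    obtain ⟨h, rfl⟩ := Ideal.Quotient.mk_surjective h
    rw [← map_mul, Ideal.Quotient.eq, Ideal.mem_span_singleton] at hh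
    obtain ⟨l, hl⟩ := hh
    rw [sub_eq_iff_eq_add.1 hl, Polynomial.map_add, Polynomial.map_mul, Polynomial.map_mul, hqm,
      Polynomial.map_pow]
    exact dvd_add (Dvd.dvd.mul_right (pow_dvd_pow _ hν) _) (dvd_mul_right _ _)
  · rintro ⟨h, hh⟩
    obtain ⟨h, rfl⟩ := map_surjective _ Ideal.Quotient.mk_surjective h
    rw [← Polynomial.map_pow, ← Polynomial.map_mul, ← sub_eq_zero, ← Polynomial.map_sub,
      map_eq_zero_iff] at hh
    obtain ⟨l, hl⟩ := hh
    rw [sub_eq_iff_eq_add.1 hl, map_add, map_mul, map_mul]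
    refine dvd_add (Dvd.dvd.mul_right ?_ _) (dvd_mul_right _ _)
    rw [← hu.dvd_mul_right, ← hfu, map_pow]
    exact pow_dvd_pow _ hν

/-- Case `ν = p ^ s + k` -/
lemma Sset_high (hγ : γ ≠ 0) (hγ2 : γ ^ 2 = 0)
    (hmax : ∀ a : R, a ∈ Ideal.span {γ} ↔ ¬ IsUnit a) [Nontrivial (R ⧸ Ideal.span {γ})]
    {q f : R[X]} (hq : q.Monic) {N k : ℕ} (hk : k ≤ N)
    (hqm : q.map (Ideal.Quotient.mk (Ideal.span {γ}))
      = (f.map (Ideal.Quotient.mk (Ideal.span {γ}))) ^ N)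
    (hu : ∃ u, IsUnit u ∧ Ideal.Quotient.mk (Ideal.span {q}) f ^ N =
      Ideal.Quotient.mk (Ideal.span {q}) (C γ) * u) (ρ : ℕ) (hρ : ρ ≤ q.natDegree) :
    Sset q (Ideal.span {Ideal.Quotient.mk (Ideal.span {q}) (f ^ (N + k))}) ρ
      = (P (Ideal.Quotient.mk (Ideal.span {γ}))
          ((f.map (Ideal.Quotient.mk (Ideal.span {γ}))) ^ k) ρ).map
            (AddMonoidHom.mulLeft (C γ)) := by
  obtain ⟨u, hu, hfu⟩ := hu
  set φ := Ideal.Quotient.mk (Ideal.span {γ}) with hφ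
  have hdvd : ∀ x, Ideal.Quotient.mk (Ideal.span {q}) (f ^ (N + k)) ∣ x ↔
      Ideal.Quotient.mk (Ideal.span {q}) (C γ * f ^ k) ∣ x := by
    intro x
    rw [map_pow, pow_add, hfu, map_mul, map_pow, mul_right_comm, hu.mul_right_dvd]
  have hg0 : (C γ : R[X]).map φ = 0 := (map_eq_zero_iff _).2 dvd_rfl
  ext g
  simp only [Sset, Set.mem_ofPred_eq, SetLike.mem_coe, AddSubgroup.mem_map, mem_P,
    AddMonoidHom.coe_mulLeft]
  rw [Ideal.mem_span_singleton, hdvd]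
  constructor
  · rintro ⟨hd, h, hh⟩
    obtain ⟨h, rfl⟩ := Ideal.Quotient.mk_surjective h
    rw [← map_mul, Ideal.Quotient.eq, Ideal.mem_span_singleton] at hh
    obtain ⟨l, hl⟩ := hh
    rw [sub_eq_iff_eq_add] at hl
    -- the reduction of g vanishes
    have hqd : (q.map φ).degree = q.natDegree := by
      rw [hq.degree_map, degree_eq_natDegree]
      rintro rfl
      have := hq.map φ
      simp at this
    have hm : g.map φ = q.map φ * l.map φ := by
      rw [hl]; simp [hg0]
    have hgz : g.map φ = 0 := by
      by_contra h0
      refine (hq.map φ).not_dvd_of_degree_lt h0 ?_ ⟨_, hm⟩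
      rw [hqd]
      exact degree_map_le.trans_lt (hd.trans_le (by exact_mod_cast hρ))
    have hlz : l.map φ = 0 := by
      rw [hgz] at hm
      exact ((hq.map φ).mul_right_eq_zero_iff).1 hm.symm
    obtain ⟨g', rfl⟩ := (map_eq_zero_iff _).1 hgz
    obtain ⟨l', rfl⟩ := (map_eq_zero_iff _).1 hlz
    have hz : C γ * (g' - (q * l' + f ^ k * h)) = 0 := by
      rw [mul_sub, hl]; ring
    rw [C_mul_eq_zero_iff hγ hγ2 hmax, Polynomial.map_sub, sub_eq_zero] at hz
    obtain ⟨g'', hg'', hdeg⟩ := exists_degree_eq_of_mem_lifts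
      (mem_lifts_of_surjective (f := φ) Ideal.Quotient.mk_surjective (g'.map φ))
    refine ⟨g'', ⟨?_, ?_⟩, ?_⟩
    · rw [hdeg, degree_lt_iff_coeff_zero]
      intro i hi
      rw [degree_lt_iff_coeff_zero] at hd
      have := hd i hi
      rw [coeff_C_mul, gamma_mul hγ hγ2 hmax] at this
      rw [coeff_map]
      exact Ideal.Quotient.eq_zero_iff_mem.2 this
    · rw [hg'', hφ, hz, ← hφ, Polynomial.map_add, Polynomial.map_mul, Polynomial.map_mul, hqm,
        Polynomial.map_pow]
      exact dvd_add (Dvd.dvd.mul_right (pow_dvd_pow _ hk) _) (dvd_mul_right _ _)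
    · rw [← sub_eq_zero, ← mul_sub, C_mul_eq_zero_iff hγ hγ2 hmax, Polynomial.map_sub, hg'',
        sub_self]
  · rintro ⟨g', ⟨hd, h, hh⟩, rfl⟩
    refine ⟨?_, ?_⟩
    · rw [degree_lt_iff_coeff_zero] at hd ⊢
      intro i hi
      rw [coeff_C_mul, hd i hi, mul_zero]
    · obtain ⟨h, rfl⟩ := map_surjective _ Ideal.Quotient.mk_surjective h
      rw [← Polynomial.map_pow, ← Polynomial.map_mul, ← sub_eq_zero, ← Polynomial.map_sub,
        ← C_mul_eq_zero_iff hγ hγ2 hmax, mul_sub, sub_eq_zero] at hh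
      rw [hh, ← mul_assoc, map_mul _ (C γ * f ^ k)]
      exact dvd_mul_right _ _
end

end RTaux

/-- RT weight distributions of the `(α₀^{p^s} + γβ)`-constacyclic codes
`⟨(x^n − α₀)^ν⟩` of length `np^s` over a finite chain ring with nilpotency index 2. -/
theorem stmt7 {R : Type} [CommRing R] [Finite R]
    (p m s n : ℕ) (hp : p.Prime) (hm : 0 < m) (hs : 0 < s) (hn : 0 < n)
    (hnp : Nat.gcd n p = 1)
    (γ : R) (hγ : γ ≠ 0) (hγ2 : γ ^ 2 = 0)
    (hmax : ∀ a : R, a ∈ Ideal.span {γ} ↔ ¬ IsUnit a)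
    (hres : Nat.card (R ⧸ Ideal.span {γ}) = p ^ m)
    (α₀ β : R) (hα₀ : IsUnit α₀) (hβ : IsUnit β)
    (hirr : Irreducible ((X ^ n - C α₀ : R[X]).map (Ideal.Quotient.mk (Ideal.span {γ}))))
    (ν : ℕ) (hν : ν ≤ 2 * p ^ s) :
    rtCount (X ^ (n * p ^ s) - C (α₀ ^ p ^ s + γ * β))
      (Ideal.span {Ideal.Quotient.mk
        (Ideal.span {(X ^ (n * p ^ s) - C (α₀ ^ p ^ s + γ * β) : R[X])})
        ((X ^ n - C α₀) ^ ν)}) 0 = 1 ∧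
    (ν = 2 * p ^ s → ∀ ρ, 1 ≤ ρ → ρ ≤ n * p ^ s →
      rtCount (X ^ (n * p ^ s) - C (α₀ ^ p ^ s + γ * β))
        (Ideal.span {Ideal.Quotient.mk
          (Ideal.span {(X ^ (n * p ^ s) - C (α₀ ^ p ^ s + γ * β) : R[X])})
          ((X ^ n - C α₀) ^ ν)}) ρ = 0) ∧
    (p ^ s + 1 ≤ ν → ν ≤ 2 * p ^ s - 1 →
      (∀ ρ, 1 ≤ ρ → ρ ≤ n * ν - n * p ^ s →
        rtCount (X ^ (n * p ^ s) - C (α₀ ^ p ^ s + γ * β))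
          (Ideal.span {Ideal.Quotient.mk
            (Ideal.span {(X ^ (n * p ^ s) - C (α₀ ^ p ^ s + γ * β) : R[X])})
            ((X ^ n - C α₀) ^ ν)}) ρ = 0) ∧
      (∀ ρ, n * ν - n * p ^ s + 1 ≤ ρ → ρ ≤ n * p ^ s →
        rtCount (X ^ (n * p ^ s) - C (α₀ ^ p ^ s + γ * β))
          (Ideal.span {Ideal.Quotient.mk
            (Ideal.span {(X ^ (n * p ^ s) - C (α₀ ^ p ^ s + γ * β) : R[X])})
            ((X ^ n - C α₀) ^ ν)}) ρ =
          (p ^ m - 1) * p ^ (m * (ρ + n * p ^ s - n * ν - 1)))) ∧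
    (∀ y, (y = 0 ∨ y = 1) → ν = y * p ^ s → ∀ ρ, 1 ≤ ρ → ρ ≤ n * p ^ s →
      rtCount (X ^ (n * p ^ s) - C (α₀ ^ p ^ s + γ * β))
        (Ideal.span {Ideal.Quotient.mk
          (Ideal.span {(X ^ (n * p ^ s) - C (α₀ ^ p ^ s + γ * β) : R[X])})
          ((X ^ n - C α₀) ^ ν)}) ρ =
        (p ^ (m * (2 - y)) - 1) * p ^ (m * (2 - y) * (ρ - 1))) ∧
    (1 ≤ ν → ν ≤ p ^ s - 1 →
      (∀ ρ, 1 ≤ ρ → ρ ≤ n * ν →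
        rtCount (X ^ (n * p ^ s) - C (α₀ ^ p ^ s + γ * β))
          (Ideal.span {Ideal.Quotient.mk
            (Ideal.span {(X ^ (n * p ^ s) - C (α₀ ^ p ^ s + γ * β) : R[X])})
            ((X ^ n - C α₀) ^ ν)}) ρ = (p ^ m - 1) * p ^ (m * (ρ - 1))) ∧
      (∀ ρ, n * ν + 1 ≤ ρ → ρ ≤ n * p ^ s →
        rtCount (X ^ (n * p ^ s) - C (α₀ ^ p ^ s + γ * β))
          (Ideal.span {Ideal.Quotient.mk
            (Ideal.span {(X ^ (n * p ^ s) - C (α₀ ^ p ^ s + γ * β) : R[X])})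
            ((X ^ n - C α₀) ^ ν)}) ρ =
          (p ^ (2 * m) - 1) * p ^ (m * (2 * ρ - n * ν - 2)))) := by
  have hnt : Nontrivial (R ⧸ Ideal.span {γ}) := by
    rw [Ideal.Quotient.nontrivial_iff]
    intro h
    have := (hmax 1).1 (by rw [h]; trivial)
    exact this isUnit_one
  have hntR : Nontrivial R := ⟨γ, 0, hγ⟩
  have hps : 0 < p ^ s := pow_pos hp.pos s
  have hN : n * p ^ s ≠ 0 := (Nat.mul_pos hn hps).ne'
  obtain ⟨w, hw⟩ := RTaux.f_pow hmax hp hres n s α₀ β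
  have hu := RTaux.exists_unit hγ2 (isUnit_C.2 hβ) (p ^ s) hw
  have hqm : (X ^ (n * p ^ s) - C (α₀ ^ p ^ s + γ * β) : R[X]).map
      (Ideal.Quotient.mk (Ideal.span {γ}))
      = ((X ^ n - C α₀ : R[X]).map (Ideal.Quotient.mk (Ideal.span {γ}))) ^ p ^ s := by
    have hg0 : (C γ : R[X]).map (Ideal.Quotient.mk (Ideal.span {γ})) = 0 :=
      (RTaux.map_eq_zero_iff _).2 dvd_rfl
    rw [← Polynomial.map_pow, hw, Polynomial.map_add, Polynomial.map_mul, hg0, zero_mul, add_zero]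
  have hq : (X ^ (n * p ^ s) - C (α₀ ^ p ^ s + γ * β) : R[X]).Monic := monic_X_pow_sub_C _ hN
  have hqd : (X ^ (n * p ^ s) - C (α₀ ^ p ^ s + γ * β) : R[X]).natDegree = n * p ^ s :=
    natDegree_X_pow_sub_C
  have hf : (X ^ n - C α₀ : R[X]).Monic := monic_X_pow_sub_C _ hn.ne'
  have hfm := hf.map (Ideal.Quotient.mk (Ideal.span {γ}))
  have hfd : ∀ k, (((X ^ n - C α₀ : R[X]).map (Ideal.Quotient.mk (Ideal.span {γ}))) ^ k).natDegree
      = n * k := by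
    intro k
    rw [hfm.natDegree_pow, hf.natDegree_map, natDegree_X_pow_sub_C, mul_comm]
  generalize X ^ (n * p ^ s) - C (α₀ ^ p ^ s + γ * β) = q at *
  generalize X ^ n - C α₀ = f at *
  have hlow : ν ≤ p ^ s → ∀ ρ, (RTaux.Sset q (Ideal.span {Ideal.Quotient.mk (Ideal.span {q})
      (f ^ ν)}) ρ).ncard = (p ^ m) ^ (ρ - n * ν) * (p ^ m) ^ ρ := by
    intro h ρ
    rw [RTaux.Sset_low h hqm hu]
    obtain ⟨h1, h2⟩ := RTaux.card_P (Ideal.Quotient.mk (Ideal.span {γ}))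
      Ideal.Quotient.mk_surjective (RTaux.card_R hγ hγ2 hmax) _ (hfm.pow ν) ρ
    rw [h2, hfd, hres] at h1
    exact h1
  have hhigh : p ^ s ≤ ν → ∀ ρ, ρ ≤ n * p ^ s →
      (RTaux.Sset q (Ideal.span {Ideal.Quotient.mk (Ideal.span {q})
      (f ^ ν)}) ρ).ncard = (p ^ m) ^ (ρ - n * (ν - p ^ s)) := by
    intro h ρ hρ
    obtain ⟨k, rfl⟩ := Nat.exists_eq_add_of_le h
    rw [RTaux.Sset_high hγ hγ2 hmax hq (by omega) hqm hu ρ (by omega)]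
    have h1 := RTaux.card_map_gamma hγ hγ2 hmax _ (hfm.pow k) ρ
    rw [hfd, hres] at h1
    rw [Nat.add_sub_cancel_left]
    exact h1
  have hcount := RTaux.rtCount_succ q hq (Ideal.span {Ideal.Quotient.mk (Ideal.span {q}) (f ^ ν)})
  rw [hqd] at hcount
  refine ⟨RTaux.rtCount_zero _ _, ?_, ?_, ?_, ?_⟩
  · intro hν2 ρ h1 h2
    obtain ⟨ρ, rfl⟩ := Nat.exists_eq_add_of_le' h1
    rw [hcount ρ h2, hhigh (by omega) _ h2, hhigh (by omega) _ (by omega)]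
    have e : ν - p ^ s = p ^ s := by omega
    rw [e, Nat.sub_eq_zero_of_le h2, show ρ - n * p ^ s = 0 by omega, Nat.sub_self]
  · intro h3 h4
    obtain ⟨k, rfl⟩ := Nat.exists_eq_add_of_le (show p ^ s ≤ ν by omega)
    have e : n * (p ^ s + k) = n * p ^ s + n * k := by ring
    rw [e]
    simp only [Nat.add_sub_cancel_left] at hhigh ⊢
    refine ⟨?_, ?_⟩
    · intro ρ h1 h2
      have hle : n * k ≤ n * p ^ s := Nat.mul_le_mul_left _ (by omega)
      obtain ⟨ρ, rfl⟩ := Nat.exists_eq_add_of_le' h1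
      rw [hcount ρ (by omega), hhigh (by omega) _ (by omega), hhigh (by omega) _ (by omega)]
      rw [Nat.sub_eq_zero_of_le h2, show ρ - n * k = 0 by omega, Nat.sub_self]
    · intro ρ h1 h2
      obtain ⟨r, rfl⟩ := Nat.exists_eq_add_of_le h1
      have e1 : n * k + 1 + r = n * k + r + 1 := by ring
      rw [e1] at h2 ⊢
      rw [hcount _ h2, hhigh (by omega) _ h2, hhigh (by omega) _ (by omega)]
      rw [show n * k + r + 1 - n * k = r + 1 by omega, show n * k + r - n * k = r by omega,
        show n * k + r + 1 + n * p ^ s - (n * p ^ s + n * k) - 1 = r by omega, pow_mul,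
        Nat.sub_mul, one_mul, pow_succ']
  · intro y hy hνy ρ h1 h2
    obtain ⟨ρ, rfl⟩ := Nat.exists_eq_add_of_le' h1
    rcases hy with rfl | rfl
    · have h0 : ν = 0 := by simpa using hνy
      rw [hcount ρ h2, hlow (by omega), hlow (by omega), h0]
      simp only [mul_zero, Nat.sub_zero, Nat.add_sub_cancel, Nat.sub_mul, one_mul]
      congr 1 <;> ring
    · have h0 : ν = p ^ s := by simpa using hνy
      rw [hcount ρ h2, hhigh (by omega) _ h2, hhigh (by omega) _ (by omega), h0]
      simp only [Nat.sub_self, mul_zero, Nat.sub_zero, Nat.add_sub_cancel, Nat.sub_mul, one_mul]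
      congr 1 <;> ring
  · intro h3 h4
    have hle : n * ν ≤ n * p ^ s := Nat.mul_le_mul_left _ (by omega)
    refine ⟨?_, ?_⟩
    · intro ρ h1 h2
      obtain ⟨ρ, rfl⟩ := Nat.exists_eq_add_of_le' h1
      rw [hcount ρ (by omega), hlow (by omega), hlow (by omega), Nat.sub_eq_zero_of_le h2,
        show ρ - n * ν = 0 by omega, Nat.add_sub_cancel, Nat.sub_mul]
      congr 1 <;> ring
    · intro ρ h1 h2
      obtain ⟨r, rfl⟩ := Nat.exists_eq_add_of_le h1
      have e1 : n * ν + 1 + r = n * ν + r + 1 := by ring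
      rw [e1] at h2 ⊢
      rw [hcount _ h2, hlow (by omega), hlow (by omega)]
      rw [show n * ν + r + 1 - n * ν = r + 1 by omega, show n * ν + r - n * ν = r by omega,
        show 2 * (n * ν + r + 1) - n * ν - 2 = r + r + n * ν by omega, Nat.sub_mul]
      congr 1 <;> ring
end

section
/- Let α₀ be a unit of R such that x^n − α₀ is basic irreducible over R, let α = α₀^{p^s}, write f = x^n − α₀, and let C = ⟨γ f^τ⟩ be an ideal of K = R[x]/⟨x^{np^s} − α⟩ with 0 ≤ τ < p^s. Then the Hamming distance of C is: 1 if τ = 0; ℓ + 2 if ℓp^{s−1} + 1 ≤ τ ≤ (ℓ+1)p^{s−1} for some 0 ≤ ℓ ≤ p − 2; and (i+1)p^k if p^s − p^{s−k} + (i−1)p^{s−k−1} + 1 ≤ τ ≤ p^s − p^{s−k} + i·p^{s−k−1} for some 1 ≤ i ≤ p − 1 and 1 ≤ k ≤ s − 1. -/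
open Polynomial

/-- digit product -/
def PP (p s t : ℕ) : ℕ := ∏ j ∈ Finset.range s, (t / p ^ j % p + 1)

theorem PP_pos (p s t : ℕ) : 1 ≤ PP p s t := by
  unfold PP
  exact Finset.one_le_prod' (fun i _ => by omega)

theorem PP_step {p : ℕ} (s t e : ℕ) (he : e < p) : PP p (s+1) (p * t + e) = (e+1) * PP p s t := by
  unfold PP
  rw [Finset.prod_range_succ', mul_comm]
  congr 1
  · simp [Nat.mul_add_mod, Nat.mod_eq_of_lt he]
  · apply Finset.prod_congr rfl
    intro j _
    rw [pow_succ', ← Nat.div_div_eq_div_mul, Nat.mul_add_div (by omega), Nat.div_eq_of_lt he, add_zero]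

theorem PP_add (p a b t : ℕ) : PP p (a+b) t = PP p a t * PP p b (t / p ^ a) := by
  unfold PP
  rw [Finset.prod_range_add]
  congr 1
  apply Finset.prod_congr rfl
  intro j _
  rw [pow_add, Nat.div_div_eq_div_mul]

theorem PP_ge_two {p : ℕ} (hp : 1 < p) (s t : ℕ) (h : t % p ^ s ≠ 0) : 2 ≤ PP p s t := by
  induction s generalizing t with
  | zero => simp [Nat.mod_one] at h
  | succ s ih =>
    have hlt : t % p < p := Nat.mod_lt _ (by omega)
    have h1 := PP_step s (t / p) (t % p) hlt
    rw [Nat.div_add_mod] at h1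
    rw [h1]
    have h3 := PP_pos p s (t/p)
    by_cases h0 : t % p = 0
    · have h2 : (t / p) % p ^ s ≠ 0 := by
        intro hc
        apply h
        rw [pow_succ', Nat.mod_mul, h0, hc]; simp
      have := ih _ h2
      rw [h0]; omega
    · have : 1 ≤ t % p := by omega
      nlinarith

theorem PP_case1 {p : ℕ} (hp : 1 < p) (s t l : ℕ) (hl : l + 1 < p)
    (h : l * p ^ s + 1 ≤ t % p ^ (s+1)) : l + 2 ≤ PP p (s+1) t := by
  have hP : 0 < p ^ s := by positivity
  rw [PP_add]
  have h1 := PP_pos p s t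
  have e1 : PP p 1 (t / p ^ s) = t / p ^ s % p + 1 := by simp [PP]
  rw [e1]
  rw [pow_succ, Nat.mod_mul] at h
  have hlt : t % p ^ s < p ^ s := Nat.mod_lt _ hP
  set d := t / p ^ s % p
  have hd : l ≤ d := by
    by_contra hc
    have : (d+1) * p ^ s ≤ l * p ^ s := Nat.mul_le_mul_right _ (by omega)
    nlinarith
  rcases Nat.lt_or_ge l d with h2 | h2
  · nlinarith
  · have hd' : d = l := by omega
    have : t % p ^ s ≠ 0 := by
      intro h0
      rw [h0, hd'] at h
      nlinarith
    have := PP_ge_two hp s t this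
    nlinarith

theorem PP_full {p : ℕ} (hp : 1 < p) (k : ℕ) : PP p k (p ^ k - 1) = p ^ k := by
  induction k with
  | zero => simp [PP]
  | succ k ih =>
    have h := PP_step k (p ^ k - 1) (p-1) (show p - 1 < p by omega)
    have hP : 0 < p ^ k := by positivity
    have : p * (p ^ k - 1) + (p - 1) = p ^ (k+1) - 1 := by
      obtain ⟨c, hc⟩ : ∃ c, p ^ k = c + 1 := ⟨p^k-1, by omega⟩
      rw [pow_succ, hc]
      have : (c+1) * p = p * c + p := by ring
      rw [this]; simp; omega
    rw [this, ih] at h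
    rw [h, pow_succ']
    congr 1; omega

theorem PP_case2 {p : ℕ} (hp : 1 < p) (a k t i : ℕ) (hi : 1 ≤ i) (hi' : i < p)
    (h : p ^ (a + 1 + k) - p ^ (a+1) + (i - 1) * p ^ a + 1 ≤ t) (ht : t < p ^ (a+1+k)) :
    (i + 1) * p ^ k ≤ PP p (a+1+k) t := by
  have hP : 0 < p ^ (a+1) := by positivity
  have hK : 0 < p ^ k := by positivity
  rw [pow_add p (a+1) k] at h ht
  set Q := p ^ (a+1) with hQ
  obtain ⟨c, hc⟩ : ∃ c, p ^ k = c + 1 := ⟨p^k-1, by omega⟩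
  have e : Q * p ^ k - Q = Q * c := by rw [hc, mul_add]; simp
  rw [e] at h
  obtain ⟨t', rfl⟩ : ∃ t', t = Q * c + t' := ⟨t - Q * c, by omega⟩
  have ht' : t' < Q := by rw [hc, mul_add] at ht; omega
  rw [PP_add, ← hQ]
  have hdiv : (Q * c + t') / Q = p ^ k - 1 := by
    rw [Nat.mul_add_div hP, Nat.div_eq_of_lt ht', hc]; simp
  rw [hdiv, PP_full hp]
  apply Nat.mul_le_mul_right
  have := PP_case1 hp a (Q * c + t') (i-1) (by omega) (by
    rw [← hQ, Nat.mul_add_mod, Nat.mod_eq_of_lt ht']; omega)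
  omega

section sec
variable {F : Type} [CommRing F]

/-- section polynomial -/
noncomputable def sct (q j : ℕ) (h : F[X]) : F[X] :=
  ∑ k ∈ Finset.range (h.natDegree + 1), monomial k (h.coeff (k * q + j))

theorem coeff_sct {q : ℕ} (hq : 0 < q) (j : ℕ) (h : F[X]) (k : ℕ) :
    (sct q j h).coeff k = h.coeff (k * q + j) := by
  unfold sct
  rw [finsetSum_coeff]
  simp only [coeff_monomial]
  rw [Finset.sum_ite_eq']
  split_ifs with hk
  · rfl
  · symm
    apply coeff_eq_zero_of_natDegree_lt
    simp at hk
    nlinarith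

theorem sct_add {q : ℕ} (hq : 0 < q) (j : ℕ) (h g : F[X]) :
    sct q j (h + g) = sct q j h + sct q j g := by
  ext k; simp [coeff_sct hq]

theorem sct_monomial_mul {q : ℕ} (hq : 0 < q) {j : ℕ} (hj : j < q) (d : ℕ) (a : F) (h : F[X]) :
    sct q j (monomial (d * q) a * h) = monomial d a * sct q j h := by
  ext k
  rw [coeff_sct hq, ← C_mul_X_pow_eq_monomial, ← C_mul_X_pow_eq_monomial, mul_assoc, mul_assoc, coeff_C_mul, coeff_C_mul, coeff_X_pow_mul', coeff_X_pow_mul', coeff_sct hq]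
  by_cases hk : d ≤ k
  · obtain ⟨c, rfl⟩ := Nat.exists_eq_add_of_le hk
    rw [if_pos (by nlinarith), if_pos hk]
    congr 2
    rw [add_mul, Nat.add_sub_cancel_left]; omega
  · rw [if_neg, if_neg hk]
    have : (k+1) * q ≤ d * q := Nat.mul_le_mul_right _ (by omega)
    nlinarith

theorem sct_expand_mul {q : ℕ} (hq : 0 < q) {j : ℕ} (hj : j < q) (g h : F[X]) :
    sct q j (expand F q g * h) = g * sct q j h := by
  induction g using Polynomial.induction_on' with
  | add a b ha hb => rw [map_add, add_mul, sct_add hq, ha, hb, add_mul]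
  | monomial d a => rw [expand_monomial, sct_monomial_mul hq hj]

theorem sct_decomp {q : ℕ} (hq : 0 < q) (h : F[X]) :
    h = ∑ j ∈ Finset.range q, expand F q (sct q j h) * X ^ j := by
  ext k
  rw [finsetSum_coeff, Finset.sum_eq_single (k % q)]
  · rw [coeff_mul_X_pow', if_pos (Nat.mod_le _ _), coeff_expand hq]
    have : k - k % q = q * (k / q) := by have := Nat.div_add_mod k q; omega
    rw [if_pos (by rw [this]; exact dvd_mul_right _ _), this, Nat.mul_div_cancel_left _ hq, coeff_sct hq, mul_comm, Nat.div_add_mod]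
  · intro b hb hne
    rw [coeff_mul_X_pow']
    split_ifs with h1
    · rw [coeff_expand hq, if_neg]
      rintro ⟨c, hc⟩
      apply hne
      have : k = q * c + b := by omega
      rw [this, Nat.mul_add_mod, Nat.mod_eq_of_lt (Finset.mem_range.1 hb)]
    · rfl
  · intro h1
    exact absurd (Finset.mem_range.2 (Nat.mod_lt _ hq)) h1

theorem sct_card {q : ℕ} (hq : 0 < q) (h : F[X]) :
    ∑ j ∈ Finset.range q, (sct q j h).support.card ≤ h.support.card := by
  rw [Finset.card_eq_sum_card_fiberwise (f := (· % q)) (t := Finset.range q)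
    (fun x _ => by simpa using Nat.mod_lt _ hq)]
  apply Finset.sum_le_sum
  intro j hj
  apply Finset.card_le_card_of_injOn (fun k => k * q + j)
  · intro k hk
    simp [coeff_sct hq] at hk ⊢
    exact ⟨hk, Nat.mod_eq_of_lt (Finset.mem_range.1 hj)⟩
  · intro a _ b _ hab
    simp at hab
    rcases hab with h | h
    · exact h
    · omega

theorem sct_ne {q : ℕ} (hq : 0 < q) (h : F[X]) (hh : h ≠ 0) : ∃ j < q, sct q j h ≠ 0 := by
  by_contra hc
  push Not at hc
  apply hh
  rw [sct_decomp hq h]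
  apply Finset.sum_eq_zero
  intro j hj
  rw [hc j (Finset.mem_range.1 hj)]; simp

theorem sct_deg {q : ℕ} (hq : 0 < q) (h : F[X]) (j M : ℕ) (hd : h.degree < ((q * M : ℕ) : WithBot ℕ)) :
    (sct q j h).degree < (M : WithBot ℕ) := by
  rw [degree_lt_iff_coeff_zero] at hd ⊢
  intro k hk
  rw [coeff_sct hq]
  apply hd
  nlinarith
end sec

section fld
variable {F : Type} [Field F]

theorem descartes {p : ℕ} [CharP F p] (a : F) (ha : a ≠ 0) (e : ℕ) :
    ∀ u : F[X], u ≠ 0 → u.degree < (p : WithBot ℕ) → (X - C a) ^ e ∣ u → e + 1 ≤ u.support.card := by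
  induction e with
  | zero => intro u hu _ _; simpa [Nat.one_le_iff_ne_zero, Finset.card_eq_zero] using hu
  | succ e ih =>
    intro u hu hdeg hdvd
    obtain ⟨v, hv⟩ : ∃ v, v ∈ u.support := Finset.nonempty_iff_ne_empty.2 (by simpa using hu)
    have hltp : ∀ k, u.coeff k ≠ 0 → k < p := by
      intro k hk
      by_contra hc
      exact hk ((degree_lt_iff_coeff_zero _ _).1 hdeg k (by omega))
    set w : F[X] := X * derivative u - C (v : F) * u with hw
    have hcoef : ∀ k, w.coeff k = ((k : F) - v) * u.coeff k := by
      intro k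
      rw [hw, coeff_sub, coeff_C_mul]
      cases k with
      | zero => simp
      | succ k => rw [coeff_X_mul, coeff_derivative]; push_cast; ring
    have hsup : w.support = u.support.erase v := by
      ext k
      simp only [mem_support_iff, Finset.mem_erase, hcoef, mul_ne_zero_iff]
      constructor
      · rintro ⟨h1, h2⟩
        exact ⟨fun h => h1 (by rw [h, sub_self]), h2⟩
      · rintro ⟨h1, h2⟩
        refine ⟨fun h => h1 ?_, h2⟩
        rw [sub_eq_zero] at h
        rw [CharP.cast_eq_iff_mod_eq F p] at h
        have e1 := hltp k h2
        have e2 := hltp v (mem_support_iff.1 hv)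
        rwa [Nat.mod_eq_of_lt e1, Nat.mod_eq_of_lt e2] at h
    have hcard : w.support.card + 1 = u.support.card := by
      rw [hsup, Finset.card_erase_add_one hv]
    have hw0 : w ≠ 0 := by
      intro h0
      rw [h0] at hcard
      simp at hcard
      obtain ⟨k, x, hx, hux⟩ := card_support_eq_one.1 hcard.symm
      have h1 : (X - C a) ∣ u := (dvd_pow_self _ (by omega)).trans hdvd
      rw [dvd_iff_isRoot, IsRoot, hux] at h1
      simp [hx, ha] at h1
    have hwd : (X - C a) ^ e ∣ w := by
      obtain ⟨g, hg⟩ := hdvd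
      apply dvd_sub
      · apply Dvd.dvd.mul_left
        rw [hg, derivative_mul, derivative_pow]
        apply dvd_add
        · simp only [Nat.add_sub_cancel]
          exact ⟨C ((e+1:ℕ):F) * derivative (X - C a) * g, by ring⟩
        · exact ⟨(X - C a) * derivative g, by ring⟩
      · exact Dvd.dvd.mul_left ⟨(X - C a) * g, by rw [hg]; ring⟩ _
    have := ih w hw0 (by
      rw [degree_lt_iff_coeff_zero] at hdeg ⊢
      intro k hk
      rw [hcoef, hdeg k hk, mul_zero]) hwd
    omega

theorem lower {p : ℕ} [hp : Fact p.Prime] [CharP F p] (s : ℕ) :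
    ∀ (a : F), a ≠ 0 → ∀ (h : F[X]) (τ : ℕ), h ≠ 0 → h.degree < ((p ^ s : ℕ) : WithBot ℕ) →
      (X - C a) ^ τ ∣ h → ∃ t, τ ≤ t ∧ t < p ^ s ∧ PP p s t ≤ h.support.card := by
  have hp0 : 0 < p := hp.out.pos
  induction s with
  | zero =>
    intro a ha h τ hh hdeg hdvd
    have := degree_le_of_dvd hdvd hh
    rw [degree_pow, degree_X_sub_C] at this
    have h2 := this.trans_lt hdeg
    simp at h2
    refine ⟨0, by omega, by simp, ?_⟩
    simpa [PP, Nat.one_le_iff_ne_zero, Finset.card_eq_zero] using hh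
  | succ s ih =>
    intro a ha h τ hh hdeg hdvd
    have hchar : (X - C a : F[X]) ^ p = X ^ p - C (a ^ p) := by
      rw [sub_pow_char, C_pow]
    have hexp : expand F p (X - C (a ^ p)) = X ^ p - C (a ^ p) := by simp
    have hmon : (X ^ p - C (a ^ p) : F[X]).Monic := monic_X_pow_sub_C _ hp0.ne'
    have hfin : FiniteMultiplicity (X ^ p - C (a ^ p) : F[X]) h :=
      finiteMultiplicity_of_degree_pos_of_monic (by rw [degree_X_pow_sub_C hp0]; exact_mod_cast hp0) hmon hh
    obtain ⟨h', hh', hnd⟩ := hfin.exists_eq_pow_mul_and_not_dvd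
    set E := multiplicity (X ^ p - C (a ^ p) : F[X]) h with hE
    have hd' : (X - C a) ^ (τ - p * E) ∣ h' := by
      rcases Nat.lt_or_ge τ (p * E) with hlt | hge
      · rw [Nat.sub_eq_zero_of_le hlt.le]; simp
      · rw [hh', ← hchar, ← pow_mul] at hdvd
        have : τ = p * E + (τ - p * E) := by omega
        rw [this, pow_add] at hdvd
        exact (mul_dvd_mul_iff_left (pow_ne_zero _ (X_sub_C_ne_zero a))).1 hdvd
    set e := τ - p * E with he
    have hep : e < p := by
      by_contra hc
      apply hnd
      rw [← hchar]
      exact (pow_dvd_pow _ (by omega)).trans hd'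
    set u : F[X] := ∑ j ∈ Finset.range p, C (eval (a ^ p) (sct p j h')) * X ^ j with hu
    have hucoef : ∀ k, u.coeff k = if k < p then eval (a ^ p) (sct p k h') else 0 := by
      intro k
      rw [hu, finsetSum_coeff]
      simp only [coeff_C_mul, coeff_X_pow, mul_ite, mul_one, mul_zero]
      rw [Finset.sum_ite_eq]; simp
    have hdiff : (X ^ p - C (a ^ p) : F[X]) ∣ h' - u := by
      rw [hu]
      conv_rhs => lhs; rw [sct_decomp hp0 h']
      rw [← Finset.sum_sub_distrib]
      apply Finset.dvd_sum
      intro j _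
      rw [← sub_mul]
      apply Dvd.dvd.mul_right
      have := map_dvd (expand F p) (X_sub_C_dvd_sub_C_eval (a := a ^ p) (p := sct p j h'))
      rwa [hexp, map_sub, expand_C] at this
    have hu0 : u ≠ 0 := by
      intro h0
      rw [h0, sub_zero] at hdiff
      exact hnd hdiff
    have hud : (X - C a) ^ e ∣ u := by
      have h1 : (X - C a) ^ e ∣ h' - u := by
        rw [← hchar] at hdiff
        exact (pow_dvd_pow _ hep.le).trans hdiff
      have := dvd_sub hd' h1
      simpa using this
    have hcard := descartes (p := p) a ha e u hu0 (by
      rw [degree_lt_iff_coeff_zero]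
      intro k hk
      rw [hucoef, if_neg (by omega)]) hud
    have hsec : ∀ j ∈ u.support, ∃ t, E ≤ t ∧ t < p ^ s ∧ PP p s t ≤ (sct p j h).support.card := by
      intro j hj
      rw [mem_support_iff, hucoef] at hj
      have hjp : j < p := by
        by_contra hc
        rw [if_neg hc] at hj; exact hj rfl
      rw [if_pos hjp] at hj
      have h1 : sct p j h = (X - C (a ^ p)) ^ E * sct p j h' := by
        conv_lhs => rw [hh', ← hexp, ← map_pow]
        rw [sct_expand_mul hp0 hjp]
      apply ih (a ^ p) (pow_ne_zero _ ha)
      · rw [h1]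
        apply mul_ne_zero (pow_ne_zero _ (X_sub_C_ne_zero _))
        intro h0
        rw [h0] at hj; simp at hj
      · apply sct_deg hp0
        rw [← pow_succ']; exact hdeg
      · rw [h1]; exact dvd_mul_right _ _
    choose! T hT1 hT2 hT3 using hsec
    obtain ⟨j0, hj0, hmin⟩ := Finset.exists_min_image u.support (fun j => PP p s (T j))
      (Finset.nonempty_iff_ne_empty.2 (by simpa using hu0))
    refine ⟨p * T j0 + e, ?_, ?_, ?_⟩
    · have := Nat.mul_le_mul_left p (hT1 j0 hj0)
      omega
    · have := Nat.mul_le_mul_left p (Nat.succ_le_of_lt (hT2 j0 hj0))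
      rw [← pow_succ', Nat.mul_succ] at this
      omega
    · rw [PP_step s _ e hep]
      calc (e+1) * PP p s (T j0) ≤ u.support.card * PP p s (T j0) := Nat.mul_le_mul_right _ hcard
        _ = ∑ j ∈ u.support, PP p s (T j0) := by simp
        _ ≤ ∑ j ∈ u.support, (sct p j h).support.card :=
            Finset.sum_le_sum fun j hj => (hmin j hj).trans (hT3 j hj)
        _ ≤ ∑ j ∈ Finset.range p, (sct p j h).support.card := by
            apply Finset.sum_le_sum_of_subset
            intro j hj
            rw [mem_support_iff, hucoef] at hj
            by_contra hc
            rw [Finset.mem_range] at hc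
            rw [if_neg hc] at hj; exact hj rfl
        _ ≤ _ := sct_card hp0 h

theorem lower_n {p : ℕ} [hp : Fact p.Prime] [CharP F p] (s n : ℕ) (hn : 0 < n)
    (a : F) (ha : a ≠ 0) (h : F[X]) (τ : ℕ) (hh : h ≠ 0)
    (hdeg : h.degree < ((n * p ^ s : ℕ) : WithBot ℕ))
    (hdvd : (X ^ n - C a) ^ τ ∣ h) : ∃ t, τ ≤ t ∧ t < p ^ s ∧ PP p s t ≤ h.support.card := by
  obtain ⟨j, hj, hne⟩ := sct_ne hn h hh
  obtain ⟨g, hg⟩ := hdvd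
  have hexp : expand F n (X - C a) = X ^ n - C a := by simp
  obtain ⟨t, h1, h2, h3⟩ := lower (p := p) s a ha (sct n j h) τ hne (sct_deg hn _ _ _ hdeg) (by
    rw [hg, ← hexp, ← map_pow, sct_expand_mul hn hj]; exact dvd_mul_right _ _)
  refine ⟨t, h1, h2, h3.trans ?_⟩
  exact (Finset.single_le_sum (f := fun j => (sct n j h).support.card) (fun _ _ => Nat.zero_le _)
    (Finset.mem_range.2 hj)).trans (sct_card hn h)

theorem wt_mul (g h : F[X]) : (g * h).support.card ≤ g.support.card * h.support.card := by
  classical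
  have hsub : (g * h).support ⊆ (g.support ×ˢ h.support).image (fun x => x.1 + x.2) := by
    intro k hk
    rw [mem_support_iff, coeff_mul] at hk
    obtain ⟨x, hx, hne⟩ := Finset.exists_ne_zero_of_sum_ne_zero hk
    rw [Finset.mem_image]
    refine ⟨x, ?_, by simpa using hx⟩
    rw [Finset.mem_product, mem_support_iff, mem_support_iff]
    exact mul_ne_zero_iff.1 hne
  refine (Finset.card_le_card hsub).trans (Finset.card_image_le.trans ?_)
  rw [Finset.card_product]

theorem wt_pow {p : ℕ} [hp : Fact p.Prime] [CharP F p] (n e j : ℕ) (hn : 0 < n) (a : F) :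
    ((X ^ n - C a : F[X]) ^ (p ^ e * j)).support.card ≤ j + 1 := by
  have hM : 0 < n * p ^ e := Nat.mul_pos hn (pow_pos hp.out.pos _)
  have h1 : (X ^ n - C a : F[X]) ^ (p ^ e * j) = expand F (n * p ^ e) ((X - C (a ^ p ^ e)) ^ j) := by
    rw [pow_mul, sub_pow_char_pow, map_pow]; simp [pow_mul]
  rw [h1]
  have h2 : (expand F (n * p ^ e) ((X - C (a ^ p ^ e)) ^ j)).support.card ≤
      ((X - C (a ^ p ^ e)) ^ j).support.card := by
    apply Finset.card_le_card_of_surjOn (fun k => k * (n * p ^ e))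
    intro k hk
    simp only [Finset.mem_coe, mem_support_iff, coeff_expand hM] at hk
    split_ifs at hk with hd
    · exact ⟨_, by simpa using hk, Nat.div_mul_cancel hd⟩
    · exact absurd rfl hk
  refine h2.trans ((card_supp_le_succ_natDegree _).trans ?_)
  rw [natDegree_pow, natDegree_X_sub_C, mul_one]
end fld

theorem polyRep_mk {A : Type} [CommRing A] (q : A[X]) (hq : q.Monic) (g : A[X]) :
    polyRep q (Ideal.Quotient.mk (Ideal.span {q}) g) = g %ₘ q := by
  unfold polyRep
  set g' := Function.surjInv Ideal.Quotient.mk_surjective (Ideal.Quotient.mk (Ideal.span {q}) g)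
  have h1 : Ideal.Quotient.mk (Ideal.span {q}) g' = Ideal.Quotient.mk (Ideal.span {q}) g :=
    Function.surjInv_eq _ _
  rw [Ideal.Quotient.eq, Ideal.mem_span_singleton] at h1
  have h2 := (modByMonic_eq_zero_iff_dvd hq).2 h1
  rw [sub_modByMonic, sub_eq_zero] at h2
  exact h2

theorem dH_eq_s12 {R : Type} [CommRing R]
    (p m s n : ℕ) (hp : p.Prime) (hn : 0 < n)
    (γ : R) (hγ : γ ≠ 0) (hγ2 : γ ^ 2 = 0)
    (hmax : ∀ a : R, a ∈ Ideal.span {γ} ↔ ¬ IsUnit a)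
    (hres : Nat.card (R ⧸ Ideal.span {γ}) = p ^ m)
    (α₀ : R) (hα₀ : IsUnit α₀) (τ : ℕ) (d t0 : ℕ) (ht0 : τ ≤ t0) (ht0' : t0 < p ^ s)
    (hlow : ∀ t, τ ≤ t → t < p ^ s → d ≤ PP p s t)
    (hup : ∀ (F : Type) [Field F] [CharP F p] (a : F),
      ((X ^ n - C a : F[X]) ^ t0).support.card ≤ d) :
    dH (X ^ (n * p ^ s) - C (α₀ ^ p ^ s))
        (Ideal.span {Ideal.Quotient.mk
          (Ideal.span {(X ^ (n * p ^ s) - C (α₀ ^ p ^ s) : R[X])})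
          (C γ * (X ^ n - C α₀) ^ τ)}) = d := by
  have hpf : Fact p.Prime := ⟨hp⟩
  have hps : 0 < p ^ s := pow_pos hp.pos _
  have hN : 0 < n * p ^ s := Nat.mul_pos hn hps
  have hnt : Nontrivial R := ⟨⟨γ, 0, hγ⟩⟩
  have hM : (Ideal.span {γ}).IsMaximal := by
    rw [Ideal.isMaximal_iff]
    refine ⟨fun h => (hmax 1).1 h isUnit_one, ?_⟩
    intro J x _ hx hxJ
    have hu : IsUnit x := by
      by_contra hc
      exact hx ((hmax x).2 hc)
    rw [Ideal.eq_top_of_isUnit_mem _ hxJ hu]; trivial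
  obtain ⟨F, hFld, π, hπ, hcard⟩ : ∃ (F : Type) (_ : Field F) (π : R →+* F),
      (∀ a, π a = 0 ↔ a ∈ Ideal.span {γ}) ∧ Nat.card F = p ^ m :=
    ⟨R ⧸ Ideal.span {γ}, Ideal.Quotient.field _, Ideal.Quotient.mk (Ideal.span {γ}),
      fun a => Ideal.Quotient.eq_zero_iff_mem, hres⟩
  have hfin : Finite F := Nat.finite_of_card_ne_zero (by rw [hcard]; exact pow_ne_zero _ hp.ne_zero)
  have hchar : CharP F p := by
    obtain ⟨r, hr⟩ := CharP.exists F
    have := Fintype.ofFinite F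
    obtain ⟨k, hrp, hk⟩ := FiniteField.card F r
    rw [← Nat.card_eq_fintype_card, hcard] at hk
    have h1 : r ∣ p ^ m := by rw [hk]; exact dvd_pow_self _ k.pos.ne'
    have h2 := (Nat.prime_dvd_prime_iff_eq hrp hp).1 (hrp.dvd_of_dvd_pow h1)
    rwa [h2] at hr
  have hsupp : ∀ r : R[X], (C γ * r).support = (r.map π).support := by
    intro r
    ext k
    rw [mem_support_iff, mem_support_iff, coeff_C_mul, coeff_map, not_iff_not]
    rw [hπ]
    constructor
    · intro h
      rw [hmax]
      intro hu
      exact hγ (hu.mul_left_eq_zero.1 h)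
    · intro h
      obtain ⟨c, hc⟩ := Ideal.mem_span_singleton.1 h
      rw [hc, ← mul_assoc, ← sq, hγ2, zero_mul]
  set q : R[X] := X ^ (n * p ^ s) - C (α₀ ^ p ^ s) with hq
  have hqm : q.Monic := monic_X_pow_sub_C _ hN.ne'
  have hqF : q.map π = (X ^ n - C (π α₀)) ^ (p ^ s) := by
    rw [sub_pow_char_pow, hq]; simp [pow_mul]
  have hfF : (X ^ n - C α₀ : R[X]).map π = X ^ n - C (π α₀) := by simp
  have ha : π α₀ ≠ 0 := (hα₀.map π).ne_zero
  have hrep : ∀ g : R[X], polyRep q (Ideal.Quotient.mk (Ideal.span {q}) (C γ * g)) =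
      C γ * (g %ₘ q) := by
    intro g
    rw [polyRep_mk q hqm, ← smul_eq_C_mul, smul_modByMonic, smul_eq_C_mul]
  have hwt : ∀ g : R[X], wH q (Ideal.Quotient.mk (Ideal.span {q}) (C γ * g)) =
      (g.map π %ₘ q.map π).support.card := by
    intro g
    unfold wH
    rw [hrep, hsupp, map_modByMonic π hqm]
  set I := Ideal.span {Ideal.Quotient.mk (Ideal.span {q}) (C γ * (X ^ n - C α₀) ^ τ)} with hI
  have hqmF : (q.map π).Monic := hqm.map π
  have hzero : ∀ g : R[X], Ideal.Quotient.mk (Ideal.span {q}) (C γ * g) ≠ 0 →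
      g.map π %ₘ q.map π ≠ 0 := by
    intro g hg h0
    apply hg
    rw [Ideal.Quotient.eq_zero_iff_mem, Ideal.mem_span_singleton, ← modByMonic_eq_zero_iff_dvd hqm,
      ← smul_eq_C_mul, smul_modByMonic, smul_eq_C_mul, ← support_eq_empty, hsupp,
      map_modByMonic π hqm, h0, support_zero]
  have hlow' : ∀ c ∈ I, c ≠ 0 → d ≤ wH q c := by
    intro c hc hc0
    obtain ⟨b, hb⟩ := Ideal.mem_span_singleton.1 hc
    obtain ⟨g, rfl⟩ := Ideal.Quotient.mk_surjective b
    rw [← map_mul, mul_assoc] at hb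
    subst hb
    rw [hwt]
    have hz := hzero _ hc0
    set G := (((X ^ n - C α₀) ^ τ * g : R[X])).map π with hG
    have hGd : (X ^ n - C (π α₀)) ^ τ ∣ G := by
      rw [hG, Polynomial.map_mul, Polynomial.map_pow, hfF]; exact dvd_mul_right _ _
    obtain ⟨t, h1, h2, h3⟩ := lower_n (p := p) s n hn (π α₀) ha (G %ₘ q.map π) τ hz
      (by
        have := degree_modByMonic_lt G hqmF
        rw [hqm.degree_map, hq, degree_X_pow_sub_C hN] at this
        exact this)
      (by
        rw [modByMonic_eq_sub_mul_div]
        apply dvd_sub hGd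
        apply Dvd.dvd.mul_right
        rw [hqF]
        exact pow_dvd_pow _ (by omega))
    exact (hlow t h1 h2).trans h3
  have hG0 : ((X ^ n - C α₀ : R[X]) ^ t0).map π %ₘ q.map π = (X ^ n - C (π α₀)) ^ t0 := by
    rw [Polynomial.map_pow, hfF]
    rw [modByMonic_eq_self_iff hqmF, hqF, degree_pow, degree_pow, degree_X_pow_sub_C hn]
    rw [nsmul_eq_mul, nsmul_eq_mul]
    exact_mod_cast Nat.mul_lt_mul_of_pos_right ht0' hn
  have hne : (X ^ n - C (π α₀) : F[X]) ^ t0 ≠ 0 := pow_ne_zero _ (X_pow_sub_C_ne_zero hn _)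
  have hc0 : Ideal.Quotient.mk (Ideal.span {q}) (C γ * (X ^ n - C α₀) ^ t0) ≠ 0 := by
    intro h0
    have h1 := hwt ((X ^ n - C α₀) ^ t0)
    rw [h0, hG0] at h1
    have h2 : wH q (0 : R[X] ⧸ Ideal.span {q}) = 0 := by
      unfold wH
      rw [← map_zero (Ideal.Quotient.mk (Ideal.span {q})), polyRep_mk q hqm]; simp
    rw [h2] at h1
    exact hne (support_eq_empty.1 (Finset.card_eq_zero.1 h1.symm))
  have hcI : Ideal.Quotient.mk (Ideal.span {q}) (C γ * (X ^ n - C α₀) ^ t0) ∈ I := by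
    rw [hI, Ideal.mem_span_singleton]
    apply _root_.map_dvd
    exact mul_dvd_mul_left _ (pow_dvd_pow _ ht0)
  have hw : wH q (Ideal.Quotient.mk (Ideal.span {q}) (C γ * (X ^ n - C α₀) ^ t0)) ≤ d := by
    rw [hwt, hG0]; exact hup F _
  have hmem : wH q (Ideal.Quotient.mk (Ideal.span {q}) (C γ * (X ^ n - C α₀) ^ t0)) ∈
      {w : ℕ | ∃ c ∈ I, c ≠ 0 ∧ w = wH q c} := ⟨_, hcI, hc0, rfl⟩
  unfold dH
  apply le_antisymm
  · exact (Nat.sInf_le hmem).trans hw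
  · apply le_csInf ⟨_, hmem⟩
    rintro w ⟨c, hc, hcn, rfl⟩
    exact hlow' c hc hcn

/-- Hamming distances of the Type II codes `⟨γ f^τ⟩` of
`K = R[x]/⟨x^{np^s} − α₀^{p^s}⟩`, where `f = x^n − α₀` is basic irreducible. -/
theorem stmt12 {R : Type} [CommRing R] [Finite R]
    (p m s n : ℕ) (hp : p.Prime) (hm : 0 < m) (hs : 0 < s) (hn : 0 < n)
    (hnp : Nat.gcd n p = 1)
    (γ : R) (hγ : γ ≠ 0) (hγ2 : γ ^ 2 = 0)
    (hmax : ∀ a : R, a ∈ Ideal.span {γ} ↔ ¬ IsUnit a)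
    (hres : Nat.card (R ⧸ Ideal.span {γ}) = p ^ m)
    (α₀ : R) (hα₀ : IsUnit α₀)
    (hirr : Irreducible ((X ^ n - C α₀ : R[X]).map (Ideal.Quotient.mk (Ideal.span {γ}))))
    (τ : ℕ) (hτ : τ < p ^ s) :
    (τ = 0 →
      dH (X ^ (n * p ^ s) - C (α₀ ^ p ^ s))
        (Ideal.span {Ideal.Quotient.mk
          (Ideal.span {(X ^ (n * p ^ s) - C (α₀ ^ p ^ s) : R[X])})
          (C γ * (X ^ n - C α₀) ^ τ)}) = 1) ∧
    (∀ ℓ, ℓ ≤ p - 2 → ℓ * p ^ (s - 1) + 1 ≤ τ → τ ≤ (ℓ + 1) * p ^ (s - 1) →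
      dH (X ^ (n * p ^ s) - C (α₀ ^ p ^ s))
        (Ideal.span {Ideal.Quotient.mk
          (Ideal.span {(X ^ (n * p ^ s) - C (α₀ ^ p ^ s) : R[X])})
          (C γ * (X ^ n - C α₀) ^ τ)}) = ℓ + 2) ∧
    (∀ i k, 1 ≤ i → i ≤ p - 1 → 1 ≤ k → k ≤ s - 1 →
      p ^ s - p ^ (s - k) + (i - 1) * p ^ (s - k - 1) + 1 ≤ τ →
      τ ≤ p ^ s - p ^ (s - k) + i * p ^ (s - k - 1) →
      dH (X ^ (n * p ^ s) - C (α₀ ^ p ^ s))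
        (Ideal.span {Ideal.Quotient.mk
          (Ideal.span {(X ^ (n * p ^ s) - C (α₀ ^ p ^ s) : R[X])})
          (C γ * (X ^ n - C α₀) ^ τ)}) = (i + 1) * p ^ k) := by
  have hpf : Fact p.Prime := ⟨hp⟩
  have hp1 := hp.one_lt
  refine ⟨?_, ?_, ?_⟩
  · intro h0
    refine dH_eq_s12 p m s n hp hn γ hγ hγ2 hmax hres α₀ hα₀ τ 1 0 (by omega) (by omega)
      (fun t _ _ => PP_pos p s t) ?_
    intro F _ _ a
    simpa using wt_pow (p := p) n 0 0 hn a
  · intro l hl h1 h2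
    obtain ⟨s, rfl⟩ : ∃ s', s = s' + 1 := ⟨s - 1, by omega⟩
    simp only [Nat.add_sub_cancel] at h1 h2
    have hP : 0 < p ^ s := pow_pos hp.pos _
    refine dH_eq_s12 p m (s+1) n hp hn γ hγ hγ2 hmax hres α₀ hα₀ τ (l+2) ((l+1) * p ^ s) h2 ?_ ?_ ?_
    · rw [pow_succ']
      exact Nat.mul_lt_mul_of_pos_right (by omega) hP
    · intro t ht ht'
      apply PP_case1 hp1 s t l (by omega)
      rw [Nat.mod_eq_of_lt ht']; omega
    · intro F _ _ a
      rw [mul_comm]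
      exact wt_pow (p := p) n s (l+1) hn a
  · intro i k hi hi' hk hk' h1 h2
    obtain ⟨b, rfl⟩ : ∃ b, s = b + 1 + k := ⟨s - k - 1, by omega⟩
    have e1 : b + 1 + k - k = b + 1 := by omega
    rw [e1, Nat.add_sub_cancel] at h1 h2
    have hB : 0 < p ^ b := pow_pos hp.pos _
    have hK : 0 < p ^ k := pow_pos hp.pos _
    have e2 : p ^ (b + 1 + k) - p ^ (b + 1) = p ^ (b+1) * (p ^ k - 1) := by
      rw [pow_add p (b+1) k, Nat.mul_sub, mul_one]
    have h3 : p ^ (b+1) ≤ p ^ (b+1+k) := Nat.pow_le_pow_right hp.pos (by omega)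
    have h4 : i * p ^ b < p ^ (b+1) := by
      rw [pow_succ']
      exact Nat.mul_lt_mul_of_pos_right (by omega) hB
    refine dH_eq_s12 p m (b+1+k) n hp hn γ hγ hγ2 hmax hres α₀ hα₀ τ ((i+1) * p ^ k)
      (p ^ (b + 1 + k) - p ^ (b + 1) + i * p ^ b) h2 (by omega) ?_ ?_
    · intro t ht ht'
      exact PP_case2 hp1 b k t i hi (by omega) (by omega) ht'
    · intro F _ _ a
      rw [e2, pow_add, mul_comm i]
      refine (wt_mul _ _).trans ?_
      rw [mul_comm]
      have w1 := wt_pow (p := p) n b i hn a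
      have w2 := wt_pow (p := p) n (b+1) (p ^ k - 1) hn a
      rw [Nat.sub_add_cancel hK] at w2
      exact Nat.mul_le_mul w1 w2
end

section
/- Let α₀ be a unit of R such that x^n − α₀ is basic irreducible over R, let α = α₀^{p^s}, write f = x^n − α₀, and let C = ⟨f^ω + γ f^t G, γ f^μ⟩ be an ideal of K = R[x]/⟨x^{np^s} − α⟩, where 0 ≤ μ < ω < p^s, G is either 0 or a unit of K, 0 ≤ t < μ when G ≠ 0, and μ < κ, where κ is the least nonnegative integer such that γ f^κ ∈ ⟨f^ω + γ f^t G⟩. Then the Hamming distance of C is: 1 if μ = 0; ℓ + 2 if ℓp^{s−1} + 1 ≤ μ ≤ (ℓ+1)p^{s−1} for some 0 ≤ ℓ ≤ p − 2; and (i+1)p^k if p^s − p^{s−k} + (i−1)p^{s−k−1} + 1 ≤ μ ≤ p^s − p^{s−k} + i·p^{s−k−1} for some 1 ≤ i ≤ p − 1 and 1 ≤ k ≤ s − 1. -/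
open Polynomial

/-- The `r`-th section of a polynomial modulo `n`. -/
noncomputable def sec13 {F : Type*} [CommRing F] (n r : ℕ) (c : F[X]) : F[X] :=
  ∑ j ∈ Finset.range (c.natDegree + 1), monomial j (c.coeff (j * n + r))

lemma sec13_coeff {F : Type*} [CommRing F] {n : ℕ} (hn : 0 < n) (r : ℕ) (c : F[X]) (j : ℕ) :
    (sec13 n r c).coeff j = c.coeff (j * n + r) := by
  unfold sec13
  rw [finsetSum_coeff]
  simp only [coeff_monomial]
  rw [Finset.sum_ite_eq']
  split_ifs with h
  · rfl
  · rw [coeff_eq_zero_of_natDegree_lt]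
    simp at h
    nlinarith

lemma sec13_expand_mul {F : Type*} [CommRing F] {n : ℕ} (hn : 0 < n) {r : ℕ} (hr : r < n)
    (u h : F[X]) : sec13 n r (expand F n u * h) = u * sec13 n r h := by
  induction u using Polynomial.induction_on' with
  | add u v hu hv =>
    rw [map_add, add_mul, add_mul, ← hu, ← hv]
    ext j
    simp [sec13_coeff hn]
  | monomial k a =>
    ext j
    rw [sec13_coeff hn, expand_monomial, ← C_mul_X_pow_eq_monomial, ← C_mul_X_pow_eq_monomial,
      mul_assoc, mul_assoc, coeff_C_mul, coeff_C_mul, coeff_X_pow_mul', coeff_X_pow_mul',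
      sec13_coeff hn]
    congr 1
    by_cases hk : k ≤ j
    · obtain ⟨d, rfl⟩ := Nat.exists_eq_add_of_le hk
      have h1 : k * n ≤ (k + d) * n + r := by nlinarith
      rw [if_pos h1, if_pos hk]
      congr 1
      rw [add_mul, add_assoc, Nat.add_sub_cancel_left, Nat.add_sub_cancel_left]
    · have h1 : ¬ k * n ≤ j * n + r := by
        push Not at hk ⊢
        nlinarith
      rw [if_neg h1, if_neg hk]

lemma sec13_sum {F : Type*} [CommRing F] {n : ℕ} (hn : 0 < n) (h : F[X]) :
    h = ∑ r ∈ Finset.range n, X ^ r * expand F n (sec13 n r h) := by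
  ext d
  rw [finsetSum_coeff, Finset.sum_eq_single (d % n)]
  · rw [coeff_X_pow_mul', if_pos (Nat.mod_le d n), coeff_expand hn]
    have h1 : d - d % n = n * (d / n) := by
      have := Nat.mod_add_div d n
      omega
    rw [h1, if_pos (dvd_mul_right _ _), Nat.mul_div_cancel_left _ hn, sec13_coeff hn,
      mul_comm, Nat.div_add_mod]
  · intro r hr hne
    rw [coeff_X_pow_mul']
    split_ifs with h1
    · rw [coeff_expand hn, if_neg]
      rintro ⟨e, he⟩
      apply hne
      have : d = r + n * e := by omega
      rw [this, Nat.add_mul_mod_self_left, Nat.mod_eq_of_lt (Finset.mem_range.1 hr)]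
    · rfl
  · intro h1
    exact absurd (Finset.mem_range.2 (Nat.mod_lt _ hn)) h1

lemma sec13_card {F : Type*} [CommRing F] {n : ℕ} (hn : 0 < n) (c : F[X]) :
    ∑ r ∈ Finset.range n, (sec13 n r c).support.card ≤ c.support.card := by
  rw [Finset.card_eq_sum_card_fiberwise (f := fun j => j % n) (t := Finset.range n)]
  · apply Finset.sum_le_sum
    intro r hr
    apply Finset.card_le_card_of_injOn (fun j => j * n + r)
    · intro j hj
      have hj' : c.coeff (j * n + r) ≠ 0 := by
        rw [← sec13_coeff hn]; exact mem_support_iff.1 hj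
      simp [hj', Nat.mod_eq_of_lt (Finset.mem_range.1 hr)]
    · intro a _ b _ hab
      exact Nat.eq_of_mul_eq_mul_right hn (Nat.add_right_cancel hab)
  · intro j _
    simpa using Nat.mod_lt _ hn

lemma sec13_natDegree {F : Type*} [CommRing F] {n : ℕ} (hn : 0 < n) (r : ℕ) (c : F[X]) {N : ℕ}
    (hN : 0 < N) (h : c.natDegree < n * N) : (sec13 n r c).natDegree < N := by
  by_cases h0 : sec13 n r c = 0
  · rw [h0]; simpa using hN
  rw [natDegree_lt_iff_degree_lt h0, degree_lt_iff_coeff_zero]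
  intro j hj
  rw [sec13_coeff hn, coeff_eq_zero_of_natDegree_lt]
  nlinarith

/-- low degree polynomials -/
lemma low13 {F : Type*} [Field F] (p : ℕ) [CharP F p] (a : F) (ha : a ≠ 0) (v : ℕ) :
    ∀ g : F[X], g ≠ 0 → g.natDegree < p → (X - C a) ^ v ∣ g → v + 1 ≤ g.support.card := by
  induction v with
  | zero =>
    intro g hg _ _
    have := Finset.card_pos.2 (nonempty_support_iff.2 hg)
    omega
  | succ v ih =>
    intro g hg hd hdv
    obtain ⟨e, he⟩ := nonempty_support_iff.2 hg
    set D : F[X] := X * derivative g - C (e : F) * g with hD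
    have hco : ∀ j, D.coeff j = ((j : F) - e) * g.coeff j := by
      intro j
      rw [hD, coeff_sub, coeff_C_mul]
      cases j with
      | zero => simp
      | succ j => rw [coeff_X_mul, coeff_derivative]; push_cast; ring
    have hsup : D.support = g.support.erase e := by
      ext j
      rw [Finset.mem_erase, mem_support_iff, mem_support_iff, hco]
      constructor
      · intro h
        refine ⟨?_, right_ne_zero_of_mul h⟩
        rintro rfl
        simp at h
      · rintro ⟨h1, h2⟩
        refine mul_ne_zero ?_ h2
        intro h3
        apply h1
        have h4 : (j : F) = (e : F) := sub_eq_zero.1 h3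
        rw [CharP.natCast_eq_natCast F p] at h4
        exact Nat.ModEq.eq_of_lt_of_lt h4
          ((le_natDegree_of_mem_supp _ (mem_support_iff.2 h2)).trans_lt hd)
          ((le_natDegree_of_mem_supp _ he).trans_lt hd)
    have hDd : (X - C a) ^ v ∣ D := by
      apply dvd_sub
      · apply Dvd.dvd.mul_left
        obtain ⟨q, rfl⟩ := hdv
        rw [derivative_mul, derivative_X_sub_C_pow, Nat.add_sub_cancel]
        apply dvd_add
        · exact Dvd.dvd.mul_right (Dvd.dvd.mul_left dvd_rfl _) _
        · exact Dvd.dvd.mul_right (pow_dvd_pow _ (Nat.le_succ _)) _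
      · exact Dvd.dvd.mul_left ((pow_dvd_pow _ (Nat.le_succ _)).trans hdv) _
    have hD0 : D ≠ 0 := by
      intro h0
      have h1 : g.support.erase e = ∅ := by rw [← hsup, h0, support_zero]
      have h2 : g.support ⊆ {e} := by
        intro j hj
        by_contra hne
        have : j ∈ g.support.erase e := Finset.mem_erase.2 ⟨by simpa using hne, hj⟩
        rw [h1] at this
        simp at this
      have h3 : g = monomial e (g.coeff e) := by
        ext j
        rw [coeff_monomial]
        split_ifs with hj
        · rw [hj]
        · by_contra h4
          exact hj (Finset.mem_singleton.1 (h2 (mem_support_iff.2 h4))).symm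
      have h5 : g.eval a = 0 := by
        have : (X - C a) ∣ g := (dvd_pow_self _ (Nat.succ_ne_zero v)).trans hdv
        exact dvd_iff_isRoot.1 this
      rw [h3, eval_monomial] at h5
      exact mul_ne_zero (mem_support_iff.1 he) (pow_ne_zero _ ha) h5
    have hDdeg : D.natDegree < p := by
      rw [natDegree_lt_iff_degree_lt hD0, degree_lt_iff_coeff_zero]
      intro j hj
      rw [hco, coeff_eq_zero_of_natDegree_lt (lt_of_lt_of_le hd hj), mul_zero]
    have := ih D hD0 hDdeg hDd
    rw [hsup, Finset.card_erase_of_mem he] at this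
    omega

def Bd13 (F : Type*) [Field F] (p s v B : ℕ) : Prop :=
  ∀ a : F, a ≠ 0 → ∀ c : F[X], c ≠ 0 → c.natDegree < p ^ s → (X - C a) ^ v ∣ c →
    B ≤ c.support.card

lemma Bd13.mono {F : Type*} [Field F] {p s v v' B B' : ℕ} (h : Bd13 F p s v B) (hv : v ≤ v')
    (hB : B' ≤ B) : Bd13 F p s v' B' :=
  fun a ha c hc hd hdv => hB.trans (h a ha c hc hd ((pow_dvd_pow _ hv).trans hdv))

lemma Bd13.zero (F : Type*) [Field F] (p s v : ℕ) : Bd13 F p s v 1 :=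
  fun _ _ _ hc _ _ => Finset.card_pos.2 (nonempty_support_iff.2 hc)

lemma Bd13.top (F : Type*) [Field F] (p s B : ℕ) : Bd13 F p s (p ^ s) B := by
  intro a ha c hc hd hdv
  have := natDegree_le_of_dvd hdv hc
  rw [natDegree_pow, natDegree_X_sub_C] at this
  omega

lemma Bd13.step {F : Type*} [Field F] {p : ℕ} [hp : Fact p.Prime] [CharP F p]
    {s v v0 B B' : ℕ} (hv0 : v0 < p)
    (h1 : Bd13 F p s v B') (h2 : Bd13 F p s (v + 1) B) (hB : B ≤ (v0 + 1) * B') :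
    Bd13 F p (s + 1) (p * v + v0) B := by
  intro a ha c hc hd hdv
  have hp0 : 0 < p := hp.out.pos
  have hps : 0 < p ^ s := pow_pos hp0 s
  have hb : a ^ p ≠ 0 := pow_ne_zero _ ha
  have hXp : (X - C a) ^ p = expand F p (X - C (a ^ p)) := by
    rw [sub_pow_char, map_sub, expand_X, expand_C, C_pow]
  have hex : ∀ w, (X - C a) ^ (p * w) = expand F p ((X - C (a ^ p)) ^ w) := by
    intro w
    rw [pow_mul, hXp]
    exact (map_pow (expand F p) _ w).symm
  have hdeg : ∀ r, (sec13 p r c).natDegree < p ^ s := by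
    intro r
    apply sec13_natDegree hp0 r c hps
    rwa [← pow_succ']
  by_cases hcase : (X - C a) ^ (p * (v + 1)) ∣ c
  · rw [hex] at hcase
    have : ∃ r ∈ Finset.range p, sec13 p r c ≠ 0 := by
      by_contra hcon
      push Not at hcon
      apply hc
      rw [sec13_sum hp0 c]
      apply Finset.sum_eq_zero
      intro r hr
      rw [hcon r hr]; simp
    obtain ⟨r, hr, hne⟩ := this
    refine le_trans ?_ (sec13_card hp0 c)
    refine le_trans ?_ (Finset.single_le_sum (f := fun r => (sec13 p r c).support.card)
      (fun _ _ => Nat.zero_le _) hr)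
    apply h2 _ hb _ hne (hdeg r)
    obtain ⟨q, hq⟩ := hcase
    rw [hq, sec13_expand_mul hp0 (Finset.mem_range.1 hr)]
    exact dvd_mul_right _ _
  · obtain ⟨q, hq⟩ := hdv
    rw [pow_add, mul_assoc] at hq
    set h := (X - C a) ^ v0 * q with hh
    have hnd : ¬ (X - C a) ^ p ∣ h := by
      rintro ⟨w, hw⟩
      apply hcase
      rw [hq, hw, mul_add, mul_one, pow_add, ← mul_assoc]
      exact dvd_mul_right _ _
    set g : F[X] := ∑ r ∈ Finset.range p, X ^ r * C (eval (a ^ p) (sec13 p r h)) with hg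
    have hgh : (X - C a) ^ p ∣ h - g := by
      conv_rhs => rw [sec13_sum hp0 h]
      rw [hg, ← Finset.sum_sub_distrib]
      apply Finset.dvd_sum
      intro r _
      rw [← mul_sub, hXp]
      apply Dvd.dvd.mul_left
      have : X - C (a ^ p) ∣ sec13 p r h - C (eval (a ^ p) (sec13 p r h)) := by
        rw [dvd_iff_isRoot]; simp
      have := map_dvd (expand F p) this
      simpa using this
    have hg0 : g ≠ 0 := by
      intro h0
      rw [h0, sub_zero] at hgh
      exact hnd hgh
    have hgc : ∀ j, g.coeff j = if j < p then eval (a ^ p) (sec13 p j h) else 0 := by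
      intro j
      rw [hg, finsetSum_coeff]
      simp only [coeff_mul_C, coeff_X_pow, ite_mul, one_mul, zero_mul]
      rw [Finset.sum_ite_eq]
      simp
    have hgd : g.natDegree < p := by
      rw [natDegree_lt_iff_degree_lt hg0, degree_lt_iff_coeff_zero]
      intro j hj
      rw [hgc, if_neg (by omega)]
    have hgv : (X - C a) ^ v0 ∣ g := by
      have h3 : (X - C a) ^ v0 ∣ h - g := (pow_dvd_pow _ hv0.le).trans hgh
      have h4 : (X - C a) ^ v0 ∣ h := dvd_mul_right _ _
      have := dvd_sub h4 h3
      simpa using this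
    have hcard := low13 p a ha v0 g hg0 hgd hgv
    have hsecc : ∀ r < p, sec13 p r c = (X - C (a ^ p)) ^ v * sec13 p r h := by
      intro r hr
      rw [hq, hex, sec13_expand_mul hp0 hr]
    calc B ≤ (v0 + 1) * B' := hB
      _ ≤ g.support.card * B' := Nat.mul_le_mul_right _ hcard
      _ = ∑ r ∈ g.support, B' := by simp
      _ ≤ ∑ r ∈ g.support, (sec13 p r c).support.card := by
        apply Finset.sum_le_sum
        intro r hr
        have h5 := mem_support_iff.1 hr
        rw [hgc] at h5
        have hrp : r < p := by
          by_contra h6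
          rw [if_neg h6] at h5
          exact h5 rfl
        rw [if_pos hrp] at h5
        have h7 : sec13 p r h ≠ 0 := by
          intro h8
          rw [h8] at h5
          simp at h5
        refine h1 _ hb _ ?_ (hdeg r) ?_
        · rw [hsecc r hrp]
          exact mul_ne_zero (pow_ne_zero _ (X_sub_C_ne_zero _)) h7
        · rw [hsecc r hrp]
          exact dvd_mul_right _ _
      _ ≤ ∑ r ∈ Finset.range p, (sec13 p r c).support.card := by
        apply Finset.sum_le_sum_of_subset
        intro r hr
        exact Finset.mem_range.2 ((le_natDegree_of_mem_supp _ hr).trans_lt hgd)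
      _ ≤ c.support.card := sec13_card hp0 c

lemma Bd13.lem1 (F : Type*) [Field F] {p : ℕ} [hp : Fact p.Prime] [CharP F p] (k : ℕ) :
    Bd13 F p k (p ^ k - 1) (p ^ k) := by
  induction k with
  | zero => exact Bd13.zero _ _ _ _
  | succ k ih =>
    have hp0 := hp.out.pos
    have hpk : 0 < p ^ k := pow_pos hp0 k
    have h := Bd13.step (v0 := p - 1) (B := p ^ (k + 1)) (by omega) ih
      ((Bd13.top F p k _).mono (by omega) le_rfl)
      (by rw [Nat.sub_add_cancel hp0, pow_succ'])
    refine h.mono ?_ le_rfl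
    rw [pow_succ', Nat.mul_sub]
    have : p * 1 ≤ p * p ^ k := Nat.mul_le_mul_left _ hpk
    omega

lemma Bd13.lem2 (F : Type*) [Field F] {p : ℕ} [hp : Fact p.Prime] [CharP F p] (k e : ℕ) :
    Bd13 F p (k + e) (p ^ (k + e) - p ^ e) (p ^ k) := by
  induction e with
  | zero => exact Bd13.lem1 F k
  | succ e ih =>
    have h := Bd13.step (v0 := 0) hp.out.pos ih (ih.mono (Nat.le_succ _) le_rfl) (by omega)
    refine h.mono ?_ le_rfl
    rw [← add_assoc, pow_succ', pow_succ', Nat.mul_sub, add_zero]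

lemma Bd13.lem3 (F : Type*) [Field F] {p : ℕ} [hp : Fact p.Prime] [CharP F p] (k e : ℕ) :
    ∀ j, j + 2 ≤ p → Bd13 F p (k + e + 1) (p ^ (k + e + 1) - p ^ (e + 1) + j * p ^ e + 1)
      ((j + 2) * p ^ k) := by
  have hp0 := hp.out.pos
  induction e with
  | zero =>
    intro j hj
    have hpk : 0 < p ^ k := pow_pos hp0 k
    have h := Bd13.step (v0 := j + 1) (B := (j + 2) * p ^ k) (by omega) (Bd13.lem1 F k)
      ((Bd13.top F p k _).mono (by omega) le_rfl) le_rfl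
    refine h.mono ?_ le_rfl
    rw [add_zero, pow_succ', Nat.mul_sub]
    simp
    omega
  | succ e ih =>
    intro j hj
    have h2 := ih j hj
    have h1 : Bd13 F p (k + e + 1) (p ^ (k + e + 1) - p ^ (e + 1) + j * p ^ e)
        ((j + 1) * p ^ k) := by
      cases j with
      | zero =>
        refine (Bd13.lem2 F k (e + 1)).mono ?_ (by simp)
        simp [add_assoc]
      | succ j =>
        refine (ih j (by omega)).mono ?_ le_rfl
        have : 0 < p ^ e := pow_pos hp0 e
        nlinarith
    have h := Bd13.step (v0 := 1) (by omega) h1 h2 (by nlinarith [Nat.zero_le (j * p ^ k)])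
    refine h.mono ?_ le_rfl
    have e1 : p ^ (k + (e + 1) + 1) = p * p ^ (k + e + 1) := by ring
    have e2 : p ^ (e + 1 + 1) = p * p ^ (e + 1) := by ring
    have e3 : j * p ^ (e + 1) = p * (j * p ^ e) := by ring
    rw [e1, e2, e3, mul_add, Nat.mul_sub]

/-- upper bound -/
lemma upper13 (F : Type*) [Field F] {p : ℕ} [hp : Fact p.Prime] [CharP F p] (k e i n : ℕ) (a : F)
    (hn : 0 < n) :
    ((X ^ n - C a) ^ (p ^ (k + e + 1) - p ^ (e + 1) + i * p ^ e)).support.card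
      ≤ (i + 1) * p ^ k := by
  have hp0 := hp.out.pos
  have hpk : 0 < p ^ k := pow_pos hp0 k
  have hN : p ^ (k + e + 1) - p ^ (e + 1) + i * p ^ e = p ^ (e + 1) * (p ^ k - 1) + p ^ e * i := by
    rw [Nat.mul_sub, ← pow_add, mul_one, mul_comm i]
    congr 3
    ring
  have gen : ∀ (N d : ℕ) (b : F), 0 < N → ((X ^ N - C b) ^ d).support.card ≤ d + 1 := by
    intro N d b hN
    have : (X ^ N - C b) ^ d = expand F N ((X - C b) ^ d) := by simp
    rw [this]
    have hsub : (expand F N ((X - C b) ^ d)).support ⊆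
        ((X - C b) ^ d).support.image (fun j => j * N) := by
      intro j hj
      have hj := mem_support_iff.1 hj
      rw [coeff_expand hN] at hj
      by_cases hdv : N ∣ j
      · rw [if_pos hdv] at hj
        exact Finset.mem_image.2 ⟨j / N, mem_support_iff.2 hj, Nat.div_mul_cancel hdv⟩
      · rw [if_neg hdv] at hj
        exact absurd rfl hj
    refine (Finset.card_le_card hsub).trans (Finset.card_image_le.trans ?_)
    refine (card_supp_le_succ_natDegree _).trans ?_
    rw [natDegree_pow, natDegree_X_sub_C, mul_one]
  have key : ∀ w d : ℕ, ((X ^ n - C a) ^ (p ^ w * d)).support.card ≤ d + 1 := by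
    intro w d
    rw [pow_mul, sub_pow_char_pow, ← pow_mul, ← C_pow]
    exact gen _ _ _ (Nat.mul_pos hn (pow_pos hp0 _))
  rw [hN, pow_add]
  refine (card_support_mul_le).trans ?_
  rw [mul_comm]
  refine Nat.mul_le_mul (key _ _) ?_
  have := key (e + 1) (p ^ k - 1)
  omega

lemma polyRep13 {A : Type} [CommRing A] {q : A[X]} (hq : q.Monic) (P : A[X]) :
    polyRep q (Ideal.Quotient.mk (Ideal.span {q}) P) = P %ₘ q := by
  unfold polyRep
  apply modByMonic_eq_of_dvd_sub hq
  rw [← Ideal.mem_span_singleton, ← Ideal.Quotient.eq]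
  exact Function.surjInv_eq _ _

/-- lower bound transferred from the length `p ^ s` case to the length `n * p ^ s` case. -/
lemma lower13 {F : Type*} [Field F] {p s n μ d : ℕ} (hp : 0 < p) (hn : 0 < n)
    (hBd : Bd13 F p s μ d) (a : F) (ha : a ≠ 0) (c : F[X]) (hc : c ≠ 0)
    (hd : c.natDegree < n * p ^ s) (hdv : (X ^ n - C a) ^ μ ∣ c) : d ≤ c.support.card := by
  have hex : (X ^ n - C a) ^ μ = expand F n ((X - C a) ^ μ) := by simp
  rw [hex] at hdv
  have : ∃ r ∈ Finset.range n, sec13 n r c ≠ 0 := by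
    by_contra hcon
    push Not at hcon
    apply hc
    rw [sec13_sum hn c]
    apply Finset.sum_eq_zero
    intro r hr
    rw [hcon r hr]; simp
  obtain ⟨r, hr, hne⟩ := this
  refine le_trans ?_ (sec13_card hn c)
  refine le_trans ?_ (Finset.single_le_sum (f := fun r => (sec13 n r c).support.card)
    (fun _ _ => Nat.zero_le _) hr)
  apply hBd _ ha _ hne (sec13_natDegree hn r c (pow_pos hp s) hd)
  obtain ⟨q, hq⟩ := hdv
  rw [hq, sec13_expand_mul hn (Finset.mem_range.1 hr)]
  exact dvd_mul_right _ _

lemma core13 {R : Type} [CommRing R] {F : Type} [Field F] (φ : R →+* F)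
    (hφs : Function.Surjective φ)
    (p s n : ℕ) [hp : Fact p.Prime] [CharP F p] (hn : 0 < n)
    (γ : R) (hγ : γ ≠ 0) (hz : ∀ a, γ * a = 0 ↔ φ a = 0) (hk : ∀ a, φ a = 0 → ∃ b, a = γ * b)
    (α₀ : R) (hα₀ : IsUnit α₀)
    (hirr : Irreducible ((X ^ n - C α₀ : R[X]).map φ))
    (Q : R[X]) (hQ : Q = X ^ (n * p ^ s) - C (α₀ ^ p ^ s))
    (μ κ : ℕ) (A : R[X] ⧸ Ideal.span {Q})
    (hκ : ∀ k, Ideal.Quotient.mk (Ideal.span {Q}) (C γ) *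
        (Ideal.Quotient.mk (Ideal.span {Q}) (X ^ n - C α₀)) ^ k ∈ Ideal.span {A} → κ ≤ k)
    (hμκ : μ < κ) (M d : ℕ) (hμM : μ ≤ M) (hM : M < p ^ s) (hBd : Bd13 F p s μ d)
    (hup : ((X ^ n - C (φ α₀)) ^ M).support.card ≤ d) :
    dH Q (Ideal.span {A, Ideal.Quotient.mk (Ideal.span {Q}) (C γ * (X ^ n - C α₀) ^ μ)}) = d := by
  have hp0 := hp.out.pos
  have hN : 0 < n * p ^ s := Nat.mul_pos hn (pow_pos hp0 s)
  have hRn : Nontrivial R := ⟨γ, 0, hγ⟩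
  have hQm : Q.Monic := by rw [hQ]; exact monic_X_pow_sub_C _ hN.ne'
  have hQd : Q.degree = (n * p ^ s : ℕ) := by rw [hQ]; exact degree_X_pow_sub_C hN _
  set f : R[X] := X ^ n - C α₀ with hf
  have hfb : f.map φ = X ^ n - C (φ α₀) := by simp [hf]
  have hfm : f.Monic := monic_X_pow_sub_C _ hn.ne'
  have hQb : Q.map φ = (f.map φ) ^ p ^ s := by
    rw [hfb, hQ, sub_pow_char_pow, ← pow_mul]
    simp
  have ha : φ α₀ ≠ 0 := (hα₀.map φ).ne_zero
  -- multiplication by γ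
  have hzP : ∀ P : R[X], P.map φ = 0 → C γ * P = 0 := by
    intro P hP
    ext j
    rw [coeff_C_mul, coeff_zero, hz, ← coeff_map, hP, coeff_zero]
  have hsuppγ : ∀ P : R[X], (C γ * P).support = (P.map φ).support := by
    intro P
    ext j
    rw [mem_support_iff, mem_support_iff, coeff_C_mul, coeff_map, not_iff_not, hz]
  -- torsion
  have hT : ∀ H : R[X], Ideal.Quotient.mk (Ideal.span {Q}) (C γ * H) ∈
      Ideal.span {A, Ideal.Quotient.mk (Ideal.span {Q}) (C γ * f ^ μ)} →
      (f.map φ) ^ μ ∣ H.map φ := by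
    intro H hH
    obtain ⟨x, y, hxy⟩ := Ideal.mem_span_pair.1 hH
    obtain ⟨Y, rfl⟩ := Ideal.Quotient.mk_surjective y
    by_contra hcon
    set D := H - f ^ μ * Y with hD
    have hDn : ¬ (f.map φ) ^ μ ∣ D.map φ := by
      intro h
      apply hcon
      have : H.map φ = D.map φ + (f.map φ) ^ μ * Y.map φ := by
        rw [hD]; simp
      rw [this]
      exact dvd_add h (dvd_mul_right _ _)
    have hD0 : D.map φ ≠ 0 := by
      intro h
      rw [h] at hDn
      exact hDn (dvd_zero _)
    have hDA : Ideal.Quotient.mk (Ideal.span {Q}) (C γ * D) ∈ Ideal.span {A} := by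
      rw [Ideal.mem_span_singleton']
      refine ⟨x, ?_⟩
      rw [hD, mul_sub, map_sub, ← hxy]
      simp only [map_mul]
      ring
    obtain ⟨u, hu1, hu2⟩ := (FiniteMultiplicity.of_not_isUnit hirr.not_isUnit
      hD0).exists_eq_pow_mul_and_not_dvd
    set j := multiplicity (f.map φ) (D.map φ) with hj
    have hjμ : j < μ := by
      by_contra h
      apply hDn
      rw [hu1]
      exact Dvd.dvd.mul_right (pow_dvd_pow _ (by omega)) _
    have hcop : IsCoprime u (Q.map φ) := by
      rw [hQb]
      exact (IsCoprime.pow_left ((hirr.coprime_iff_not_dvd).2 hu2)).symm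
    obtain ⟨v, w, hvw⟩ := hcop
    obtain ⟨V, rfl⟩ := map_surjective φ hφs v
    obtain ⟨W, rfl⟩ := map_surjective φ hφs w
    have h0 : (D * V - f ^ j + f ^ j * (W * Q)).map φ = 0 := by
      have hu1' : D.map φ = (f.map φ) ^ j * u := hu1
      simp only [Polynomial.map_add, Polynomial.map_sub, Polynomial.map_mul, Polynomial.map_pow]
      rw [hu1']
      linear_combination (f.map φ) ^ j * hvw
    have h1 := hzP _ h0
    have h2 : C γ * f ^ j = C γ * D * V + C γ * f ^ j * W * Q := by
      linear_combination -h1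
    have hQ0 : Ideal.Quotient.mk (Ideal.span {Q}) Q = 0 :=
      Ideal.Quotient.eq_zero_iff_mem.2 (Ideal.mem_span_singleton_self _)
    have h3 : Ideal.Quotient.mk (Ideal.span {Q}) (C γ * f ^ j) ∈ Ideal.span {A} := by
      rw [h2, map_add, map_mul _ _ Q, hQ0, mul_zero, add_zero, map_mul]
      exact Ideal.mul_mem_right _ _ hDA
    rw [map_mul, map_pow] at h3
    have := hκ j h3
    omega
  -- lower bound
  have hlow : ∀ c ∈ Ideal.span {A, Ideal.Quotient.mk (Ideal.span {Q}) (C γ * f ^ μ)}, c ≠ 0 →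
      d ≤ wH Q c := by
    intro c hc hc0
    obtain ⟨P0, rfl⟩ := Ideal.Quotient.mk_surjective c
    unfold wH
    rw [polyRep13 hQm]
    set P := P0 %ₘ Q with hP
    have hPd : P.degree < (n * p ^ s : ℕ) := by
      rw [← hQd]; exact degree_modByMonic_lt _ hQm
    have hPc : Ideal.Quotient.mk (Ideal.span {Q}) P0 = Ideal.Quotient.mk (Ideal.span {Q}) P := by
      rw [eq_comm, Ideal.Quotient.eq, Ideal.mem_span_singleton]
      exact dvd_modByMonic_sub _ _
    rw [hPc] at hc hc0
    have hP0 : P ≠ 0 := by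
      intro h; rw [h, map_zero] at hc0; exact hc0 rfl
    have hfin : ∀ H : R[X], H.map φ ≠ 0 → (∀ j, P.coeff j = 0 → (H.map φ).coeff j = 0) →
        Ideal.Quotient.mk (Ideal.span {Q}) (C γ * H) ∈
          Ideal.span {A, Ideal.Quotient.mk (Ideal.span {Q}) (C γ * f ^ μ)} →
        d ≤ P.support.card := by
      intro H hH0 hsup hmem
      have hss : (H.map φ).support ⊆ P.support := by
        intro j hj
        rw [mem_support_iff] at hj ⊢
        exact fun h => hj (hsup j h)
      refine le_trans ?_ (Finset.card_le_card hss)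
      have hdv := hT H hmem
      rw [hfb] at hdv
      refine lower13 hp0 hn hBd _ ha _ hH0 ?_ hdv
      rw [natDegree_lt_iff_degree_lt hH0, degree_lt_iff_coeff_zero]
      intro j hj
      exact hsup j ((degree_lt_iff_coeff_zero _ _).1 hPd j hj)
    by_cases hb : P.map φ = 0
    · have : ∀ j, ∃ b, P.coeff j = γ * b := by
        intro j
        apply hk
        rw [← coeff_map, hb, coeff_zero]
      have hdvd : C γ ∣ P := (C_dvd_iff_dvd_coeff _ _).2 this
      obtain ⟨H, hH⟩ := hdvd
      have hsupp := hsuppγ H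
      rw [← hH] at hsupp
      refine hfin H ?_ ?_ (hH ▸ hc)
      · intro h
        rw [h, support_zero, support_eq_empty] at hsupp
        exact hP0 hsupp
      · intro j hj
        rw [← notMem_support_iff] at hj ⊢
        rwa [← hsupp]
    · refine hfin P hb ?_ ?_
      · intro j hj
        rw [coeff_map, hj, map_zero]
      · rw [map_mul _ _ P]
        exact Ideal.mul_mem_left _ _ hc
  -- upper bound
  have hPMd : (C γ * f ^ M).degree < Q.degree := by
    rw [hQd]
    refine lt_of_le_of_lt degree_le_natDegree ?_
    rw [Nat.cast_lt]
    refine lt_of_le_of_lt (natDegree_C_mul_le _ _) ?_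
    rw [hfm.natDegree_pow, natDegree_X_pow_sub_C, mul_comm]
    exact Nat.mul_lt_mul_of_pos_left hM hn
  have hmodM : (C γ * f ^ M) %ₘ Q = C γ * f ^ M := (modByMonic_eq_self_iff hQm).2 hPMd
  have hsM := hsuppγ (f ^ M)
  have hfM0 : (f ^ M).map φ ≠ 0 := ((hfm.pow M).map φ).ne_zero
  have hcM0 : Ideal.Quotient.mk (Ideal.span {Q}) (C γ * f ^ M) ≠ 0 := by
    intro h
    rw [Ideal.Quotient.eq_zero_iff_mem, Ideal.mem_span_singleton,
      ← modByMonic_eq_zero_iff_dvd hQm, hmodM] at h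
    rw [h, support_zero] at hsM
    exact hfM0 (support_eq_empty.1 hsM.symm)
  have hcM : Ideal.Quotient.mk (Ideal.span {Q}) (C γ * f ^ M) ∈
      Ideal.span {A, Ideal.Quotient.mk (Ideal.span {Q}) (C γ * f ^ μ)} := by
    obtain ⟨e, rfl⟩ := Nat.exists_eq_add_of_le hμM
    rw [pow_add, ← mul_assoc, map_mul _ _ (f ^ e)]
    exact Ideal.mul_mem_right _ _ (Ideal.subset_span (Or.inr rfl))
  have hwM : wH Q (Ideal.Quotient.mk (Ideal.span {Q}) (C γ * f ^ M)) ≤ d := by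
    unfold wH
    rw [polyRep13 hQm, hmodM, hsM, Polynomial.map_pow, hfb]
    exact hup
  unfold dH
  apply le_antisymm
  · refine le_trans (Nat.sInf_le ?_) hwM
    exact ⟨_, hcM, hcM0, rfl⟩
  · refine le_csInf ⟨_, _, hcM, hcM0, rfl⟩ ?_
    rintro w ⟨c, hc, hc0, rfl⟩
    exact hlow c hc hc0

/-- Hamming distances of the Type IV codes
`⟨f^ω + γ f^t G, γ f^μ⟩` of `K = R[x]/⟨x^{np^s} − α₀^{p^s}⟩`. -/
theorem stmt13 {R : Type} [CommRing R] [Finite R]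
    (p m s n : ℕ) (hp : p.Prime) (hm : 0 < m) (hs : 0 < s) (hn : 0 < n)
    (hnp : Nat.gcd n p = 1)
    (γ : R) (hγ : γ ≠ 0) (hγ2 : γ ^ 2 = 0)
    (hmax : ∀ a : R, a ∈ Ideal.span {γ} ↔ ¬ IsUnit a)
    (hres : Nat.card (R ⧸ Ideal.span {γ}) = p ^ m)
    (α₀ : R) (hα₀ : IsUnit α₀)
    (hirr : Irreducible ((X ^ n - C α₀ : R[X]).map (Ideal.Quotient.mk (Ideal.span {γ}))))
    (ω t μ : ℕ) (G : R[X] ⧸ Ideal.span {(X ^ (n * p ^ s) - C (α₀ ^ p ^ s) : R[X])})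
    (hμω : μ < ω) (hω : ω < p ^ s) (hG : G = 0 ∨ IsUnit G) (ht : G ≠ 0 → t < μ)
    (κ : ℕ)
    (hκ : IsLeast {k : ℕ |
      Ideal.Quotient.mk (Ideal.span {(X ^ (n * p ^ s) - C (α₀ ^ p ^ s) : R[X])}) (C γ) *
        (Ideal.Quotient.mk (Ideal.span {(X ^ (n * p ^ s) - C (α₀ ^ p ^ s) : R[X])})
          (X ^ n - C α₀)) ^ k ∈
      Ideal.span {Ideal.Quotient.mk
          (Ideal.span {(X ^ (n * p ^ s) - C (α₀ ^ p ^ s) : R[X])})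
          ((X ^ n - C α₀) ^ ω) +
        Ideal.Quotient.mk (Ideal.span {(X ^ (n * p ^ s) - C (α₀ ^ p ^ s) : R[X])})
          (C γ * (X ^ n - C α₀) ^ t) * G}} κ)
    (hμκ : μ < κ) :
    (μ = 0 →
      dH (X ^ (n * p ^ s) - C (α₀ ^ p ^ s))
        (Ideal.span {Ideal.Quotient.mk
            (Ideal.span {(X ^ (n * p ^ s) - C (α₀ ^ p ^ s) : R[X])})
            ((X ^ n - C α₀) ^ ω) +
          Ideal.Quotient.mk (Ideal.span {(X ^ (n * p ^ s) - C (α₀ ^ p ^ s) : R[X])})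
            (C γ * (X ^ n - C α₀) ^ t) * G,
          Ideal.Quotient.mk (Ideal.span {(X ^ (n * p ^ s) - C (α₀ ^ p ^ s) : R[X])})
            (C γ * (X ^ n - C α₀) ^ μ)}) = 1) ∧
    (∀ ℓ, ℓ ≤ p - 2 → ℓ * p ^ (s - 1) + 1 ≤ μ → μ ≤ (ℓ + 1) * p ^ (s - 1) →
      dH (X ^ (n * p ^ s) - C (α₀ ^ p ^ s))
        (Ideal.span {Ideal.Quotient.mk
            (Ideal.span {(X ^ (n * p ^ s) - C (α₀ ^ p ^ s) : R[X])})
            ((X ^ n - C α₀) ^ ω) +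
          Ideal.Quotient.mk (Ideal.span {(X ^ (n * p ^ s) - C (α₀ ^ p ^ s) : R[X])})
            (C γ * (X ^ n - C α₀) ^ t) * G,
          Ideal.Quotient.mk (Ideal.span {(X ^ (n * p ^ s) - C (α₀ ^ p ^ s) : R[X])})
            (C γ * (X ^ n - C α₀) ^ μ)}) = ℓ + 2) ∧
    (∀ i k, 1 ≤ i → i ≤ p - 1 → 1 ≤ k → k ≤ s - 1 →
      p ^ s - p ^ (s - k) + (i - 1) * p ^ (s - k - 1) + 1 ≤ μ →
      μ ≤ p ^ s - p ^ (s - k) + i * p ^ (s - k - 1) →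
      dH (X ^ (n * p ^ s) - C (α₀ ^ p ^ s))
        (Ideal.span {Ideal.Quotient.mk
            (Ideal.span {(X ^ (n * p ^ s) - C (α₀ ^ p ^ s) : R[X])})
            ((X ^ n - C α₀) ^ ω) +
          Ideal.Quotient.mk (Ideal.span {(X ^ (n * p ^ s) - C (α₀ ^ p ^ s) : R[X])})
            (C γ * (X ^ n - C α₀) ^ t) * G,
          Ideal.Quotient.mk (Ideal.span {(X ^ (n * p ^ s) - C (α₀ ^ p ^ s) : R[X])})
            (C γ * (X ^ n - C α₀) ^ μ)}) = (i + 1) * p ^ k) := by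
  have : Fact p.Prime := ⟨hp⟩
  have hp2 := hp.two_le
  have hp0 := hp.pos
  have hγn : ¬ IsUnit γ := (hmax γ).1 (Ideal.mem_span_singleton_self γ)
  have hI1 : Ideal.span {γ} ≠ ⊤ := by
    intro h
    exact hγn (Ideal.span_singleton_eq_top.1 h)
  have hM : (Ideal.span {γ}).IsMaximal := by
    refine ⟨hI1, ?_⟩
    intro J hJ
    obtain ⟨x, hxJ, hx⟩ := Set.exists_of_ssubset hJ
    have hxu : IsUnit x := by
      by_contra h
      exact hx ((hmax x).2 h)
    exact Ideal.eq_top_of_isUnit_mem _ hxJ hxu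
  let : Field (R ⧸ Ideal.span {γ}) := Ideal.Quotient.field _
  have : Finite (R ⧸ Ideal.span {γ}) := Finite.of_surjective _ Ideal.Quotient.mk_surjective
  let : Fintype (R ⧸ Ideal.span {γ}) := Fintype.ofFinite _
  have : CharP (R ⧸ Ideal.span {γ}) p := by
    obtain ⟨r, hr⟩ := CharP.exists (R ⧸ Ideal.span {γ})
    obtain ⟨k, hrp, hcard⟩ := FiniteField.card (R ⧸ Ideal.span {γ}) r
    rw [Nat.card_eq_fintype_card, hcard] at hres
    have : r = p := by
      have h1 : r ∣ p ^ m := by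
        rw [← hres]; exact dvd_pow_self _ k.ne_zero
      exact (Nat.prime_dvd_prime_iff_eq hrp hp).1 (hrp.dvd_of_dvd_pow h1)
    rwa [this] at hr
  have hmk : ∀ a : R, Ideal.Quotient.mk (Ideal.span {γ}) a = 0 ↔ ∃ b, a = γ * b := by
    intro a
    rw [Ideal.Quotient.eq_zero_iff_mem, Ideal.mem_span_singleton]
    rfl
  have hz : ∀ a : R, γ * a = 0 ↔ Ideal.Quotient.mk (Ideal.span {γ}) a = 0 := by
    intro a
    constructor
    · intro h
      rw [Ideal.Quotient.eq_zero_iff_mem, hmax]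
      intro hu
      exact hγ ((hu.mul_left_eq_zero).1 h)
    · intro h
      obtain ⟨b, rfl⟩ := (hmk a).1 h
      rw [← mul_assoc, ← sq, hγ2, zero_mul]
  have key := fun M d h1 h2 h3 h4 => core13 (Ideal.Quotient.mk (Ideal.span {γ}))
    Ideal.Quotient.mk_surjective p s n hn γ hγ hz (fun a => (hmk a).1) α₀ hα₀ hirr _ rfl μ κ _
    (fun k hk => hκ.2 hk) hμκ M d h1 h2 h3 h4
  have part : ∀ i k, 1 ≤ i → i ≤ p - 1 → k ≤ s - 1 →
      p ^ s - p ^ (s - k) + (i - 1) * p ^ (s - k - 1) + 1 ≤ μ →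
      μ ≤ p ^ s - p ^ (s - k) + i * p ^ (s - k - 1) → _ := fun i k hi1 hi2 hks hl hu =>
    key (p ^ s - p ^ (s - k) + i * p ^ (s - k - 1)) ((i + 1) * p ^ k) hu
      (by
        obtain ⟨e, rfl⟩ : ∃ e, s = k + e + 1 := ⟨s - k - 1, by omega⟩
        have e1 : k + e + 1 - k = e + 1 := by omega
        rw [e1, Nat.add_sub_cancel]
        have h1 : p ^ (e + 1) ≤ p ^ (k + e + 1) := Nat.pow_le_pow_right hp0 (by omega)
        have h2 : i * p ^ e < p ^ (e + 1) := by
          rw [pow_succ']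
          exact Nat.mul_lt_mul_of_pos_right (by omega) (pow_pos hp0 e)
        omega)
      (by
        obtain ⟨e, rfl⟩ : ∃ e, s = k + e + 1 := ⟨s - k - 1, by omega⟩
        obtain ⟨j, rfl⟩ : ∃ j, i = j + 1 := ⟨i - 1, by omega⟩
        have e1 : k + e + 1 - k = e + 1 := by omega
        rw [e1] at hl
        exact (Bd13.lem3 _ k e j (by omega)).mono hl le_rfl)
      (by
        obtain ⟨e, rfl⟩ : ∃ e, s = k + e + 1 := ⟨s - k - 1, by omega⟩
        have e1 : k + e + 1 - k = e + 1 := by omega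
        rw [e1]
        exact upper13 _ k e i n _ hn)
  refine ⟨?_, ?_, ?_⟩
  · intro h0
    refine key 0 1 (by omega) (pow_pos hp0 s) (Bd13.zero _ _ _ _) ?_
    rw [pow_zero]
    exact (card_supp_le_succ_natDegree _).trans (by simp)
  · intro l hl h1 h2
    have := part (l + 1) 0 (by omega) (by omega) (by omega) (by simpa using h1) (by simpa using h2)
    rw [this, pow_zero, mul_one]
  · intro i k hi1 hi2 _ hks hl hu
    exact part i k hi1 hi2 hks hl hu
end

section
/- Let α₀ be a unit of R such that x^n − α₀ is basic irreducible over R, let α = α₀^{p^s}, write f = x^n − α₀, and let C = ⟨f^ω + γ f^t G, γ f^μ⟩ be an ideal of K = R[x]/⟨x^{np^s} − α⟩, where 0 ≤ μ < ω < p^s, G is either 0 or a unit of K, 0 ≤ t < μ when G ≠ 0, and μ < κ, where κ is the least nonnegative integer such that γ f^κ ∈ ⟨f^ω + γ f^t G⟩. For 0 ≤ ρ ≤ np^s let A_ρ denote the number of codewords of C with RT weight equal to ρ. Then A_0 = 1; A_ρ = 0 for 1 ≤ ρ ≤ nμ; A_ρ = (p^m − 1)p^{m(ρ − nμ − 1)}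 for nμ + 1 ≤ ρ ≤ nω; and A_ρ = (p^{2m} − 1)p^{m(2ρ − nω − nμ − 2)} for nω + 1 ≤ ρ ≤ np^s. -/
open Polynomial

section RTHelpers

lemma rtH_degC {R : Type} [CommRing R] (c : R) (P : R[X]) : (C c * P).degree ≤ P.degree := by
  rw [degree_le_iff_coeff_zero]
  intro i hi
  rw [coeff_C_mul, coeff_eq_zero_of_degree_lt hi, mul_zero]

/-- Counting polynomials in an ideal with degree at most `ρ` and prescribed top coefficient set. -/
lemma rtH_count {R : Type} [CommRing R] (J : Ideal R[X]) (ρ : ℕ) (S : Set R)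
    (e : R → R[X]) (he : ∀ c ∈ S, e c ∈ J ∧ (e c).degree < ((ρ + 1 : ℕ) : WithBot ℕ) ∧
      (e c).coeff ρ = c) :
    Set.ncard {P : R[X] | P ∈ J ∧ P.degree < ((ρ + 1 : ℕ) : WithBot ℕ) ∧ P.coeff ρ ∈ S} =
      S.ncard * Set.ncard {P : R[X] | P ∈ J ∧ P.degree < (ρ : WithBot ℕ)} := by
  rw [← Set.ncard_prod]
  symm
  refine Set.ncard_congr (fun x _ => x.2 + e x.1) ?_ ?_ ?_
  · rintro ⟨c, P⟩ ⟨hc, hP, hd⟩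
    obtain ⟨h1, h2, h3⟩ := he c hc
    refine ⟨J.add_mem hP h1, ?_, ?_⟩
    · refine (degree_add_le _ _).trans_lt (max_lt (hd.trans ?_) h2)
      exact_mod_cast Nat.lt_succ_self ρ
    · simp only [coeff_add]
      rw [coeff_eq_zero_of_degree_lt hd, h3, zero_add]
      exact hc
  · rintro ⟨c, P⟩ ⟨c', P'⟩ ⟨hc, hP, hd⟩ ⟨hc', hP', hd'⟩ h
    dsimp only at *
    have h1 := congrArg (fun Q : R[X] => Q.coeff ρ) h
    simp only [coeff_add] at h1
    rw [coeff_eq_zero_of_degree_lt hd, coeff_eq_zero_of_degree_lt hd', (he c hc).2.2,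
      (he c' hc').2.2, zero_add, zero_add] at h1
    subst h1
    simpa using h
  · rintro Q ⟨hQ, hd, hc⟩
    obtain ⟨h1, h2, h3⟩ := he _ hc
    refine ⟨(Q.coeff ρ, Q - e (Q.coeff ρ)), ⟨hc, J.sub_mem hQ h1, ?_⟩, by simp⟩
    rw [degree_lt_iff_coeff_zero] at *
    intro i hi
    rcases hi.eq_or_lt with rfl | hi
    · simp [h3]
    · rw [coeff_sub, hd i hi, h2 i hi, sub_zero]

lemma rtH_exists {R : Type} [CommRing R] [Nontrivial R] (J : Ideal R[X]) (ρ : ℕ) (S : Set R)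
    (g : R[X]) (hg : g.Monic) (hd : g.natDegree ≤ ρ) (h : ∀ c ∈ S, C c * g ∈ J) :
    ∀ c ∈ S, (C c * (g * X ^ (ρ - g.natDegree))) ∈ J ∧
      (C c * (g * X ^ (ρ - g.natDegree))).degree < ((ρ + 1 : ℕ) : WithBot ℕ) ∧
      (C c * (g * X ^ (ρ - g.natDegree))).coeff ρ = c := by
  intro c hc
  have hm : (g * X ^ (ρ - g.natDegree)).Monic := hg.mul (monic_X_pow _)
  have hnd : (g * X ^ (ρ - g.natDegree)).natDegree = ρ := by
    rw [hg.natDegree_mul (monic_X_pow _), natDegree_X_pow]; omega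
  refine ⟨?_, ?_, ?_⟩
  · rw [← mul_assoc]; exact J.mul_mem_right _ (h c hc)
  · refine (rtH_degC _ _).trans_lt ?_
    rw [degree_eq_natDegree hm.ne_zero, hnd]
    exact_mod_cast Nat.lt_succ_self ρ
  · rw [coeff_C_mul]
    have := hm.coeff_natDegree
    rw [hnd] at this
    rw [this, mul_one]

lemma rtH_polyRep {A : Type} [CommRing A] (q : A[X]) (hq : q.Monic)
    (P : A[X]) (hP : P.degree < q.degree) : polyRep q (Ideal.Quotient.mk _ P) = P := by
  nontriviality A
  unfold polyRep
  set Y := Function.surjInv Ideal.Quotient.mk_surjective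
    (Ideal.Quotient.mk (Ideal.span {q}) P) with hY
  have h : Ideal.Quotient.mk (Ideal.span {q}) Y = Ideal.Quotient.mk (Ideal.span {q}) P :=
    Function.surjInv_eq _ _
  rw [Ideal.Quotient.eq, Ideal.mem_span_singleton] at h
  have h2 := (modByMonic_eq_zero_iff_dvd hq).2 h
  rw [sub_modByMonic, sub_eq_zero] at h2
  rw [h2, modByMonic_eq_self_iff hq]
  exact hP

lemma rtH_mk_polyRep {A : Type} [CommRing A] (q : A[X])
    (c : A[X] ⧸ Ideal.span {q}) : Ideal.Quotient.mk _ (polyRep q c) = c := by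
  unfold polyRep
  conv_rhs => rw [← Function.surjInv_eq Ideal.Quotient.mk_surjective c]
  rw [Ideal.Quotient.eq, Ideal.mem_span_singleton]
  refine ⟨-(Function.surjInv Ideal.Quotient.mk_surjective c /ₘ q), ?_⟩
  rw [modByMonic_eq_sub_mul_div]
  ring

lemma rtH_mk_inj {A : Type} [CommRing A] (q : A[X]) (hq : q.Monic)
    (P Q : A[X]) (hP : P.degree < q.degree) (hQ : Q.degree < q.degree)
    (h : Ideal.Quotient.mk (Ideal.span {q}) P = Ideal.Quotient.mk (Ideal.span {q}) Q) :
    P = Q := by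
  rw [← rtH_polyRep q hq P hP, h, rtH_polyRep q hq Q hQ]

lemma rtH_rtCount {A : Type} [CommRing A] [Nontrivial A] (q : A[X]) (hq : q.Monic)
    (I : Ideal (A[X] ⧸ Ideal.span {q})) (ρ : ℕ) (hρ : ρ < q.natDegree) (L : Set A)
    (hL : ∀ P : A[X], Ideal.Quotient.mk (Ideal.span {q}) P ∈ I →
      P.degree < ((ρ + 1 : ℕ) : WithBot ℕ) → P.coeff ρ ∈ L) :
    rtCount q I (ρ + 1) = Set.ncard {P : A[X] | P ∈ I.comap (Ideal.Quotient.mk (Ideal.span {q})) ∧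
      P.degree < ((ρ + 1 : ℕ) : WithBot ℕ) ∧ P.coeff ρ ∈ L \ {0}} := by
  have hqd : ((ρ + 1 : ℕ) : WithBot ℕ) ≤ q.degree := by
    rw [degree_eq_natDegree hq.ne_zero]; exact_mod_cast hρ
  unfold rtCount
  symm
  refine Set.ncard_congr (fun P _ => Ideal.Quotient.mk _ P) ?_ ?_ ?_
  · rintro P ⟨hP, hd, -, hc⟩
    refine ⟨hP, ?_⟩
    have hne : Ideal.Quotient.mk (Ideal.span {q}) P ≠ 0 := by
      intro h0
      have := rtH_mk_inj q hq P 0 (hd.trans_le hqd)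
        (by rw [degree_zero]; exact (WithBot.bot_lt_coe _).trans_le hqd) (by rw [h0, map_zero])
      apply hc
      simp [this]
    rw [wRT, if_neg hne, rtH_polyRep q hq P (hd.trans_le hqd)]
    congr 1
    apply le_antisymm
    · rw [natDegree_le_iff_coeff_eq_zero]
      intro i hi
      exact (degree_lt_iff_coeff_zero _ _).1 hd i hi
    · exact le_natDegree_of_ne_zero hc
  · intro P Q hP hQ h
    exact rtH_mk_inj q hq P Q (hP.2.1.trans_le hqd) (hQ.2.1.trans_le hqd) h
  · rintro c ⟨hc, hw⟩
    have hne : c ≠ 0 := by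
      rintro rfl; simp [wRT] at hw
    rw [wRT, if_neg hne, Nat.add_right_cancel_iff] at hw
    have hmk := rtH_mk_polyRep q c
    have hp0 : polyRep q c ≠ 0 := by
      intro h; rw [h, map_zero] at hmk; exact hne hmk.symm
    have hd : (polyRep q c).degree < ((ρ + 1 : ℕ) : WithBot ℕ) := by
      rw [degree_eq_natDegree hp0, hw]; exact_mod_cast Nat.lt_succ_self ρ
    refine ⟨polyRep q c, ⟨?_, hd, ?_, ?_⟩, hmk⟩
    · rw [Ideal.mem_comap, hmk]; exact hc
    · exact hL _ (by rw [hmk]; exact hc) hd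
    · rw [← hw]
      exact fun h => hp0 (leadingCoeff_eq_zero.1 h)

lemma rtH_zero {A : Type} [CommRing A] (q : A[X]) (I : Ideal (A[X] ⧸ Ideal.span {q})) :
    rtCount q I 0 = 1 := by
  unfold rtCount
  rw [Set.ncard_eq_one]
  refine ⟨0, ?_⟩
  ext c
  simp only [Set.mem_ofPred_eq, Set.mem_singleton_iff]
  constructor
  · rintro ⟨-, h⟩
    by_contra hc
    rw [wRT, if_neg hc] at h
    omega
  · rintro rfl
    exact ⟨I.zero_mem, by simp [wRT]⟩

/-- Abstract counting from the leading coefficient data. -/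
lemma rtH_main {R : Type} [CommRing R] [Finite R] [Nontrivial R] (q : R[X]) (hq : q.Monic)
    (I : Ideal (R[X] ⧸ Ideal.span {q})) (a b Q : ℕ) (hab : a ≤ b) (T : Set R) (h0T : 0 ∈ T)
    (hT : T.ncard = Q) (hR : Nat.card R = Q ^ 2)
    (h1 : ∀ P : R[X], Ideal.Quotient.mk (Ideal.span {q}) P ∈ I → P.degree < (a : WithBot ℕ) →
      P = 0)
    (h2 : ∀ P : R[X], Ideal.Quotient.mk (Ideal.span {q}) P ∈ I → P.degree < (b : WithBot ℕ) →
      ∀ i, P.coeff i ∈ T)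
    (u v : R[X]) (hu : u.Monic) (hv : v.Monic) (hua : u.natDegree = a) (hvb : v.natDegree = b)
    (huI : ∀ c ∈ T, Ideal.Quotient.mk (Ideal.span {q}) (C c * u) ∈ I)
    (hvI : Ideal.Quotient.mk (Ideal.span {q}) v ∈ I) :
    (∀ ρ, 1 ≤ ρ → ρ ≤ a → ρ ≤ q.natDegree → rtCount q I ρ = 0) ∧
    (∀ ρ, a + 1 ≤ ρ → ρ ≤ b → ρ ≤ q.natDegree → rtCount q I ρ = (Q - 1) * Q ^ (ρ - a - 1)) ∧
    (∀ ρ, b + 1 ≤ ρ → ρ ≤ q.natDegree →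
      rtCount q I ρ = (Q ^ 2 - 1) * Q ^ (2 * ρ - b - a - 2)) := by
  set J := I.comap (Ideal.Quotient.mk (Ideal.span {q})) with hJ
  set B : ℕ → ℕ := fun ρ => Set.ncard {P : R[X] | P ∈ J ∧ P.degree < (ρ : WithBot ℕ)} with hB
  have hcast : ∀ {i j : ℕ}, i ≤ j → ((i : ℕ) : WithBot ℕ) ≤ (j : WithBot ℕ) := by
    intro i j h; exact_mod_cast h
  have hBstep : ∀ (ρ : ℕ) (L : Set R), (∀ P ∈ J, P.degree < ((ρ + 1 : ℕ) : WithBot ℕ) →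
      P.coeff ρ ∈ L) → B (ρ + 1) =
      Set.ncard {P : R[X] | P ∈ J ∧ P.degree < ((ρ + 1 : ℕ) : WithBot ℕ) ∧ P.coeff ρ ∈ L} := by
    intro ρ L hL
    simp only [hB]
    congr 1
    ext P
    simp only [Set.mem_ofPred_eq]
    exact ⟨fun h => ⟨h.1, h.2, hL P h.1 h.2⟩, fun h => ⟨h.1, h.2.1⟩⟩
  have hB0 : B a = 1 := by
    simp only [hB]
    rw [Set.ncard_eq_one]
    refine ⟨0, ?_⟩
    ext P
    simp only [Set.mem_ofPred_eq, Set.mem_singleton_iff]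
    constructor
    · rintro ⟨h, h'⟩; exact h1 P h h'
    · rintro rfl; exact ⟨J.zero_mem, by simp⟩
  have hTL : ∀ ρ, ρ < b → ∀ P ∈ J, P.degree < ((ρ + 1 : ℕ) : WithBot ℕ) → P.coeff ρ ∈ T :=
    fun ρ hρ P hP hd => h2 P hP (hd.trans_le (hcast hρ)) ρ
  have heu : ∀ ρ, a ≤ ρ → ∀ S ⊆ T, Set.ncard {P : R[X] | P ∈ J ∧
      P.degree < ((ρ + 1 : ℕ) : WithBot ℕ) ∧ P.coeff ρ ∈ S} = S.ncard * B ρ := by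
    intro ρ hρ S hS
    exact rtH_count J ρ S _ (rtH_exists J ρ S u hu (by omega) (fun c hc => huI c (hS hc)))
  have hev : ∀ ρ, b ≤ ρ → ∀ S : Set R, Set.ncard {P : R[X] | P ∈ J ∧
      P.degree < ((ρ + 1 : ℕ) : WithBot ℕ) ∧ P.coeff ρ ∈ S} = S.ncard * B ρ := by
    intro ρ hρ S
    exact rtH_count J ρ S _ (rtH_exists J ρ S v hv (by omega)
      (fun c hc => J.mul_mem_left _ hvI))
  have hBa : ∀ j, a + j ≤ b → B (a + j) = Q ^ j := by
    intro j
    induction j with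
    | zero => intro _; simpa using hB0
    | succ j ih =>
      intro h
      rw [← add_assoc, hBstep (a + j) T (hTL _ (by omega)), heu _ (by omega) T subset_rfl,
        ih (by omega), hT, pow_succ, mul_comm]
  have hBb : ∀ j, B (b + j) = Q ^ (b - a + 2 * j) := by
    intro j
    induction j with
    | zero =>
      have := hBa (b - a) (by omega)
      rw [Nat.add_sub_cancel' hab] at this
      simpa using this
    | succ j ih =>
      rw [← add_assoc, hBstep (b + j) Set.univ (fun _ _ _ => Set.mem_univ _),
        hev _ (by omega) _, ih, Set.ncard_univ, hR, ← pow_add]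
      congr 1; ring
  refine ⟨?_, ?_, ?_⟩
  · intro ρ h h' hq'
    obtain ⟨ρ, rfl⟩ : ∃ r, ρ = r + 1 := ⟨ρ - 1, by omega⟩
    rw [rtH_rtCount q hq I ρ hq' {0}]
    · simp
    · intro P hP hd
      simp [h1 P hP (hd.trans_le (hcast h'))]
  · intro ρ h h' hq'
    obtain ⟨j, rfl⟩ : ∃ r, ρ = a + r + 1 := ⟨ρ - a - 1, by omega⟩
    rw [rtH_rtCount q hq I _ hq' T (hTL _ h'), heu _ (by omega) _ Set.sdiff_subset,
      hBa _ (by omega), Set.ncard_sdiff_singleton_of_mem h0T, hT]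
    congr 2; omega
  · intro ρ h hq'
    obtain ⟨j, rfl⟩ : ∃ r, ρ = b + r + 1 := ⟨ρ - b - 1, by omega⟩
    rw [rtH_rtCount q hq I _ hq' Set.univ (fun _ _ _ => Set.mem_univ _), hev _ (by omega) _,
      hBb, Set.ncard_sdiff_singleton_of_mem (Set.mem_univ _), Set.ncard_univ, hR]
    congr 2; omega

/-- The algebraic facts about the code. -/
lemma rtH_alg {R k : Type} [CommRing R] [Field k] (π : R →+* k)
    (hπ : Function.Surjective π) (γ : R) (hγ2 : γ ^ 2 = 0) (hker : ∀ a, π a = 0 ↔ γ ∣ a)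
    (hann : ∀ a, γ * a = 0 → π a = 0) (f q : R[X]) (hf : f.Monic) (d M : ℕ)
    (hd : f.natDegree = d) (hirr : Irreducible (f.map π)) (hqf : q.map π = (f.map π) ^ M)
    (ω t μ : ℕ) (hμω : μ < ω) (hωM : ω < M) (G : R[X] ⧸ Ideal.span {q})
    (hno : ∀ j ≤ μ, Ideal.Quotient.mk (Ideal.span {q}) (C γ) *
      (Ideal.Quotient.mk (Ideal.span {q}) f) ^ j ∉
      Ideal.span {Ideal.Quotient.mk (Ideal.span {q}) (f ^ ω) +
        Ideal.Quotient.mk (Ideal.span {q}) (C γ * f ^ t) * G})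
    (I : Ideal (R[X] ⧸ Ideal.span {q}))
    (hI : I = Ideal.span {Ideal.Quotient.mk (Ideal.span {q}) (f ^ ω) +
        Ideal.Quotient.mk (Ideal.span {q}) (C γ * f ^ t) * G,
        Ideal.Quotient.mk (Ideal.span {q}) (C γ * f ^ μ)}) :
    (∀ P : R[X], Ideal.Quotient.mk (Ideal.span {q}) P ∈ I →
      P.degree < ((d * μ : ℕ) : WithBot ℕ) → P = 0) ∧
    (∀ P : R[X], Ideal.Quotient.mk (Ideal.span {q}) P ∈ I →
      P.degree < ((d * ω : ℕ) : WithBot ℕ) → ∀ i, γ ∣ P.coeff i) ∧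
    (∃ v : R[X], v.Monic ∧ v.natDegree = d * ω ∧ Ideal.Quotient.mk (Ideal.span {q}) v ∈ I) := by
  haveI : Nontrivial R := π.domain_nontrivial
  have hπγ : π γ = 0 := (hker γ).2 dvd_rfl
  have hCγ2 : (C γ : R[X]) * C γ = 0 := by rw [← C_mul, ← pow_two, hγ2, C_0]
  have hfm : (f.map π).Monic := hf.map π
  have hfd : (f.map π).natDegree = d := by rw [hf.natDegree_map, hd]
  have hdeg : ∀ j, ((f.map π) ^ j).degree = ((d * j : ℕ) : WithBot ℕ) := by
    intro j
    rw [degree_eq_natDegree (hfm.pow j).ne_zero, hfm.natDegree_pow, hfd, mul_comm]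
  have hlift : ∀ P : R[X], P.map π = 0 → ∃ a, P = C γ * a := by
    intro P hP
    have : C γ ∣ P := by
      rw [C_dvd_iff_dvd_coeff]
      intro i
      rw [← hker, ← coeff_map, hP, coeff_zero]
    exact this
  -- elements of the code reduce to multiples of f^ω
  have hres : ∀ P : R[X], Ideal.Quotient.mk (Ideal.span {q}) P ∈ I →
      (f.map π) ^ ω ∣ P.map π := by
    intro P hP
    let φ0 : R[X] →+* k[X] ⧸ Ideal.span {(f.map π) ^ ω} :=
      (Ideal.Quotient.mk _).comp (mapRingHom π)
    have hφ0 : ∀ x ∈ Ideal.span {q}, φ0 x = 0 := by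
      intro x hx
      obtain ⟨y, rfl⟩ := Ideal.mem_span_singleton.1 hx
      rw [map_mul]
      have : φ0 q = 0 := by
        simp only [φ0, RingHom.comp_apply, coe_mapRingHom]
        rw [Ideal.Quotient.eq_zero_iff_mem, Ideal.mem_span_singleton, hqf]
        exact pow_dvd_pow _ hωM.le
      rw [this, zero_mul]
    let φ : R[X] ⧸ Ideal.span {q} →+* k[X] ⧸ Ideal.span {(f.map π) ^ ω} :=
      Ideal.Quotient.lift _ φ0 hφ0
    have hφ : ∀ x, φ (Ideal.Quotient.mk _ x) = φ0 x := fun x => Ideal.Quotient.lift_mk _ _ _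
    have hφγ : φ0 (C γ) = 0 := by
      simp [φ0, hπγ]
    have hφf : φ0 (f ^ ω) = 0 := by
      simp only [φ0, RingHom.comp_apply, coe_mapRingHom]
      rw [Ideal.Quotient.eq_zero_iff_mem, Ideal.mem_span_singleton, Polynomial.map_pow]
    have hle : I ≤ RingHom.ker φ := by
      rw [hI, Ideal.span_le]
      rintro x (rfl | rfl)
      · simp only [SetLike.mem_coe, RingHom.mem_ker]
        rw [map_add, map_mul, hφ, hφ, hφf, map_mul, hφγ]
        simp
      · simp only [SetLike.mem_coe, RingHom.mem_ker]
        rw [hφ, map_mul, hφγ, zero_mul]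
    have h := hle hP
    rw [RingHom.mem_ker, hφ] at h
    simp only [φ0, RingHom.comp_apply, coe_mapRingHom] at h
    rwa [Ideal.Quotient.eq_zero_iff_mem, Ideal.mem_span_singleton] at h
  have h2 : ∀ P : R[X], Ideal.Quotient.mk (Ideal.span {q}) P ∈ I →
      P.degree < ((d * ω : ℕ) : WithBot ℕ) → P.map π = 0 := by
    intro P hP hPd
    by_contra hne
    have := degree_le_of_dvd (hres P hP) hne
    rw [hdeg] at this
    exact absurd (this.trans degree_map_le) (not_le.2 hPd)
  have hu : Ideal.Quotient.mk (Ideal.span {q}) (C γ * f ^ μ) ∈ I := by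
    rw [hI]; exact Ideal.subset_span (by simp)
  -- nilpotency of f
  have hnil : IsNilpotent (Ideal.Quotient.mk (Ideal.span {q}) f) := by
    obtain ⟨e, he⟩ := hlift (f ^ M - q) (by
      rw [Polynomial.map_sub, Polynomial.map_pow, hqf, sub_self])
    refine ⟨M * 2, ?_⟩
    rw [← map_pow, Ideal.Quotient.eq_zero_iff_mem, Ideal.mem_span_singleton, pow_mul]
    have : f ^ M = q + C γ * e := by rw [← he]; ring
    rw [this]
    exact ⟨q + 2 * C γ * e, by linear_combination e ^ 2 * hCγ2⟩
  have hno' : ∀ j < μ, Ideal.Quotient.mk (Ideal.span {q}) (C γ * f ^ j) ∉ I := by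
    intro j hj hmem
    rw [hI, Ideal.mem_span_pair] at hmem
    obtain ⟨A, B, hAB⟩ := hmem
    have hun : IsUnit (1 - (Ideal.Quotient.mk (Ideal.span {q}) f) ^ (μ - j) * B) := by
      apply IsNilpotent.isUnit_one_sub
      exact Commute.isNilpotent_mul_right (Commute.all _ _) (hnil.pow_of_pos (by omega))
    obtain ⟨w, hw⟩ := hun.exists_right_inv
    apply hno j hj.le
    rw [Ideal.mem_span_singleton']
    refine ⟨A * w, ?_⟩
    have hpow : (Ideal.Quotient.mk (Ideal.span {q}) f) ^ μ =
      (Ideal.Quotient.mk (Ideal.span {q}) f) ^ j *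
        (Ideal.Quotient.mk (Ideal.span {q}) f) ^ (μ - j) := by
      rw [← pow_add]; congr 1; omega
    simp only [map_mul, map_pow] at hAB ⊢
    rw [hpow] at hAB
    linear_combination w * hAB + (Ideal.Quotient.mk (Ideal.span {q})) (C γ) *
      (Ideal.Quotient.mk (Ideal.span {q})) f ^ j * hw
  refine ⟨?_, ?_, ?_⟩
  · intro P hP hPd
    have hP0 : P.map π = 0 := h2 P hP (hPd.trans_le (by
      exact_mod_cast Nat.mul_le_mul_left d hμω.le))
    obtain ⟨a, rfl⟩ := hlift P hP0
    have had : (a.map π).degree < ((d * μ : ℕ) : WithBot ℕ) := by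
      rw [degree_lt_iff_coeff_zero] at hPd ⊢
      intro i hi
      rw [coeff_map]
      apply hann
      rw [← coeff_C_mul]
      exact hPd i hi
    by_cases ha0 : a.map π = 0
    · obtain ⟨e, rfl⟩ := hlift a ha0
      rw [← mul_assoc, hCγ2, zero_mul]
    exfalso
    have hfin : FiniteMultiplicity (f.map π) (a.map π) :=
      FiniteMultiplicity.of_not_isUnit hirr.not_isUnit ha0
    obtain ⟨w, hw, hndvd⟩ := hfin.exists_eq_pow_mul_and_not_dvd
    set j := multiplicity (f.map π) (a.map π) with hj
    have hjμ : j < μ := by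
      by_contra hle
      have hdv : (f.map π) ^ μ ∣ a.map π := by
        rw [hw]; exact (pow_dvd_pow _ (not_lt.1 hle)).mul_right _
      have := degree_le_of_dvd hdv ha0
      rw [hdeg] at this
      exact absurd this (not_le.2 had)
    have hcop : IsCoprime ((f.map π) ^ M) w :=
      ((Irreducible.coprime_iff_not_dvd hirr).2 hndvd).pow_left
    obtain ⟨x, y, hxy⟩ := hcop
    obtain ⟨x', rfl⟩ := Polynomial.map_surjective π hπ x
    obtain ⟨y', rfl⟩ := Polynomial.map_surjective π hπ y
    obtain ⟨e, he⟩ := hlift (f ^ j - y' * a - x' * q * f ^ j) (by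
      simp only [Polynomial.map_sub, Polynomial.map_mul, Polynomial.map_pow, hqf]
      rw [hw]
      linear_combination -(f.map π) ^ j * hxy)
    apply hno' j hjμ
    have heq : C γ * f ^ j = y' * (C γ * a) + (C γ * x' * f ^ j) * q := by
      linear_combination C γ * he + e * hCγ2
    rw [heq, map_add, map_mul _ y', map_mul _ _ q]
    refine I.add_mem (I.mul_mem_left _ hP) (I.mul_mem_left _ ?_)
    rw [Ideal.Quotient.eq_zero_iff_mem.2 (Ideal.mem_span_singleton_self q)]
    exact I.zero_mem
  · intro P hP hPd i
    rw [← hker, ← coeff_map, h2 P hP hPd, coeff_zero]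
  · obtain ⟨G', rfl⟩ := Ideal.Quotient.mk_surjective G
    have hfω : (f ^ ω).Monic := hf.pow ω
    have hfμ : (f ^ μ).Monic := hf.pow μ
    have hdpos : 0 < d := by rw [← hfd]; exact hirr.natDegree_pos
    have hlt : (C γ * ((f ^ t * G') %ₘ (f ^ μ))).degree < (f ^ ω).degree := by
      refine (rtH_degC _ _).trans_lt ((degree_modByMonic_lt _ hfμ).trans ?_)
      rw [degree_eq_natDegree hfμ.ne_zero, degree_eq_natDegree hfω.ne_zero,
        hf.natDegree_pow, hf.natDegree_pow, hd]
      exact_mod_cast Nat.mul_lt_mul_of_pos_right hμω hdpos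
    refine ⟨f ^ ω + C γ * ((f ^ t * G') %ₘ (f ^ μ)), hfω.add_of_left hlt, ?_, ?_⟩
    · rw [natDegree_add_eq_left_of_degree_lt hlt, hf.natDegree_pow, hd, mul_comm]
    · have heq : f ^ ω + C γ * ((f ^ t * G') %ₘ (f ^ μ)) =
        (f ^ ω + C γ * f ^ t * G') - ((f ^ t * G') /ₘ (f ^ μ)) * (C γ * f ^ μ) := by
        rw [modByMonic_eq_sub_mul_div]; ring
      rw [heq, map_sub, map_mul _ (_ /ₘ _)]
      refine I.sub_mem ?_ (I.mul_mem_left _ hu)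
      rw [map_add, map_mul _ _ G', hI]
      exact Ideal.subset_span (by simp)

end RTHelpers

/-- RT weight distribution of the Type IV codes
`⟨f^ω + γ f^t G, γ f^μ⟩` of `K = R[x]/⟨x^{np^s} − α₀^{p^s}⟩`. -/
theorem stmt15 {R : Type} [CommRing R] [Finite R]
    (p m s n : ℕ) (hp : p.Prime) (hm : 0 < m) (hs : 0 < s) (hn : 0 < n)
    (hnp : Nat.gcd n p = 1)
    (γ : R) (hγ : γ ≠ 0) (hγ2 : γ ^ 2 = 0)
    (hmax : ∀ a : R, a ∈ Ideal.span {γ} ↔ ¬ IsUnit a)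
    (hres : Nat.card (R ⧸ Ideal.span {γ}) = p ^ m)
    (α₀ : R) (hα₀ : IsUnit α₀)
    (hirr : Irreducible ((X ^ n - C α₀ : R[X]).map (Ideal.Quotient.mk (Ideal.span {γ}))))
    (ω t μ : ℕ) (G : R[X] ⧸ Ideal.span {(X ^ (n * p ^ s) - C (α₀ ^ p ^ s) : R[X])})
    (hμω : μ < ω) (hω : ω < p ^ s) (hG : G = 0 ∨ IsUnit G) (ht : G ≠ 0 → t < μ)
    (κ : ℕ)
    (hκ : IsLeast {k : ℕ |
      Ideal.Quotient.mk (Ideal.span {(X ^ (n * p ^ s) - C (α₀ ^ p ^ s) : R[X])}) (C γ) *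
        (Ideal.Quotient.mk (Ideal.span {(X ^ (n * p ^ s) - C (α₀ ^ p ^ s) : R[X])})
          (X ^ n - C α₀)) ^ k ∈
      Ideal.span {Ideal.Quotient.mk
          (Ideal.span {(X ^ (n * p ^ s) - C (α₀ ^ p ^ s) : R[X])})
          ((X ^ n - C α₀) ^ ω) +
        Ideal.Quotient.mk (Ideal.span {(X ^ (n * p ^ s) - C (α₀ ^ p ^ s) : R[X])})
          (C γ * (X ^ n - C α₀) ^ t) * G}} κ)
    (hμκ : μ < κ) :
    rtCount (X ^ (n * p ^ s) - C (α₀ ^ p ^ s))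
      (Ideal.span {Ideal.Quotient.mk
          (Ideal.span {(X ^ (n * p ^ s) - C (α₀ ^ p ^ s) : R[X])})
          ((X ^ n - C α₀) ^ ω) +
        Ideal.Quotient.mk (Ideal.span {(X ^ (n * p ^ s) - C (α₀ ^ p ^ s) : R[X])})
          (C γ * (X ^ n - C α₀) ^ t) * G,
        Ideal.Quotient.mk (Ideal.span {(X ^ (n * p ^ s) - C (α₀ ^ p ^ s) : R[X])})
          (C γ * (X ^ n - C α₀) ^ μ)}) 0 = 1 ∧
    (∀ ρ, 1 ≤ ρ → ρ ≤ n * μ →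
      rtCount (X ^ (n * p ^ s) - C (α₀ ^ p ^ s))
        (Ideal.span {Ideal.Quotient.mk
            (Ideal.span {(X ^ (n * p ^ s) - C (α₀ ^ p ^ s) : R[X])})
            ((X ^ n - C α₀) ^ ω) +
          Ideal.Quotient.mk (Ideal.span {(X ^ (n * p ^ s) - C (α₀ ^ p ^ s) : R[X])})
            (C γ * (X ^ n - C α₀) ^ t) * G,
          Ideal.Quotient.mk (Ideal.span {(X ^ (n * p ^ s) - C (α₀ ^ p ^ s) : R[X])})
            (C γ * (X ^ n - C α₀) ^ μ)}) ρ = 0) ∧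
    (∀ ρ, n * μ + 1 ≤ ρ → ρ ≤ n * ω →
      rtCount (X ^ (n * p ^ s) - C (α₀ ^ p ^ s))
        (Ideal.span {Ideal.Quotient.mk
            (Ideal.span {(X ^ (n * p ^ s) - C (α₀ ^ p ^ s) : R[X])})
            ((X ^ n - C α₀) ^ ω) +
          Ideal.Quotient.mk (Ideal.span {(X ^ (n * p ^ s) - C (α₀ ^ p ^ s) : R[X])})
            (C γ * (X ^ n - C α₀) ^ t) * G,
          Ideal.Quotient.mk (Ideal.span {(X ^ (n * p ^ s) - C (α₀ ^ p ^ s) : R[X])})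
            (C γ * (X ^ n - C α₀) ^ μ)}) ρ = (p ^ m - 1) * p ^ (m * (ρ - n * μ - 1))) ∧
    (∀ ρ, n * ω + 1 ≤ ρ → ρ ≤ n * p ^ s →
      rtCount (X ^ (n * p ^ s) - C (α₀ ^ p ^ s))
        (Ideal.span {Ideal.Quotient.mk
            (Ideal.span {(X ^ (n * p ^ s) - C (α₀ ^ p ^ s) : R[X])})
            ((X ^ n - C α₀) ^ ω) +
          Ideal.Quotient.mk (Ideal.span {(X ^ (n * p ^ s) - C (α₀ ^ p ^ s) : R[X])})
            (C γ * (X ^ n - C α₀) ^ t) * G,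
          Ideal.Quotient.mk (Ideal.span {(X ^ (n * p ^ s) - C (α₀ ^ p ^ s) : R[X])})
            (C γ * (X ^ n - C α₀) ^ μ)}) ρ =
        (p ^ (2 * m) - 1) * p ^ (m * (2 * ρ - n * ω - n * μ - 2))) := by
  classical
  haveI : Nontrivial R := ⟨⟨γ, 0, hγ⟩⟩
  haveI hM : (Ideal.span {γ}).IsMaximal := by
    rw [Ideal.isMaximal_iff]
    refine ⟨fun h => (hmax 1).1 h isUnit_one, ?_⟩
    intro J x _ hx hxJ
    have hux : IsUnit x := by
      by_contra h; exact hx ((hmax x).2 h)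
    exact (Ideal.eq_top_iff_one J).1 (Ideal.eq_top_of_isUnit_mem J hxJ hux)
  letI : Field (R ⧸ Ideal.span {γ}) := Ideal.Quotient.field _
  have hker : ∀ a, Ideal.Quotient.mk (Ideal.span {γ}) a = 0 ↔ γ ∣ a := fun a => by
    rw [Ideal.Quotient.eq_zero_iff_mem, Ideal.mem_span_singleton]
  have hann : ∀ a, γ * a = 0 → Ideal.Quotient.mk (Ideal.span {γ}) a = 0 := by
    intro a ha
    rw [Ideal.Quotient.eq_zero_iff_mem, hmax]
    intro hu
    exact hγ ((hu.mul_left_eq_zero).1 ha)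
  haveI : Fact p.Prime := ⟨hp⟩
  haveI : CharP (R ⧸ Ideal.span {γ}) p := by
    rw [CharP.charP_iff_prime_eq_zero hp]
    have h : ((p ^ m : ℕ) : R ⧸ Ideal.span {γ}) = 0 := by
      rw [← hres]
      haveI : Finite (R ⧸ Ideal.span {γ}) :=
        Finite.of_surjective _ (Ideal.Quotient.mk_surjective (I := Ideal.span {γ}))
      haveI := Fintype.ofFinite (R ⧸ Ideal.span {γ})
      rw [Nat.card_eq_fintype_card]
      exact Nat.cast_card_eq_zero _
    rw [Nat.cast_pow] at h
    exact pow_eq_zero_iff (by omega) |>.1 h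
  have hps : 0 < p ^ s := pow_pos hp.pos s
  have hN : n * p ^ s ≠ 0 := by positivity
  have hqf : (X ^ (n * p ^ s) - C (α₀ ^ p ^ s) : R[X]).map (Ideal.Quotient.mk (Ideal.span {γ})) =
      ((X ^ n - C α₀ : R[X]).map (Ideal.Quotient.mk (Ideal.span {γ}))) ^ (p ^ s) := by
    simp only [Polynomial.map_sub, Polynomial.map_pow, map_X, map_C]
    rw [sub_pow_char_pow, ← pow_mul, map_pow, C_pow]
  have hfmon : (X ^ n - C α₀ : R[X]).Monic := monic_X_pow_sub_C _ hn.ne'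
  have hqmon : (X ^ (n * p ^ s) - C (α₀ ^ p ^ s) : R[X]).Monic := monic_X_pow_sub_C _ hN
  have hfd : (X ^ n - C α₀ : R[X]).natDegree = n := natDegree_X_pow_sub_C
  have hqd : (X ^ (n * p ^ s) - C (α₀ ^ p ^ s) : R[X]).natDegree = n * p ^ s :=
    natDegree_X_pow_sub_C
  obtain ⟨h1, h2, v, hv, hvd, hvI⟩ := rtH_alg (Ideal.Quotient.mk (Ideal.span {γ}))
    Ideal.Quotient.mk_surjective γ hγ2 hker hann _ _ hfmon n (p ^ s) hfd hirr hqf ω t μ hμω hω G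
    (fun j hj hmem => absurd (hκ.2 hmem) (not_le.2 (hj.trans_lt hμκ))) _ rfl
  -- cardinalities
  have hTc : ((Ideal.span {γ} : Ideal R) : Set R).ncard = p ^ m := by
    have hr : (LinearMap.toSpanSingleton R R γ).range = Ideal.span {γ} := by
      rw [LinearMap.range_toSpanSingleton]
    have hk : (LinearMap.toSpanSingleton R R γ).ker = Ideal.span {γ} := by
      ext a
      rw [LinearMap.mem_ker, LinearMap.toSpanSingleton_apply, smul_eq_mul]
      constructor
      · intro h
        rw [← Ideal.Quotient.eq_zero_iff_mem]
        exact hann a (by rw [mul_comm]; exact h)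
      · intro h
        obtain ⟨b, rfl⟩ := Ideal.mem_span_singleton.1 h
        linear_combination b * hγ2
    have e := (LinearMap.toSpanSingleton R R γ).quotKerEquivRange
    rw [hk, hr] at e
    rw [← hres, Nat.card_congr e.toEquiv]
    rfl
  have hRc : Nat.card R = (p ^ m) ^ 2 := by
    have := Submodule.card_eq_card_quotient_mul_card (Ideal.span {γ} : Ideal R)
    rw [this, pow_two]
    first
      | exact congrArg₂ _ hres hTc
      | exact congrArg₂ _ hTc hres
  have hmain := rtH_main _ hqmon _ (n * μ) (n * ω) (p ^ m) (Nat.mul_le_mul_left n hμω.le)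
    (Ideal.span {γ} : Ideal R) (Ideal.zero_mem _) hTc hRc h1
    (fun P hP hd i => Ideal.mem_span_singleton.2 (h2 P hP hd i))
    ((X ^ n - C α₀) ^ μ) v (hfmon.pow μ) hv (by rw [hfmon.natDegree_pow, hfd, mul_comm]) hvd
    (by
      intro c hc
      obtain ⟨b, rfl⟩ := Ideal.mem_span_singleton.1 hc
      have : C (γ * b) * (X ^ n - C α₀) ^ μ = C b * (C γ * (X ^ n - C α₀) ^ μ) := by
        rw [C_mul]; ring
      rw [this, map_mul _ (C b)]
      apply Ideal.mul_mem_left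
      apply Ideal.subset_span
      exact Set.mem_insert_of_mem _ (Set.mem_singleton _))
    hvI
  rw [hqd] at hmain
  obtain ⟨c1, c2, c3⟩ := hmain
  have hωN : n * ω ≤ n * p ^ s := Nat.mul_le_mul_left n hω.le
  have hμN : n * μ ≤ n * ω := Nat.mul_le_mul_left n hμω.le
  refine ⟨rtH_zero _ _, ?_, ?_, ?_⟩
  · intro ρ hρ1 hρ2
    exact c1 ρ hρ1 hρ2 (by omega)
  · intro ρ hρ1 hρ2
    rw [c2 ρ hρ1 hρ2 (by omega), ← pow_mul]
  · intro ρ hρ1 hρ2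
    rw [c3 ρ hρ1 hρ2, ← pow_mul, ← pow_mul, mul_comm m 2]
end
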